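/- No balanced triangulation of the dunce hat on exactly 10 vertices exists. Combined with the lower bound f_0 ≥ 10, the minimum number of vertices of a balanced triangulation of the dunce hat is 11, attained by an explicit complex Δ^{DH} with f-vector (1, 11, 34, 24). -/

import Mathlib

open Finset

variable {V : Type} [DecidableEq V] {W : Type} [DecidableEq W]

/-- An abstract simplicial complex, given by its finite set of (nonempty) faces. -/
def IsCplx (K : Finset (Finset V)) : Prop :=
  ∅ ∉ K ∧ ∀ F ∈ K, ∀ G, G ⊆ F → G ≠ ∅ → G ∈ K

/-- The vertex set of a complex. -/
def verts (K : Finset (Finset V)) : Finset V := K.sup id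

/-- The number of `i`-dimensional faces. -/
def fnum (K : Finset (Finset V)) (i : ℕ) : ℕ := (K.filter fun F => F.card = i + 1).card

/-- The link of a face. -/
def link (K : Finset (Finset V)) (F : Finset V) : Finset (Finset V) :=
  K.filter fun G => Disjoint G F ∧ G ∪ F ∈ K

/-- A complex is pure `d`-dimensional. -/
def PureC (d : ℕ) (K : Finset (Finset V)) : Prop :=
  (∀ F ∈ K, F.card ≤ d + 1) ∧ ∀ F ∈ K, ∃ G ∈ K, F ⊆ G ∧ G.card = d + 1

/-- A proper `(d+1)`-coloring of the vertices. -/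
def ProperColoring (d : ℕ) (K : Finset (Finset V)) (κ : V → Fin (d + 1)) : Prop :=
  ∀ F ∈ K, Set.InjOn κ ↑F

/-- A `d`-dimensional complex is balanced if its graph is `(d+1)`-colorable. -/
def BalancedC (d : ℕ) (K : Finset (Finset V)) : Prop :=
  ∃ κ : V → Fin (d + 1), ProperColoring d K κ

/-- Connectivity of the underlying graph. -/
def Conn (K : Finset (Finset V)) : Prop :=
  ∀ u ∈ verts K, ∀ w ∈ verts K,
    Relation.ReflTransGen (fun a b => ({a, b} : Finset V) ∈ K) u w

/-- Isomorphism onto. -/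
def IsoTo (K : Finset (Finset V)) (L : Finset (Finset W)) : Prop :=
  ∃ f : V → W, Set.InjOn f ↑(verts K) ∧ L = K.image (Finset.image f)

/-- The boundary complex of the `(d+1)`-dimensional cross-polytope. -/
def stdCross (d : ℕ) : Finset (Finset (Fin (d + 1) × Bool)) :=
  (univ : Finset (Fin (d + 1) × Bool)).powerset.filter fun F =>
    F ≠ ∅ ∧ ∀ p ∈ F, ∀ q ∈ F, Prod.fst p = Prod.fst q → p = q

/-- The geometric realization of a simplicial complex. -/
def geomReal [Fintype V] (K : Finset (Finset V)) : Set (V → ℝ) :=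
  {f | (∀ v, 0 ≤ f v) ∧ (∑ v, f v) = 1 ∧ ∃ F ∈ K, {v | f v ≠ 0} = ↑F}

/-- Straight-line path on the edge from vertex `a` to vertex `b` of the triangle. -/
def epath (a b : Fin 3) (t : ℝ) : Fin 3 → ℝ := fun i => if i = a then 1 - t else if i = b then t else 0

/-- Identifications giving the dunce hat (boundary word `a a a⁻¹`). -/
def dhRel (x y : stdSimplex ℝ (Fin 3)) : Prop :=
  ∃ t : ℝ, 0 ≤ t ∧ t ≤ 1 ∧
    ((x.val = epath 0 1 t ∧ y.val = epath 1 2 t) ∨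
     (x.val = epath 0 1 t ∧ y.val = epath 0 2 t))

/-- The dunce hat: quotient of a triangle identifying its edges non-coherently. -/
def DunceHat : Type := Quot dhRel

instance : TopologicalSpace DunceHat := by unfold DunceHat; infer_instance

/-- A 1-dimensional complex is a circle (a triangulation of `S¹`). -/
def IsCircle (L : Finset (Finset V)) : Prop :=
  (∀ F ∈ L, F.card ≤ 2) ∧ (verts L).Nonempty ∧
  (∀ v ∈ verts L, (L.filter fun e => e.card = 2 ∧ v ∈ e).card = 2) ∧ Conn L

open scoped Classical in
/-- The vertices on the singular set: those whose link is not a circle. -/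
noncomputable def singVerts (K : Finset (Finset V)) : Finset V :=
  (verts K).filter fun v => ¬IsCircle (link K ({v} : Finset V))

/-- A triangulation of the dunce hat. -/
def IsDunceHatTri [Fintype V] (K : Finset (Finset V)) : Prop :=
  IsCplx K ∧ Nonempty (geomReal K ≃ₜ DunceHat)

set_option linter.unusedSectionVars false
set_option linter.unusedSimpArgs false

section LogPart
open Topology Set
variable {E : Type*} [NormedAddCommGroup E] [NormedSpace ℝ E]
variable {Ef : Type*} [NormedAddCommGroup Ef] [NormedSpace ℝ Ef]

/-- A function has a continuous logarithm on `S`. -/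
def HasLog (S : Set E) (f : E → ℂ) : Prop :=
  ∃ g : E → ℂ, ContinuousOn g S ∧ ∀ u ∈ S, f u = Complex.exp (g u)

theorem hasLog_of_starConvex {S : Set E} {p : E} {f : E → ℂ} (hS : StarConvex ℝ p S) (hp : p ∈ S)
    (hf : ContinuousOn f S) (h0 : ∀ u ∈ S, f u ≠ 0) : HasLog S f := by
  have hmem : ∀ (t : unitInterval) (u : S), p + (t : ℝ) • ((u : E) - p) ∈ S := by
    intro t u
    exact hS.add_smul_sub_mem u.2 t.2.1 t.2.2
  let H : C(unitInterval × S, {z : ℂ // z ≠ 0}) :=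
    ⟨fun q => ⟨f (p + (q.1 : ℝ) • ((q.2 : E) - p)), h0 _ (hmem q.1 q.2)⟩, by
      refine Continuous.subtype_mk ?_ _
      refine hf.comp_continuous ?_ (fun q => hmem q.1 q.2)
      fun_prop⟩
  let f0 : C(S, ℂ) := ⟨fun _ => Complex.log (f p), continuous_const⟩
  have H0 : ∀ a, H (0, a) = (fun z : ℂ ↦ (⟨_, z.exp_ne_zero⟩ : {z : ℂ // z ≠ 0})) (f0 a) := by
    intro a
    apply Subtype.ext
    simp [H, f0, Complex.exp_log (h0 p hp)]
  let L := Complex.isCoveringMap_exp.liftHomotopy H f0 H0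
  have hL := Complex.isCoveringMap_exp.liftHomotopy_lifts H f0 H0
  classical
  refine ⟨fun u => if h : u ∈ S then L (1, ⟨u, h⟩) else 0, ?_, ?_⟩
  · rw [continuousOn_iff_continuous_domRestrict]
    have : S.domRestrict (fun u => if h : u ∈ S then L (1, ⟨u, h⟩) else 0) = fun u : S => L (1, u) := by
      funext u
      simp
    rw [this]
    fun_prop
  · intro u hu
    simp only [hu, dif_pos]
    have := congrArg Subtype.val (congrFun hL (1, ⟨u, hu⟩))
    simp only [Function.comp] at this
    rw [show L = Complex.isCoveringMap_exp.liftHomotopy H f0 H0 from rfl, this]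
    simp [H]

theorem log_diff_const {S : Set E} (hS : IsPreconnected S) {g h : E → ℂ} (hg : ContinuousOn g S)
    (hh : ContinuousOn h S) (he : ∀ u ∈ S, Complex.exp (g u) = Complex.exp (h u)) {a b : E}
    (ha : a ∈ S) (hb : b ∈ S) : g b - g a = h b - h a := by
  have hg2 : ContinuousOn (fun u => h u + (g a - h a)) S := hh.add continuousOn_const
  have key := Complex.isCoveringMap_exp.eqOn_of_comp_eqOn hS hg hg2 ?_ ha (by ring)
  · have := key hb
    simp only at this
    rw [this]; ring
  · intro u hu
    apply Subtype.ext
    have h1 : Complex.exp (g a - h a) = 1 := by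
      rw [Complex.exp_sub, he a ha, div_self (Complex.exp_ne_zero _)]
    simp [Complex.exp_add, h1, he u hu]

theorem glue_closed {ι : Type*} [Finite ι] {S : Set E} (C : ι → Set E) (hC : ∀ i, IsClosed (C i))
    (hcov : S ⊆ ⋃ i, C i) (g : ι → E → ℂ) (hg : ∀ i, ContinuousOn (g i) (S ∩ C i))
    (hag : ∀ i j, ∀ u ∈ S, u ∈ C i → u ∈ C j → g i u = g j u) :
    ∃ G : E → ℂ, ContinuousOn G S ∧ ∀ i, ∀ u ∈ S, u ∈ C i → G u = g i u := by
  classical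
  let G : E → ℂ := fun u => if h : ∃ i, u ∈ C i then g h.choose u else 0
  have hG : ∀ i, ∀ u ∈ S, u ∈ C i → G u = g i u := by
    intro i u hu hi
    have h : ∃ i, u ∈ C i := ⟨i, hi⟩
    simp only [G, h, dif_pos]
    exact hag _ _ u hu h.choose_spec hi
  refine ⟨G, ?_, hG⟩
  rw [continuousOn_iff_continuous_domRestrict]
  refine (locallyFinite_of_finite (fun i => (Subtype.val : S → E) ⁻¹' C i)).continuous ?_ ?_ ?_
  · ext u
    simpa using hcov u.2
  · intro i
    exact (hC i).preimage continuous_subtype_val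
  · intro i
    have h1 : ContinuousOn (fun u : S => g i u) ((Subtype.val : S → E) ⁻¹' C i) :=
      (hg i).comp continuous_subtype_val.continuousOn (fun u hu => ⟨u.2, hu⟩)
    exact h1.congr (fun u hu => hG i u u.2 hu)

theorem exists_int_relation {α β : Type*} [Fintype α] [Fintype β]
    (h : Fintype.card α < Fintype.card β) (M : α → β → ℤ) :
    ∃ n : β → ℤ, n ≠ 0 ∧ ∀ a, ∑ b, n b * M a b = 0 := by
  by_contra hcon
  push Not at hcon
  let f : (β → ℤ) →ₗ[ℤ] (α → ℤ) := Matrix.mulVecLin (Matrix.of M)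
  have hf : Function.Injective f := by
    rw [← LinearMap.ker_eq_bot, LinearMap.ker_eq_bot']
    intro n hn
    by_contra hne
    obtain ⟨a, ha⟩ := hcon n hne
    apply ha
    have := congrFun hn a
    simp only [f, Matrix.mulVecLin_apply, Matrix.mulVec, dotProduct, Matrix.of_apply] at this
    refine Eq.trans ?_ this
    exact Finset.sum_congr rfl (fun b _ => mul_comm _ _)
  have := LinearMap.finrank_le_finrank_of_injective hf
  simp at this
  omega

/-- The dilation towards `x`. -/
def dil (x : E) (s : ℝ) (u : E) : E := x + s • (u - x)

theorem dil_dil_inv (x : E) {s : ℝ} (hs : s ≠ 0) (u : E) : dil x s (dil x s⁻¹ u) = u := by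
  simp [dil, smul_smul, mul_inv_cancel₀ hs]

theorem dil_inv_dil (x : E) {s : ℝ} (hs : s ≠ 0) (u : E) : dil x s⁻¹ (dil x s u) = u := by
  simp [dil, smul_smul, inv_mul_cancel₀ hs]

theorem dil_eq_iff (x : E) {s : ℝ} (hs : s ≠ 0) (u : E) : dil x s u = x ↔ u = x := by
  simp [dil, hs, sub_eq_zero]

theorem continuous_dil (x : E) (s : ℝ) : Continuous (dil x s) := by
  unfold dil; fun_prop

/-- Local rank property: there are multiplicatively independent local functions. -/
def LocRank (X : Set E) (x : E) (ι : Type) [Fintype ι] : Prop :=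
  ∃ N ∈ 𝓝[X] x, N ⊆ X ∧ ∃ F : ι → E → ℂ,
    (∀ i, ContinuousOn (F i) (N \ {x}) ∧ ∀ u ∈ N \ {x}, F i u ≠ 0) ∧
    ∀ N' ∈ 𝓝[X] x, N' ⊆ N → ∀ n : ι → ℤ, n ≠ 0 →
      ¬ HasLog (N' \ {x}) (fun u => ∏ i, F i u ^ n i)

/-- A homeomorphism between two subsets, given by global functions. -/
structure HP (X : Set E) (Y : Set Ef) where
  φ : E → Ef
  ψ : Ef → E
  φc : ContinuousOn φ X
  ψc : ContinuousOn ψ Y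
  φm : MapsTo φ X Y
  ψm : MapsTo ψ Y X
  ψφ : ∀ u ∈ X, ψ (φ u) = u
  φψ : ∀ u ∈ Y, φ (ψ u) = u

/-- The inverse. -/
def HP.symm {X : Set E} {Y : Set Ef} (h : HP X Y) : HP Y X :=
  ⟨h.ψ, h.φ, h.ψc, h.φc, h.ψm, h.φm, h.φψ, h.ψφ⟩

theorem HP.of_homeo {X : Set E} {Y : Set Ef} (e : X ≃ₜ Y) : Nonempty (HP X Y) := by
  classical
  refine ⟨⟨fun u => if h : u ∈ X then (e ⟨u, h⟩ : Ef) else 0,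
    fun u => if h : u ∈ Y then (e.symm ⟨u, h⟩ : E) else 0, ?_, ?_, ?_, ?_, ?_, ?_⟩⟩
  · rw [continuousOn_iff_continuous_domRestrict]
    have : X.domRestrict (fun u => if h : u ∈ X then (e ⟨u, h⟩ : Ef) else 0) = fun u : X => (e u : Ef) := by
      funext u; simp
    rw [this]; fun_prop
  · rw [continuousOn_iff_continuous_domRestrict]
    have : Y.domRestrict (fun u => if h : u ∈ Y then (e.symm ⟨u, h⟩ : E) else 0)
        = fun u : Y => (e.symm u : E) := by
      funext u; simp
    rw [this]; fun_prop
  · intro u hu; simp [hu]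
  · intro u hu; simp [hu]
  · intro u hu; simp [hu]
  · intro u hu; simp [hu]

theorem HP.nhds {X : Set E} {Y : Set Ef} (h : HP X Y) {x : E} (hx : x ∈ X) {N : Set E}
    (hN : N ∈ 𝓝[X] x) : Y ∩ h.ψ ⁻¹' N ∈ 𝓝[Y] (h.φ x) := by
  have h1 : Filter.Tendsto h.ψ (𝓝[Y] (h.φ x)) (𝓝[X] x) := by
    have := (h.ψc (h.φ x) (h.φm hx)).tendsto_nhdsWithin h.ψm
    rwa [h.ψφ x hx] at this
  exact Filter.inter_mem self_mem_nhdsWithin (h1 hN)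

theorem LocRank.transfer {X : Set E} {Y : Set Ef} (h : HP X Y) {x : E} (hx : x ∈ X)
    {ι : Type} [Fintype ι] (hr : LocRank X x ι) : LocRank Y (h.φ x) ι := by
  obtain ⟨N, hN, hNX, F, hF, hind⟩ := hr
  have hmaps : MapsTo h.ψ ((Y ∩ h.ψ ⁻¹' N) \ {h.φ x}) (N \ {x}) := by
    rintro u ⟨⟨huY, huN⟩, hux⟩
    refine ⟨huN, fun he => hux ?_⟩
    simp only [mem_singleton_iff] at he ⊢
    rw [← he, h.φψ u huY]
  refine ⟨Y ∩ h.ψ ⁻¹' N, h.nhds hx hN, inter_subset_left, fun i => F i ∘ h.ψ, ?_, ?_⟩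
  · intro i
    refine ⟨(hF i).1.comp (h.ψc.mono (fun u hu => hu.1.1)) hmaps, fun u hu => (hF i).2 _ (hmaps hu)⟩
  · intro N' hN' hsub n hn hlog
    obtain ⟨g, hg, hge⟩ := hlog
    have h2 := h.symm.nhds (h.φm hx) hN'
    have e1 : h.symm.φ (h.φ x) = x := h.ψφ x hx
    rw [e1] at h2
    have hmaps2 : MapsTo h.φ ((X ∩ h.symm.ψ ⁻¹' N') \ {x}) (N' \ {h.φ x}) := by
      rintro u ⟨⟨huX, huN⟩, hux⟩
      refine ⟨huN, fun he => hux ?_⟩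
      simp only [mem_singleton_iff] at he ⊢
      rw [← h.ψφ u huX, he, h.ψφ x hx]
    refine hind _ h2 ?_ n hn ⟨g ∘ h.φ, hg.comp (h.φc.mono (fun u hu => hu.1.1)) hmaps2, ?_⟩
    · rintro u ⟨huX, huN⟩
      have := (hsub huN).2
      simpa [HP.symm, h.ψφ u huX] using this
    · intro u hu
      have := hge _ (hmaps2 hu)
      simpa [h.ψφ u hu.1.1] using this

end LogPart

section BookPart
open Topology Set
variable {E : Type*} [NormedAddCommGroup E] [NormedSpace ℝ E]
variable {Ef : Type*} [NormedAddCommGroup Ef] [NormedSpace ℝ Ef]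

/-- Open book neighbourhood structure of a point. -/
structure Book (X : Set E) (x : E) (ι : Type) [Fintype ι] where
  N : Set E
  P : ι → Set E
  E0 : Set E
  d : E → ℝ
  l : ι → E → ℝ
  p : ι → E
  a : E
  b : E
  NX : N ⊆ X
  Dn : ∀ s : ℝ, 0 < s → s ≤ 1 → dil x s '' N ∈ 𝓝[X] x
  Ds : ∀ s : ℝ, 0 < s → s ≤ 1 → dil x s '' N ⊆ N
  bdd : ∀ U ∈ 𝓝[X] x, ∃ s : ℝ, 0 < s ∧ s ≤ 1 ∧ dil x s '' N ⊆ U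
  Pcl : ∀ i, IsClosed (P i)
  Pst : ∀ i, StarConvex ℝ (p i) (P i \ {x})
  pP : ∀ i, p i ∈ P i \ {x}
  EP : ∀ i, E0 ⊆ P i
  hN : N = E0 ∪ ⋃ i, P i
  dc : Continuous d
  lc : ∀ i, Continuous (l i)
  dh : ∀ s : ℝ, 0 < s → ∀ u, d (dil x s u) = s * d u
  lh : ∀ i, ∀ s : ℝ, 0 < s → ∀ u, l i (dil x s u) = s * l i u
  l0 : ∀ i, ∀ u ∈ P i, 0 ≤ l i u
  lj : ∀ i j, j ≠ i → ∀ u ∈ P j, l i u = 0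
  lE : ∀ i, ∀ u ∈ E0, l i u = 0
  lz : ∀ i, ∀ u ∈ P i, l i u = 0 → u ∈ E0
  dz : ∀ u ∈ E0, d u = 0 → u = x
  aE : a ∈ E0
  bE : b ∈ E0
  da : d a < 0
  db : 0 < d b
  dx : d x = 0
  sta : StarConvex ℝ a {u | u ∈ E0 ∧ d u < 0}
  stb : StarConvex ℝ b {u | u ∈ E0 ∧ 0 < d u}

namespace Book
variable {X : Set E} {x : E} {ι : Type} [Fintype ι] [DecidableEq ι]

/-- The standard functions. -/
noncomputable def fn (B : Book X x ι) (i : ι) (u : E) : ℂ :=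
  ⟨B.d u, B.l i u - ∑ j ∈ Finset.univ.erase i, B.l j u⟩

theorem fn_cont (B : Book X x ι) (i : ι) : Continuous (B.fn i) := by
  have h1 : Continuous fun u => B.l i u - ∑ j ∈ Finset.univ.erase i, B.l j u :=
    (B.lc i).sub (continuous_finsetSum _ fun j _ => B.lc j)
  have : B.fn i = fun u => (B.d u : ℂ) +
      ((B.l i u - ∑ j ∈ Finset.univ.erase i, B.l j u : ℝ) : ℂ) * Complex.I := by
    funext u
    apply Complex.ext <;> simp [fn]
  rw [this]
  exact (Complex.continuous_ofReal.comp B.dc).add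
    ((Complex.continuous_ofReal.comp h1).mul continuous_const)

theorem fn_same (B : Book X x ι) (i : ι) {u : E} (hu : u ∈ B.P i) : B.fn i u = ⟨B.d u, B.l i u⟩ := by
  have : ∑ j ∈ Finset.univ.erase i, B.l j u = 0 := by
    apply Finset.sum_eq_zero
    intro j hj
    exact B.lj j i (Finset.ne_of_mem_erase hj).symm u hu
  simp [fn, this]

theorem fn_diff (B : Book X x ι) {i j : ι} (hij : j ≠ i) {u : E} (hu : u ∈ B.P j) :
    B.fn i u = ⟨B.d u, - B.l j u⟩ := by
  have h1 : ∑ k ∈ Finset.univ.erase i, B.l k u = B.l j u := by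
    apply Finset.sum_eq_single_of_mem j (by simp [hij])
    intro k hk hkj
    exact B.lj k j hkj.symm u hu
  simp [fn, h1, B.lj i j hij u hu]

theorem page_ne (B : Book X x ι) (j : ι) {u : E} (hu : u ∈ B.P j \ {x}) : 0 < B.l j u ∨ B.d u ≠ 0 := by
  by_contra hcon
  push Not at hcon
  have h1 : B.l j u = 0 := le_antisymm hcon.1 (B.l0 j u hu.1)
  exact hu.2 (B.dz u (B.lz j u hu.1 h1) hcon.2)

theorem fn_ne (B : Book X x ι) (i : ι) {u : E} (hu : u ∈ B.N \ {x}) : B.fn i u ≠ 0 := by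
  intro h0
  have hd : B.d u = 0 := by simpa [fn] using congrArg Complex.re h0
  have huN := hu.1
  rw [B.hN] at huN
  rcases huN with h | h
  · exact hu.2 (B.dz u h hd)
  · simp only [mem_iUnion] at h
    obtain ⟨j, hj⟩ := h
    have h3 := B.page_ne j ⟨hj, hu.2⟩
    rcases eq_or_ne j i with rfl | hji
    · rw [B.fn_same j hj] at h0
      have := congrArg Complex.im h0
      simp at this
      rcases h3 with h3 | h3
      · linarith
      · exact h3 hd
    · rw [B.fn_diff hji hj] at h0
      have := congrArg Complex.im h0
      simp at this
      rcases h3 with h3 | h3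
      · linarith
      · exact h3 hd

theorem fn_dil (B : Book X x ι) (i : ι) {s : ℝ} (hs : 0 < s) (u : E) :
    B.fn i (dil x s u) = s * B.fn i u := by
  apply Complex.ext
  · simp [fn, B.dh s hs]
  · simp only [fn, Complex.mul_im, Complex.ofReal_re, Complex.ofReal_im, zero_mul, add_zero]
    rw [mul_sub, Finset.mul_sum, B.lh i s hs]
    congr 1
    exact Finset.sum_congr rfl fun j _ => B.lh j s hs u

theorem ax (B : Book X x ι) : B.a ≠ x := by
  intro h; have := B.da; rw [h, B.dx] at this; exact lt_irrefl _ this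

theorem bx (B : Book X x ι) : B.b ≠ x := by
  intro h; have := B.db; rw [h, B.dx] at this; exact lt_irrefl _ this

theorem page_log (B : Book X x ι) (i j : ι) : ∃ G : E → ℂ, ContinuousOn G (B.P j \ {x}) ∧
    (∀ u ∈ B.P j \ {x}, B.fn i u = Complex.exp (G u)) ∧
    G B.b - G B.a = ((Real.log (B.d B.b) - Real.log (-B.d B.a) : ℝ) : ℂ) +
      (if i = j then -(Real.pi * Complex.I) else Real.pi * Complex.I) := by
  have ha := B.EP j B.aE
  have hb := B.EP j B.bE
  have hda := B.da
  have hdb := B.db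
  have e1 : Complex.exp (Real.pi / 2 * Complex.I) = Complex.I := Complex.exp_pi_div_two_mul_I
  have e2 : Complex.exp (-(Real.pi / 2 * Complex.I)) = -Complex.I := by
    rw [Complex.exp_neg, e1, Complex.inv_I]
  have hII := Complex.I_mul_I
  have lr : ∀ r : ℝ, 0 < r → Complex.log (r * Complex.I) = Real.log r + Real.pi / 2 * Complex.I := by
    intro r hr
    rw [Complex.log_ofReal_mul hr Complex.I_ne_zero, Complex.log_I]
  have lr' : ∀ r : ℝ, 0 < r → Complex.log (r * -Complex.I) = Real.log r - Real.pi / 2 * Complex.I := by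
    intro r hr
    rw [Complex.log_ofReal_mul hr (neg_ne_zero.2 Complex.I_ne_zero), Complex.log_neg_I]
    ring
  by_cases hij : i = j
  · subst hij
    refine ⟨fun u => Real.pi / 2 * Complex.I + Complex.log (-Complex.I * B.fn i u), ?_, ?_, ?_⟩
    · refine continuousOn_const.add (ContinuousOn.clog ?_ ?_)
      · exact (continuous_const.mul (B.fn_cont i)).continuousOn
      · intro u hu
        rw [B.fn_same i hu.1, Complex.mem_slitPlane_iff]
        rcases B.page_ne i hu with h | h
        · left; simpa using h
        · right; simpa using h
    · intro u hu
      have hne : B.fn i u ≠ 0 := B.fn_ne i ⟨by rw [B.hN]; right; exact mem_iUnion.2 ⟨i, hu.1⟩, hu.2⟩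
      rw [Complex.exp_add, e1, Complex.exp_log (mul_ne_zero (neg_ne_zero.2 Complex.I_ne_zero) hne)]
      linear_combination (B.fn i u) * hII
    · have h1 : -Complex.I * B.fn i B.b = (B.d B.b : ℝ) * -Complex.I := by
        rw [B.fn_same i hb, B.lE i _ B.bE]
        apply Complex.ext <;> simp
      have h2 : -Complex.I * B.fn i B.a = (-B.d B.a : ℝ) * Complex.I := by
        rw [B.fn_same i ha, B.lE i _ B.aE]
        apply Complex.ext <;> simp
      simp only [h1, h2, if_true]
      rw [lr' _ hdb, lr _ (by linarith)]
      push_cast; ring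
  · refine ⟨fun u => -(Real.pi / 2 * Complex.I) + Complex.log (Complex.I * B.fn i u), ?_, ?_, ?_⟩
    · refine continuousOn_const.add (ContinuousOn.clog ?_ ?_)
      · exact (continuous_const.mul (B.fn_cont i)).continuousOn
      · intro u hu
        rw [B.fn_diff (Ne.symm hij) hu.1, Complex.mem_slitPlane_iff]
        rcases B.page_ne j hu with h | h
        · left; simpa using h
        · right; simpa using h
    · intro u hu
      have hne : B.fn i u ≠ 0 := B.fn_ne i ⟨by rw [B.hN]; right; exact mem_iUnion.2 ⟨j, hu.1⟩, hu.2⟩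
      rw [Complex.exp_add, e2, Complex.exp_log (mul_ne_zero Complex.I_ne_zero hne)]
      linear_combination (B.fn i u) * hII
    · have h1 : Complex.I * B.fn i B.b = (B.d B.b : ℝ) * Complex.I := by
        rw [B.fn_diff (Ne.symm hij) hb, B.lE j _ B.bE]
        apply Complex.ext <;> simp
      have h2 : Complex.I * B.fn i B.a = (-B.d B.a : ℝ) * -Complex.I := by
        rw [B.fn_diff (Ne.symm hij) ha, B.lE j _ B.aE]
        apply Complex.ext <;> simp
      simp only [h1, h2, if_neg hij]
      rw [lr _ hdb, lr' _ (by linarith)]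
      push_cast; ring

theorem page_preconn (B : Book X x ι) (j : ι) : IsPreconnected (B.P j \ {x}) :=
  ((B.Pst j).isPathConnected (B.pP j)).isConnected.isPreconnected

theorem locRank (B : Book X x ι) (i0 : ι) : LocRank X x {i : ι // i ≠ i0} := by
  have hN : B.N ∈ 𝓝[X] x := Filter.mem_of_superset (B.Dn 1 one_pos le_rfl) (B.Ds 1 one_pos le_rfl)
  refine ⟨B.N, hN, B.NX, fun i => B.fn i, fun i => ⟨(B.fn_cont i).continuousOn,
    fun u hu => B.fn_ne i hu⟩, ?_⟩
  intro N' hN' hsub n hn hlog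
  obtain ⟨s, hs, hs1, hsN⟩ := B.bdd N' hN'
  obtain ⟨g, hg, hge⟩ := hlog
  -- pull back to N
  have hmaps : MapsTo (dil x s) (B.N \ {x}) (N' \ {x}) := by
    intro u hu
    exact ⟨hsN ⟨u, hu.1, rfl⟩, fun h => hu.2 ((dil_eq_iff x hs.ne' u).1 h)⟩
  have hg' : ContinuousOn (g ∘ dil x s) (B.N \ {x}) :=
    hg.comp (continuous_dil x s).continuousOn hmaps
  have hdiff : ∀ j : ι, g (dil x s B.b) - g (dil x s B.a) =
      ∑ i : {i : ι // i ≠ i0}, (n i : ℂ) *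
        (((Real.log (B.d B.b) - Real.log (-B.d B.a) : ℝ) : ℂ) +
      (if (i : ι) = j then -(Real.pi * Complex.I) else Real.pi * Complex.I)) := by
    intro j
    choose G hG1 hG2 hG3 using fun i => B.page_log i j
    have hPN : B.P j \ {x} ⊆ B.N \ {x} := by
      intro u hu
      refine ⟨?_, hu.2⟩
      rw [B.hN]; right; exact mem_iUnion.2 ⟨j, hu.1⟩
    have key := log_diff_const (B.page_preconn j) (hg'.mono hPN)
      (h := fun u => (∑ i : {i : ι // i ≠ i0}, (n i : ℂ) * G i u) +
        ∑ i : {i : ι // i ≠ i0}, (n i : ℂ) * (Real.log s : ℂ)) ?_ ?_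
      (a := B.a) (b := B.b) ⟨B.EP j B.aE, B.ax⟩ ⟨B.EP j B.bE, B.bx⟩
    · simp only [Function.comp] at key
      rw [key, add_sub_add_right_eq_sub, ← Finset.sum_sub_distrib]
      refine Finset.sum_congr rfl fun i _ => ?_
      rw [← hG3 i]; ring
    · refine ContinuousOn.add ?_ continuousOn_const
      exact continuousOn_finsetSum _ fun i _ => continuousOn_const.mul (hG1 i)
    · intro u hu
      simp only [Function.comp]
      rw [← hge _ (hmaps (hPN hu)), ← Finset.sum_add_distrib, Complex.exp_sum]
      refine Finset.prod_congr rfl fun i _ => ?_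
      show B.fn i (dil x s u) ^ n i = _
      rw [B.fn_dil i hs, hG2 i u hu, ← mul_add, Complex.exp_int_mul, Complex.exp_add,
        ← Complex.ofReal_exp, Real.exp_log hs, mul_comm]
  apply hn
  funext k
  have h1 := (hdiff k).symm.trans (hdiff i0)
  rw [← sub_eq_zero, ← Finset.sum_sub_distrib, Finset.sum_eq_single k] at h1
  · simp only [if_true, if_neg k.2] at h1
    have h2 : (n k : ℂ) * (-2 * (Real.pi * Complex.I)) = 0 := by linear_combination h1
    have h3 : (-2 * ((Real.pi : ℂ) * Complex.I)) ≠ 0 := by simp [Real.pi_ne_zero]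
    have := (mul_eq_zero.1 h2).resolve_right h3
    simpa using this
  · intro i _ hik
    have : (i : ι) ≠ k := fun h => hik (Subtype.ext h)
    simp [this, i.2]
  · simp

theorem exists_log (B : Book X x ι) {κ : Type} [Fintype κ] (h : Fintype.card ι ≤ Fintype.card κ)
    (h0 : 0 < Fintype.card κ) (F : κ → E → ℂ) (hF : ∀ i, ContinuousOn (F i) (B.N \ {x}))
    (hF0 : ∀ i, ∀ u ∈ B.N \ {x}, F i u ≠ 0) :
    ∃ n : κ → ℤ, n ≠ 0 ∧ HasLog (B.N \ {x}) (fun u => ∏ i, F i u ^ n i) := by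
  have hxa : ∀ u ∈ {u | u ∈ B.E0 ∧ B.d u < 0}, u ∈ B.N \ {x} := by
    rintro u ⟨hu, hd⟩
    refine ⟨by rw [B.hN]; exact Or.inl hu, ?_⟩
    rintro rfl
    rw [B.dx] at hd; exact lt_irrefl _ hd
  have hxb : ∀ u ∈ {u | u ∈ B.E0 ∧ 0 < B.d u}, u ∈ B.N \ {x} := by
    rintro u ⟨hu, hd⟩
    refine ⟨by rw [B.hN]; exact Or.inl hu, ?_⟩
    rintro rfl
    rw [B.dx] at hd; exact lt_irrefl _ hd
  rcases isEmpty_or_nonempty ι with hι | ⟨⟨l0⟩⟩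
  · refine ⟨fun _ => 1, ?_, ?_⟩
    · obtain ⟨k⟩ := Fintype.card_pos_iff.1 h0
      intro hh; simpa using congrFun hh k
    · simp only [zpow_one]
      have hNE : B.N = B.E0 := by rw [B.hN]; simp
      have hc : ContinuousOn (fun u => ∏ i, F i u) (B.N \ {x}) :=
        continuousOn_finsetProd _ fun i _ => hF i
      have hn : ∀ u ∈ B.N \ {x}, ∏ i, F i u ≠ 0 := fun u hu =>
        Finset.prod_ne_zero_iff.2 fun i _ => hF0 i u hu
      obtain ⟨ga, ga1, ga2⟩ := hasLog_of_starConvex B.sta ⟨B.aE, B.da⟩ (hc.mono hxa)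
        (fun u hu => hn u (hxa u hu))
      obtain ⟨gb, gb1, gb2⟩ := hasLog_of_starConvex B.stb ⟨B.bE, B.db⟩ (hc.mono hxb)
        (fun u hu => hn u (hxb u hu))
      have key := glue_closed (S := B.N \ {x})
        (fun c : Bool => if c then {u | B.d u ≤ 0} else {u | 0 ≤ B.d u}) ?_ ?_
        (fun c : Bool => if c then ga else gb) ?_ ?_
      · obtain ⟨G, G1, G2⟩ := key
        refine ⟨G, G1, fun u hu => ?_⟩
        have hne : B.d u ≠ 0 := fun hh => hu.2 (B.dz u (hNE ▸ hu.1) hh)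
        rcases lt_or_gt_of_ne hne with hd | hd
        · rw [G2 true u hu (by simpa using hd.le)]
          simpa using ga2 u ⟨hNE ▸ hu.1, hd⟩
        · rw [G2 false u hu (by simpa using hd.le)]
          simpa using gb2 u ⟨hNE ▸ hu.1, hd⟩
      · intro c
        cases c
        · simpa using isClosed_le continuous_const B.dc
        · simpa using isClosed_le B.dc continuous_const
      · intro u _
        rcases le_total (B.d u) 0 with hd | hd
        · exact mem_iUnion.2 ⟨true, by simpa using hd⟩
        · exact mem_iUnion.2 ⟨false, by simpa using hd⟩
      · intro c
        cases c
        · refine (gb1.mono ?_)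
          rintro u ⟨hu, hd⟩
          have hne : B.d u ≠ 0 := fun hh => hu.2 (B.dz u (hNE ▸ hu.1) hh)
          exact ⟨hNE ▸ hu.1, lt_of_le_of_ne (by simpa using hd) hne.symm⟩
        · refine (ga1.mono ?_)
          rintro u ⟨hu, hd⟩
          have hne : B.d u ≠ 0 := fun hh => hu.2 (B.dz u (hNE ▸ hu.1) hh)
          exact ⟨hNE ▸ hu.1, lt_of_le_of_ne (by simpa using hd) hne⟩
      · intro c c' u hu h1 h2
        have hne : B.d u ≠ 0 := fun hh => hu.2 (B.dz u (hNE ▸ hu.1) hh)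
        cases c <;> cases c' <;> simp at h1 h2 ⊢
        · exact absurd (le_antisymm h2 h1) hne
        · exact absurd (le_antisymm h1 h2) hne
  · have hPN : ∀ j, B.P j \ {x} ⊆ B.N \ {x} := by
      intro j u hu
      refine ⟨?_, hu.2⟩
      rw [B.hN]; right; exact mem_iUnion.2 ⟨j, hu.1⟩
    have hlog : ∀ i l, HasLog (B.P l \ {x}) (F i) := fun i l =>
      hasLog_of_starConvex (B.Pst l) (B.pP l) ((hF i).mono (hPN l)) (fun u hu => hF0 i u (hPN l hu))
    choose g hg1 hg2 using hlog
    have haP : ∀ l, B.a ∈ B.P l \ {x} := fun l => ⟨B.EP l B.aE, B.ax⟩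
    have hbP : ∀ l, B.b ∈ B.P l \ {x} := fun l => ⟨B.EP l B.bE, B.bx⟩
    have hm : ∀ (l : ι) (i : κ), ∃ m : ℤ, (g i l B.b - g i l B.a) - (g i l0 B.b - g i l0 B.a) =
        m * (2 * Real.pi * Complex.I) := by
      intro l i
      have : Complex.exp (g i l B.b - g i l B.a) = Complex.exp (g i l0 B.b - g i l0 B.a) := by
        rw [Complex.exp_sub, Complex.exp_sub, ← hg2 i l _ (haP l), ← hg2 i l _ (hbP l),
          ← hg2 i l0 _ (haP l0), ← hg2 i l0 _ (hbP l0)]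
      obtain ⟨m, hm⟩ := Complex.exp_eq_exp_iff_exists_int.1 this
      exact ⟨m, by rw [hm]; ring⟩
    choose M hM using hm
    obtain ⟨n, hn, hrel⟩ := exists_int_relation (α := {l : ι // l ≠ l0}) (β := κ) (by
      rw [Fintype.card_subtype_compl, Fintype.card_subtype_eq]
      have : 0 < Fintype.card ι := Fintype.card_pos_iff.2 ⟨l0⟩
      omega) (fun l i => M l i)
    have hrel' : ∀ l, ∑ i, (n i : ℂ) * ((g i l B.b - g i l B.a) - (g i l0 B.b - g i l0 B.a)) = 0 := by
      intro l
      by_cases hl : l = l0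
      · subst hl; simp
      · have h1 := hrel ⟨l, hl⟩
        have h2 : ((∑ i, n i * M l i : ℤ) : ℂ) = 0 := by
          simp only at h1; rw [h1]; simp
        push_cast at h2
        calc _ = (∑ i, (n i : ℂ) * M l i) * (2 * Real.pi * Complex.I) := by
              rw [Finset.sum_mul]
              refine Finset.sum_congr rfl fun i _ => ?_
              rw [hM]; ring
          _ = 0 := by rw [h2, zero_mul]
    refine ⟨n, hn, ?_⟩
    let H : ι → E → ℂ := fun l u => ∑ i, (n i : ℂ) * (g i l u - g i l B.a + g i l0 B.a)
    have Hc : ∀ l, ContinuousOn (H l) (B.P l \ {x}) := fun l =>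
      continuousOn_finsetSum _ fun i _ => continuousOn_const.mul
        (((hg1 i l).sub continuousOn_const).add continuousOn_const)
    have He : ∀ l, ∀ u ∈ B.P l \ {x}, ∏ i, F i u ^ n i = Complex.exp (H l u) := by
      intro l u hu
      simp only [H]
      rw [Complex.exp_sum]
      refine Finset.prod_congr rfl fun i _ => ?_
      rw [Complex.exp_int_mul, Complex.exp_add, Complex.exp_sub, ← hg2 i l _ hu,
        ← hg2 i l _ (haP l), ← hg2 i l0 _ (haP l0), div_mul_cancel₀]
      exact hF0 i _ (hPN l (haP l))
    have Ha : ∀ l l', H l B.a = H l' B.a := by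
      intro l l'; simp [H]
    have Hb : ∀ l l', H l B.b = H l' B.b := by
      have : ∀ l, H l B.b = H l0 B.b := by
        intro l
        rw [← sub_eq_zero, ← hrel' l]
        simp only [H]
        rw [← Finset.sum_sub_distrib]
        refine Finset.sum_congr rfl fun i _ => by ring
      intro l l'; rw [this l, this l']
    have pa := (B.sta.isPathConnected ⟨B.aE, B.da⟩).isConnected.isPreconnected
    have pb := (B.stb.isPathConnected ⟨B.bE, B.db⟩).isConnected.isPreconnected
    have hEa : ∀ l, {u | u ∈ B.E0 ∧ B.d u < 0} ⊆ B.P l \ {x} := fun l u hu =>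
      ⟨B.EP l hu.1, (hxa u hu).2⟩
    have hEb : ∀ l, {u | u ∈ B.E0 ∧ 0 < B.d u} ⊆ B.P l \ {x} := fun l u hu =>
      ⟨B.EP l hu.1, (hxb u hu).2⟩
    have hE : ∀ l l', ∀ u ∈ B.E0, u ≠ x → H l u = H l' u := by
      intro l l' u hu hux
      have hne : B.d u ≠ 0 := fun hh => hux (B.dz u hu hh)
      rcases lt_or_gt_of_ne hne with hd | hd
      · have := log_diff_const pa ((Hc l).mono (hEa l)) ((Hc l').mono (hEa l'))
          (fun v hv => by rw [← He l v (hEa l hv), ← He l' v (hEa l' hv)])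
          (a := B.a) (b := u) ⟨B.aE, B.da⟩ ⟨hu, hd⟩
        rw [Ha l l'] at this
        exact sub_left_injective this
      · have := log_diff_const pb ((Hc l).mono (hEb l)) ((Hc l').mono (hEb l'))
          (fun v hv => by rw [← He l v (hEb l hv), ← He l' v (hEb l' hv)])
          (a := B.b) (b := u) ⟨B.bE, B.db⟩ ⟨hu, hd⟩
        rw [Hb l l'] at this
        exact sub_left_injective this
    have key := glue_closed (S := B.N \ {x}) B.P B.Pcl ?_ H ?_ ?_
    · obtain ⟨G, G1, G2⟩ := key
      refine ⟨G, G1, fun u hu => ?_⟩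
      have huN := hu.1
      rw [B.hN] at huN
      rcases huN with hh | hh
      · rw [G2 l0 u hu (B.EP l0 hh)]
        exact He l0 u ⟨B.EP l0 hh, hu.2⟩
      · simp only [mem_iUnion] at hh
        obtain ⟨l, hl⟩ := hh
        rw [G2 l u hu hl]
        exact He l u ⟨hl, hu.2⟩
    · intro u hu
      have huN := hu.1
      rw [B.hN] at huN
      rcases huN with hh | hh
      · exact mem_iUnion.2 ⟨l0, B.EP l0 hh⟩
      · exact hh
    · intro l
      exact (Hc l).mono (fun u hu => ⟨hu.2, hu.1.2⟩)
    · intro l l' u hu h1 h2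
      by_cases hll : l = l'
      · subst hll; rfl
      · exact hE l l' u (B.lz l u h1 (B.lj l l' (Ne.symm hll) u h2)) hu.2

theorem not_locRank (B : Book X x ι) {κ : Type} [Fintype κ] (h : Fintype.card ι ≤ Fintype.card κ)
    (h0 : 0 < Fintype.card κ) : ¬ LocRank X x κ := by
  rintro ⟨N, hN, hNX, F, hF, hind⟩
  obtain ⟨s, hs, hs1, hsN⟩ := B.bdd N hN
  have hmaps : MapsTo (dil x s) (B.N \ {x}) (N \ {x}) := by
    intro u hu
    exact ⟨hsN ⟨u, hu.1, rfl⟩, fun h => hu.2 ((dil_eq_iff x hs.ne' u).1 h)⟩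
  obtain ⟨n, hn, g, g1, g2⟩ := B.exists_log h h0 (fun i => F i ∘ dil x s)
    (fun i => (hF i).1.comp (continuous_dil x s).continuousOn hmaps)
    (fun i u hu => (hF i).2 _ (hmaps hu))
  have hback : MapsTo (dil x s⁻¹) (dil x s '' B.N \ {x}) (B.N \ {x}) := by
    rintro _ ⟨⟨u, hu, rfl⟩, hux⟩
    rw [dil_inv_dil x hs.ne']
    exact ⟨hu, fun hh => hux ((dil_eq_iff x hs.ne' u).2 hh)⟩
  refine hind _ (B.Dn s hs hs1) hsN n hn ⟨g ∘ dil x s⁻¹,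
    g1.comp (continuous_dil x _).continuousOn hback, ?_⟩
  intro u hu
  have := g2 _ (hback hu)
  simpa [Function.comp, dil_dil_inv x hs.ne'] using this

end Book

theorem book_le {X : Set E} {Y : Set Ef} (h : HP X Y) {x : E} (hx : x ∈ X) {ι κ : Type}
    [Fintype ι] [Fintype κ] (B : Book X x ι) (C : Book Y (h.φ x) κ) (h2 : 2 ≤ Fintype.card ι) :
    Fintype.card ι ≤ Fintype.card κ := by
  classical
  obtain ⟨i0⟩ : Nonempty ι := Fintype.card_pos_iff.1 (by omega)
  have h1 := (B.locRank i0).transfer h hx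
  by_contra hlt
  refine C.not_locRank (κ := {i : ι // i ≠ i0}) ?_ ?_ h1
  · rw [Fintype.card_subtype_compl, Fintype.card_subtype_eq]; omega
  · rw [Fintype.card_subtype_compl, Fintype.card_subtype_eq]; omega

end BookPart

section Geom1
open Topology Set
variable {V : Type} [DecidableEq V] [Fintype V]

/-- The support. -/
noncomputable def sup0 (u : V → ℝ) : Finset V := by
  classical exact Finset.univ.filter fun v => u v ≠ 0

theorem mem_sup0 {u : V → ℝ} {v : V} : v ∈ sup0 u ↔ u v ≠ 0 := by simp [sup0]

/-- The closed simplex on `F`. -/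
def cell (F : Finset V) : Set (V → ℝ) := {u | (∀ v, 0 ≤ u v) ∧ ∑ v, u v = 1 ∧ ∀ v, v ∉ F → u v = 0}

theorem cell_mono {F G : Finset V} (h : F ⊆ G) : cell F ⊆ cell G := fun _ hu =>
  ⟨hu.1, hu.2.1, fun v hv => hu.2.2 v (fun h' => hv (h h'))⟩

theorem cell_sum {F : Finset V} {u : V → ℝ} (hu : u ∈ cell F) : ∑ v ∈ F, u v = 1 := by
  rw [← hu.2.1]
  exact Finset.sum_subset (Finset.subset_univ _) (fun v _ hv => hu.2.2 v hv)

theorem sup0_sub {F : Finset V} {u : V → ℝ} (hu : u ∈ cell F) : sup0 u ⊆ F := by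
  intro v hv
  by_contra h
  exact mem_sup0.1 hv (hu.2.2 v h)

theorem mem_geom {K : Finset (Finset V)} {u : V → ℝ} :
    u ∈ geomReal K ↔ (∀ v, 0 ≤ u v) ∧ ∑ v, u v = 1 ∧ sup0 u ∈ K := by
  have : {v | u v ≠ 0} = ((sup0 u : Finset V) : Set V) := by
    ext v; simp [mem_sup0]
  simp only [geomReal, mem_ofPred_eq, this]
  constructor
  · rintro ⟨h1, h2, F, hF, he⟩
    rw [Finset.coe_inj] at he
    exact ⟨h1, h2, he ▸ hF⟩
  · rintro ⟨h1, h2, h3⟩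
    exact ⟨h1, h2, _, h3, rfl⟩

theorem sup0_cell {K : Finset (Finset V)} {u : V → ℝ} (hu : u ∈ geomReal K) : u ∈ cell (sup0 u) := by
  rw [mem_geom] at hu
  exact ⟨hu.1, hu.2.1, fun v hv => by by_contra h; exact hv (mem_sup0.2 h)⟩

theorem cell_sub_geom {K : Finset (Finset V)} (hK : IsCplx K) {F : Finset V} (hF : F ∈ K) :
    cell F ⊆ geomReal K := by
  intro u hu
  rw [mem_geom]
  refine ⟨hu.1, hu.2.1, hK.2 F hF _ (sup0_sub hu) ?_⟩
  intro h
  have : ∑ v, u v = 0 := Finset.sum_eq_zero fun v _ => by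
    by_contra hv
    have := mem_sup0.2 hv
    rw [h] at this; simp at this
  rw [hu.2.1] at this; norm_num at this

theorem cell_convex (F : Finset V) : Convex ℝ (cell F) := by
  intro u hu w hw s t hs ht hst
  refine ⟨fun v => ?_, ?_, fun v hv => ?_⟩
  · simp only [Pi.add_apply, Pi.smul_apply, smul_eq_mul]
    have := mul_nonneg hs (hu.1 v)
    have := mul_nonneg ht (hw.1 v)
    linarith
  · simp only [Pi.add_apply, Pi.smul_apply, smul_eq_mul]
    rw [Finset.sum_add_distrib, ← Finset.mul_sum, ← Finset.mul_sum, hu.2.1, hw.2.1]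
    linarith
  · simp [hu.2.2 v hv, hw.2.2 v hv]

theorem cell_closed (F : Finset V) : IsClosed (cell F) := by
  have : cell F = (⋂ v, {u : V → ℝ | 0 ≤ u v}) ∩ ({u : V → ℝ | ∑ v, u v = 1} ∩
      ⋂ v, ⋂ (_ : v ∉ F), {u : V → ℝ | u v = 0}) := by
    ext u; simp [cell]
  rw [this]
  refine (isClosed_iInter fun v => isClosed_le continuous_const (continuous_apply v)).inter
    ((isClosed_eq (by fun_prop) continuous_const).inter (isClosed_iInter fun v => isClosed_iInter
      fun _ => isClosed_eq (continuous_apply v) continuous_const))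

theorem cell_le_one {F : Finset V} {u : V → ℝ} (hu : u ∈ cell F) (v : V) : u v ≤ 1 := by
  rw [← hu.2.1]
  exact Finset.single_le_sum (fun w _ => hu.1 w) (Finset.mem_univ v)

theorem single_cell {F : Finset V} {v : V} (hv : v ∈ F) : (Pi.single v 1 : V → ℝ) ∈ cell F := by
  refine ⟨fun w => ?_, ?_, fun w hw => ?_⟩
  · by_cases h : w = v
    · subst h; simp
    · simp [h]
  · simp
  · have : w ≠ v := fun h => hw (h ▸ hv)
    simp [this]

/-- The closed star of a face. -/
def starN (K : Finset (Finset V)) (e : Finset V) : Set (V → ℝ) :=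
  {u | ∃ F ∈ K, e ⊆ F ∧ u ∈ cell F}

theorem starN_sub {K : Finset (Finset V)} (hK : IsCplx K) (e : Finset V) : starN K e ⊆ geomReal K := by
  rintro u ⟨F, hF, _, hu⟩
  exact cell_sub_geom hK hF hu

theorem geom_pos {K : Finset (Finset V)} {x : V → ℝ} (hx : x ∈ geomReal K) {v : V} (hv : v ∈ sup0 x) :
    0 < x v := lt_of_le_of_ne ((mem_geom.1 hx).1 v) (mem_sup0.1 hv).symm

theorem starN_Dn {K : Finset (Finset V)} {x : V → ℝ} (hx : x ∈ geomReal K)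
    (s : ℝ) (hs : 0 < s) (hs1 : s ≤ 1) : dil x s '' starN K (sup0 x) ∈ 𝓝[geomReal K] x := by
  have hx' := mem_geom.1 hx
  have hO : {u : V → ℝ | ∀ v ∈ sup0 x, (1 - s) * x v < u v} ∈ 𝓝 x := by
    have : {u : V → ℝ | ∀ v ∈ sup0 x, (1 - s) * x v < u v} =
        ⋂ v ∈ sup0 x, {u : V → ℝ | (1 - s) * x v < u v} := by ext u; simp
    rw [this]
    refine IsOpen.mem_nhds (isOpen_biInter_finset fun v _ =>
      isOpen_lt continuous_const (continuous_apply v)) ?_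
    simp only [mem_iInter, mem_ofPred_eq]
    intro v hv
    have := geom_pos hx hv
    nlinarith
  refine Filter.mem_of_superset (Filter.inter_mem (mem_nhdsWithin_of_mem_nhds hO)
    self_mem_nhdsWithin) ?_
  rintro u ⟨huO, huX⟩
  have hu' := mem_geom.1 huX
  refine ⟨dil x s⁻¹ u, ⟨sup0 u, hu'.2.2, ?_, ?_, ?_, ?_⟩, dil_dil_inv x hs.ne' u⟩
  · intro v hv
    rw [mem_sup0]
    have h1 := huO v hv
    have h2 := geom_pos hx hv
    have : 0 ≤ (1 - s) * x v := mul_nonneg (by linarith) h2.le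
    linarith
  · intro v
    simp only [dil, Pi.add_apply, Pi.smul_apply, Pi.sub_apply, smul_eq_mul]
    by_cases hv : v ∈ sup0 x
    · have h1 := huO v hv
      have : x v + s⁻¹ * (u v - x v) = s⁻¹ * (u v - (1 - s) * x v) := by field_simp; ring
      rw [this]
      exact mul_nonneg (inv_nonneg.2 hs.le) (by linarith)
    · have : x v = 0 := by by_contra h; exact hv (mem_sup0.2 h)
      rw [this]
      simpa using mul_nonneg (inv_nonneg.2 hs.le) (hu'.1 v)
  · simp only [dil, Pi.add_apply, Pi.smul_apply, Pi.sub_apply, smul_eq_mul]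
    rw [Finset.sum_add_distrib, ← Finset.mul_sum, Finset.sum_sub_distrib, hu'.2.1, hx'.2.1]
    simp
  · intro v hv
    have h1 : u v = 0 := by by_contra h; exact hv (mem_sup0.2 h)
    have h2 : x v = 0 := by
      by_contra h
      have h1' := huO v (mem_sup0.2 h)
      have h2' := geom_pos hx (mem_sup0.2 h)
      have : 0 ≤ (1 - s) * x v := mul_nonneg (by linarith) h2'.le
      linarith
    simp [dil, h1, h2]

theorem dil_cell {F : Finset V} {x u : V → ℝ} (hx : x ∈ cell F) (hu : u ∈ cell F) {s : ℝ} (hs : 0 ≤ s)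
    (hs1 : s ≤ 1) : dil x s u ∈ cell F :=
  (cell_convex F).add_smul_sub_mem hx hu ⟨hs, hs1⟩

theorem starN_Ds {K : Finset (Finset V)} {x : V → ℝ} (hx : x ∈ geomReal K)
    (s : ℝ) (hs : 0 < s) (hs1 : s ≤ 1) : dil x s '' starN K (sup0 x) ⊆ starN K (sup0 x) := by
  rintro _ ⟨u, ⟨F, hF, heF, hu⟩, rfl⟩
  exact ⟨F, hF, heF, dil_cell (cell_mono heF (sup0_cell hx)) hu hs.le hs1⟩

theorem cell_dist {F G : Finset V} {x u : V → ℝ} (hx : x ∈ cell F) (hu : u ∈ cell G) : ‖u - x‖ ≤ 1 := by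
  rw [pi_norm_le_iff_of_nonneg zero_le_one]
  intro v
  rw [Real.norm_eq_abs, abs_le]
  have h1 := hx.1 v
  have h2 := cell_le_one hx v
  have h3 := hu.1 v
  have h4 := cell_le_one hu v
  simp only [Pi.sub_apply]
  constructor <;> linarith

theorem starN_bdd {K : Finset (Finset V)} (hK : IsCplx K) {x : V → ℝ} (hx : x ∈ geomReal K) (U : Set (V → ℝ))
    (hU : U ∈ 𝓝[geomReal K] x) :
    ∃ s : ℝ, 0 < s ∧ s ≤ 1 ∧ dil x s '' starN K (sup0 x) ⊆ U := by
  rw [Metric.mem_nhdsWithin_iff] at hU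
  obtain ⟨ε, hε, hsub⟩ := hU
  refine ⟨min 1 (ε / 2), by positivity, min_le_left _ _, ?_⟩
  intro w hw
  apply hsub
  refine ⟨?_, starN_sub hK _ (starN_Ds hx _ (by positivity) (min_le_left _ _) hw)⟩
  obtain ⟨u, ⟨F, hF, heF, hu⟩, rfl⟩ := hw
  rw [Metric.mem_ball, dist_eq_norm]
  simp only [dil, add_sub_cancel_left]
  rw [norm_smul, Real.norm_eq_abs, abs_of_pos (by positivity)]
  calc min 1 (ε / 2) * ‖u - x‖ ≤ (ε / 2) * 1 :=
        mul_le_mul (min_le_right _ _) (cell_dist (sup0_cell hx) hu) (norm_nonneg _) (by positivity)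
    _ < ε := by linarith

theorem dlin (x : V → ℝ) (a b : V) : IsLinearMap ℝ (fun u : V → ℝ => u b * x a - u a * x b) :=
  ⟨fun u w => by simp only [Pi.add_apply]; ring, fun c u => by
    simp only [Pi.smul_apply, smul_eq_mul]; ring⟩

theorem d_dil (x : V → ℝ) (a b : V) (s : ℝ) (u : V → ℝ) :
    dil x s u b * x a - dil x s u a * x b = s * (u b * x a - u a * x b) := by
  simp only [dil, Pi.add_apply, Pi.smul_apply, Pi.sub_apply, smul_eq_mul]; ring

/-- Triangles containing a face. -/
abbrev TriOver (K : Finset (Finset V)) (e : Finset V) : Type :=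
  {F : Finset V // F ∈ K.filter fun F => e ⊆ F ∧ F.card = 3}

theorem exists_third {e F : Finset V} (h : e ⊆ F) (he : e.card = 2) (hF : F.card = 3) :
    ∃ c, c ∉ e ∧ F = insert c e := by
  have h1 : (F \ e).card = 1 := by rw [Finset.card_sdiff_of_subset h]; omega
  obtain ⟨c, hc⟩ := Finset.card_eq_one.1 h1
  refine ⟨c, ?_, ?_⟩
  · have : c ∈ F \ e := by rw [hc]; simp
    exact (Finset.mem_sdiff.1 this).2
  · rw [← Finset.sdiff_union_of_subset h, hc]; rfl

/-- The third vertex. -/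
noncomputable def thirdV (e F : Finset V) (h : e ⊆ F) (he : e.card = 2) (hF : F.card = 3) : V :=
  (exists_third h he hF).choose

theorem edge_dz {x u : V → ℝ} {a b : V} {r : ℝ} (_hab : a ≠ b) (hxs : x a + x b = r) (hus : u a + u b = r)
    (hr : 0 < r) (hd : u b * x a - u a * x b = 0) : u a = x a ∧ u b = x b := by
  have h1 : u b = x b := by
    have : (u b - x b) * r = 0 := by
      have e1 : x a = r - x b := by linarith
      have e2 : u a = r - u b := by linarith
      rw [e1, e2] at hd
      linear_combination hd
    have := (mul_eq_zero.1 this).resolve_right hr.ne'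
    linarith
  exact ⟨by linarith, h1⟩

theorem book_edge {K : Finset (Finset V)} (hK : IsCplx K) (hdim : ∀ F ∈ K, F.card ≤ 3) {x : V → ℝ}
    (hx : x ∈ geomReal K) (h2 : (sup0 x).card = 2) :
    Nonempty (Book (geomReal K) x (TriOver K (sup0 x))) := by
  obtain ⟨a, b, hab, he⟩ := Finset.card_eq_two.1 h2
  have hT : ∀ F : TriOver K (sup0 x), F.1 ∈ K ∧ sup0 x ⊆ F.1 ∧ F.1.card = 3 := fun F =>
    Finset.mem_filter.1 F.2
  have hc : ∀ F : TriOver K (sup0 x), ∃ c, c ∉ sup0 x ∧ F.1 = insert c (sup0 x) := fun F =>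
    exists_third (hT F).2.1 h2 (hT F).2.2
  choose c hc1 hc2 using hc
  have hcx : ∀ F, x (c F) = 0 := fun F => by by_contra h; exact hc1 F (mem_sup0.2 h)
  have ha : a ∈ sup0 x := by rw [he]; simp
  have hb : b ∈ sup0 x := by rw [he]; simp
  have hxa := geom_pos hx ha
  have hxb := geom_pos hx hb
  have hsum : ∀ u ∈ cell (sup0 x), u a + u b = 1 := by
    intro u hu
    have := cell_sum hu
    rwa [he, Finset.sum_pair hab] at this
  have hxe := sup0_cell hx
  have hcF : ∀ F, c F ∈ F.1 := fun F => by rw [hc2 F]; simp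
  refine ⟨{
    N := starN K (sup0 x)
    P := fun F => cell F.1
    E0 := cell (sup0 x)
    d := fun u => u b * x a - u a * x b
    l := fun F u => u (c F)
    p := fun F => Pi.single (c F) 1
    a := Pi.single a 1
    b := Pi.single b 1
    NX := starN_sub hK _
    Dn := starN_Dn hx
    Ds := starN_Ds hx
    bdd := starN_bdd hK hx
    Pcl := fun F => cell_closed _
    Pst := ?_
    pP := ?_
    EP := fun F => cell_mono (hT F).2.1
    hN := ?_
    dc := by fun_prop
    lc := fun F => continuous_apply _
    dh := fun s _ u => d_dil x a b s u
    lh := fun F s _ u => by simp [dil, hcx]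
    l0 := fun F u hu => hu.1 _
    lj := ?_
    lE := fun F u hu => hu.2.2 _ (hc1 F)
    lz := ?_
    dz := ?_
    aE := single_cell ha
    bE := single_cell hb
    da := ?_
    db := ?_
    dx := by ring
    sta := ?_
    stb := ?_ }⟩
  · intro F
    rw [starConvex_iff_forall_pos (by
      refine ⟨single_cell (hcF F), ?_⟩
      intro h
      have := congrFun h (c F)
      simp [hcx] at this)]
    rintro u ⟨hu, hux⟩ s t hs ht hst
    refine ⟨cell_convex _ (single_cell (hcF F)) hu hs.le ht.le hst, ?_⟩
    intro h
    have := congrFun h (c F)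
    simp [hcx] at this
    have h1 := mul_nonneg ht.le (hu.1 (c F))
    linarith
  · intro F
    refine ⟨single_cell (hcF F), ?_⟩
    intro h
    have := congrFun h (c F)
    simp [hcx] at this
  · ext u
    constructor
    · rintro ⟨F, hF, heF, hu⟩
      have h3 := hdim F hF
      have h4 := Finset.card_le_card heF
      by_cases h5 : F.card = 3
      · right
        exact mem_iUnion.2 ⟨⟨F, by simp [hF, heF, h5]⟩, hu⟩
      · left
        have : sup0 x = F := Finset.eq_of_subset_of_card_le heF (by omega)
        rwa [this]
    · rintro (hu | hu)
      · exact ⟨sup0 x, (mem_geom.1 hx).2.2, subset_rfl, hu⟩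
      · obtain ⟨F, hF⟩ := mem_iUnion.1 hu
        exact ⟨F.1, (hT F).1, (hT F).2.1, hF⟩
  · intro F G hGF u hu
    apply hu.2.2
    intro hcG
    apply hGF
    apply Subtype.ext
    symm
    apply Finset.eq_of_subset_of_card_le
    · rw [hc2 F]
      exact Finset.insert_subset hcG (hT G).2.1
    · rw [(hT F).2.2, (hT G).2.2]
  · intro F u hu h0
    refine ⟨hu.1, hu.2.1, fun v hv => ?_⟩
    by_cases hvc : v = c F
    · rw [hvc]; exact h0
    · apply hu.2.2
      rw [hc2 F]
      simp [hvc, hv]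
  · intro u hu hd
    have := edge_dz hab (hsum x hxe) (hsum u hu) one_pos hd
    funext v
    by_cases hv : v ∈ sup0 x
    · rw [he] at hv
      simp only [Finset.mem_insert, Finset.mem_singleton] at hv
      rcases hv with rfl | rfl
      · exact this.1
      · exact this.2
    · rw [hu.2.2 v hv, hxe.2.2 v hv]
  · simp [hab.symm, hxb]
  · simp [hab, hxa]
  · have : Convex ℝ {u : V → ℝ | u ∈ cell (sup0 x) ∧ u b * x a - u a * x b < 0} :=
      (cell_convex _).inter (convex_halfSpace_lt (dlin x a b) 0)
    apply this.starConvex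
    refine ⟨single_cell ha, ?_⟩
    simp [hab.symm, hxb]
  · have : Convex ℝ {u : V → ℝ | u ∈ cell (sup0 x) ∧ 0 < u b * x a - u a * x b} :=
      (cell_convex _).inter (convex_halfSpace_gt (dlin x a b) 0)
    apply this.starConvex
    refine ⟨single_cell hb, ?_⟩
    simp [hab, hxa]

theorem book_tri {K : Finset (Finset V)} (hK : IsCplx K) (hdim : ∀ F ∈ K, F.card ≤ 3) {x : V → ℝ}
    (hx : x ∈ geomReal K) (h3 : (sup0 x).card = 3) : Nonempty (Book (geomReal K) x Bool) := by
  obtain ⟨a, b, c, hab, hac, hbc, he⟩ := Finset.card_eq_three.1 h3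
  have ha : a ∈ sup0 x := by rw [he]; simp
  have hb : b ∈ sup0 x := by rw [he]; simp
  have hc : c ∈ sup0 x := by rw [he]; simp
  have hxa := geom_pos hx ha
  have hxb := geom_pos hx hb
  have hxc := geom_pos hx hc
  have hsum : ∀ u ∈ cell (sup0 x), u a + u b + u c = 1 := by
    intro u hu
    have := cell_sum hu
    rw [he, Finset.sum_insert (by simp [hab, hac]), Finset.sum_pair hbc] at this
    linarith
  have hxe := sup0_cell hx
  have hxs := hsum x hxe
  have hN : starN K (sup0 x) = cell (sup0 x) := by
    ext u
    constructor
    · rintro ⟨F, hF, heF, hu⟩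
      have : sup0 x = F := Finset.eq_of_subset_of_card_le heF (by have := hdim F hF; omega)
      rwa [this]
    · intro hu
      exact ⟨sup0 x, (mem_geom.1 hx).2.2, subset_rfl, hu⟩
  have cg : Continuous fun u : V → ℝ => u c - x c := by fun_prop
  have lin : ∀ r, Convex ℝ {u : V → ℝ | u c = r} := fun r =>
    convex_hyperplane (f := fun u : V → ℝ => u c) ⟨fun _ _ => rfl, fun _ _ => rfl⟩ r
  have pa : (Pi.single a (x a + x b) + Pi.single c (x c) : V → ℝ) ∈
      {u : V → ℝ | u ∈ cell (sup0 x) ∧ u c = x c} := by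
    refine ⟨⟨fun v => ?_, ?_, fun v hv => ?_⟩, ?_⟩
    · have h1 : 0 ≤ (Pi.single a (x a + x b) : V → ℝ) := Pi.single_nonneg.2 (by linarith)
      have h2 : 0 ≤ (Pi.single c (x c) : V → ℝ) := Pi.single_nonneg.2 (by linarith)
      exact add_nonneg (h1 v) (h2 v)
    · simp only [Pi.add_apply]
      rw [Finset.sum_add_distrib]
      simp [hxs]
    · have h1 : v ≠ a := fun h => hv (h ▸ ha)
      have h2 : v ≠ c := fun h => hv (h ▸ hc)
      simp [h1, h2]
    · simp [hac.symm]
  have pb : (Pi.single b (x a + x b) + Pi.single c (x c) : V → ℝ) ∈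
      {u : V → ℝ | u ∈ cell (sup0 x) ∧ u c = x c} := by
    refine ⟨⟨fun v => ?_, ?_, fun v hv => ?_⟩, ?_⟩
    · have h1 : 0 ≤ (Pi.single b (x a + x b) : V → ℝ) := Pi.single_nonneg.2 (by linarith)
      have h2 : 0 ≤ (Pi.single c (x c) : V → ℝ) := Pi.single_nonneg.2 (by linarith)
      exact add_nonneg (h1 v) (h2 v)
    · simp only [Pi.add_apply]
      rw [Finset.sum_add_distrib]
      simp [hxs]
    · have h1 : v ≠ b := fun h => hv (h ▸ hb)
      have h2 : v ≠ c := fun h => hv (h ▸ hc)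
      simp [h1, h2]
    · simp [hbc.symm]
  have xc1 : x c < 1 := by linarith
  have hda : (fun u : V → ℝ => u b * x a - u a * x b)
      (Pi.single a (x a + x b) + Pi.single c (x c) : V → ℝ) < 0 := by
    simp [hab.symm, hbc, hac]; positivity
  have hdb : 0 < (fun u : V → ℝ => u b * x a - u a * x b)
      (Pi.single b (x a + x b) + Pi.single c (x c) : V → ℝ) := by
    simp [hab, hbc, hac]; positivity
  refine ⟨{
    N := starN K (sup0 x)
    P := fun i => {u | u ∈ cell (sup0 x) ∧ if i then x c ≤ u c else u c ≤ x c}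
    E0 := {u | u ∈ cell (sup0 x) ∧ u c = x c}
    d := fun u => u b * x a - u a * x b
    l := fun i u => if i then max (u c - x c) 0 else max (x c - u c) 0
    p := fun i => if i then Pi.single c 1 else Pi.single a 1
    a := Pi.single a (x a + x b) + Pi.single c (x c)
    b := Pi.single b (x a + x b) + Pi.single c (x c)
    NX := starN_sub hK _
    Dn := starN_Dn hx
    Ds := starN_Ds hx
    bdd := starN_bdd hK hx
    Pcl := ?_
    Pst := ?_
    pP := ?_
    EP := ?_
    hN := ?_
    dc := by fun_prop
    lc := ?_
    dh := fun s _ u => d_dil x a b s u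
    lh := ?_
    l0 := ?_
    lj := ?_
    lE := ?_
    lz := ?_
    dz := ?_
    aE := pa
    bE := pb
    da := hda
    db := hdb
    dx := by ring
    sta := ?_
    stb := ?_ }⟩
  · rintro (_ | _)
    · exact (cell_closed _).inter (isClosed_le (continuous_apply c) continuous_const)
    · exact (cell_closed _).inter (isClosed_le continuous_const (continuous_apply c))
  · rintro (_ | _)
    · simp only [Bool.false_eq_true, if_false]
      rw [starConvex_iff_forall_pos (by
        refine ⟨⟨single_cell ha, by simp [hac.symm, hxc.le]⟩, ?_⟩
        intro h
        have := congrFun h c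
        simp [hac.symm] at this
        linarith)]
      rintro u ⟨⟨hu, huc⟩, hux⟩ s t hs ht hst
      have e : (s • (Pi.single a 1 : V → ℝ) + t • u) c = t * u c := by simp [hac.symm]
      have h1 : t * u c ≤ t * x c := mul_le_mul_of_nonneg_left huc ht.le
      have h2 : t * x c < 1 * x c := by
        apply mul_lt_mul_of_pos_right _ hxc; linarith
      refine ⟨⟨cell_convex _ (single_cell ha) hu hs.le ht.le hst, ?_⟩, ?_⟩
      · rw [e]; linarith
      · intro h
        have := congrFun h c
        rw [e] at this
        linarith
    · simp only [if_true]
      rw [starConvex_iff_forall_pos (by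
        refine ⟨⟨single_cell hc, by simp [xc1.le]⟩, ?_⟩
        intro h
        have := congrFun h c
        simp at this
        linarith)]
      rintro u ⟨⟨hu, huc⟩, hux⟩ s t hs ht hst
      have e : (s • (Pi.single c 1 : V → ℝ) + t • u) c = s + t * u c := by simp
      have h1 : t * x c ≤ t * u c := mul_le_mul_of_nonneg_left huc ht.le
      have h2 : s * x c < s * 1 := mul_lt_mul_of_pos_left xc1 hs
      have h4 : s * x c + t * x c = x c := by rw [← add_mul, hst, one_mul]
      refine ⟨⟨cell_convex _ (single_cell hc) hu hs.le ht.le hst, ?_⟩, ?_⟩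
      · rw [e]; linarith
      · intro h
        have := congrFun h c
        rw [e] at this
        linarith
  · rintro (_ | _)
    · refine ⟨⟨single_cell ha, by simp [hac.symm, hxc.le]⟩, ?_⟩
      intro h
      have := congrFun h c
      simp [hac.symm] at this
      linarith
    · refine ⟨⟨single_cell hc, by simp [xc1.le]⟩, ?_⟩
      intro h
      have := congrFun h c
      simp at this
      linarith
  · rintro (_ | _) u ⟨hu, huc⟩
    · exact ⟨hu, by simp [huc]⟩
    · exact ⟨hu, by simp [huc]⟩
  · rw [hN]
    ext u
    constructor
    · intro hu
      right
      rcases le_total (u c) (x c) with h | h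
      · exact mem_iUnion.2 ⟨false, hu, by simpa using h⟩
      · exact mem_iUnion.2 ⟨true, hu, by simpa using h⟩
    · rintro (hu | hu)
      · exact hu.1
      · obtain ⟨i, hi⟩ := mem_iUnion.1 hu
        exact hi.1
  · rintro (_ | _)
    · simp only [Bool.false_eq_true, if_false]; fun_prop
    · simp only [if_true]; fun_prop
  · intro i s hs u
    have e1 : dil x s u c - x c = s * (u c - x c) := by simp [dil]
    have e2 : x c - dil x s u c = s * (x c - u c) := by simp [dil]; ring
    cases i
    · simp only [Bool.false_eq_true, if_false, e2]
      rw [mul_max_of_nonneg _ _ hs.le, mul_zero]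
    · simp only [if_true, e1]
      rw [mul_max_of_nonneg _ _ hs.le, mul_zero]
  · rintro (_ | _) u _
    · simp
    · simp
  · rintro (_ | _) (_ | _) hij u ⟨hu, huc⟩
    · exact absurd rfl hij
    · simpa using huc
    · simpa using huc
    · exact absurd rfl hij
  · rintro (_ | _) u ⟨hu, huc⟩
    · simp [huc]
    · simp [huc]
  · rintro (_ | _) u ⟨hu, huc⟩ h0
    · refine ⟨hu, le_antisymm (by simpa using huc) (by simpa using h0)⟩
    · refine ⟨hu, le_antisymm (by simpa using h0) (by simpa using huc)⟩
  · rintro u ⟨hu, huc⟩ hd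
    have hus := hsum u hu
    have := edge_dz (r := x a + x b) hab rfl (by linarith) (by linarith) hd
    funext v
    by_cases hv : v ∈ sup0 x
    · rw [he] at hv
      simp only [Finset.mem_insert, Finset.mem_singleton] at hv
      rcases hv with rfl | rfl | rfl
      · exact this.1
      · exact this.2
      · exact huc
    · rw [hu.2.2 v hv, hxe.2.2 v hv]
  · have : Convex ℝ {u : V → ℝ | u ∈ {u | u ∈ cell (sup0 x) ∧ u c = x c} ∧ u b * x a - u a * x b < 0} :=
      ((cell_convex _).inter (lin _)).inter (convex_halfSpace_lt (dlin x a b) 0)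
    exact this.starConvex ⟨pa, hda⟩
  · have : Convex ℝ {u : V → ℝ | u ∈ {u | u ∈ cell (sup0 x) ∧ u c = x c} ∧ 0 < u b * x a - u a * x b} :=
      ((cell_convex _).inter (lin _)).inter (convex_halfSpace_gt (dlin x a b) 0)
    exact this.starConvex ⟨pb, hdb⟩

end Geom1

section Geom2
open Topology Set
variable {V : Type} [DecidableEq V] [Fintype V]
variable {W : Type} [DecidableEq W] [Fintype W]

/-- Number of triangles containing a face. -/
def tdeg (K : Finset (Finset V)) (e : Finset V) : ℕ :=
  (K.filter fun F => e ⊆ F ∧ F.card = 3).card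

theorem card_TriOver (K : Finset (Finset V)) (e : Finset V) : Fintype.card (TriOver K e) = tdeg K e := by
  simp [tdeg]

/-- Number of pages at a point. -/
noncomputable def pg (K : Finset (Finset V)) (x : V → ℝ) : ℕ :=
  if (sup0 x).card = 3 then 2 else tdeg K (sup0 x)

theorem pg_le {K : Finset (Finset V)} {L : Finset (Finset W)} (hK : IsCplx K) (hL : IsCplx L)
    (dK : ∀ F ∈ K, F.card ≤ 3) (dL : ∀ F ∈ L, F.card ≤ 3) (h : HP (geomReal K) (geomReal L))
    {x : V → ℝ} (hx : x ∈ geomReal K) (h2 : 2 ≤ (sup0 x).card) (h2' : 2 ≤ (sup0 (h.φ x)).card)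
    (hp : 2 ≤ pg K x) : pg K x ≤ pg L (h.φ x) := by
  have hy := h.φm hx
  have c1 := dK _ (mem_geom.1 hx).2.2
  have c2 := dL _ (mem_geom.1 hy).2.2
  unfold pg at hp ⊢
  by_cases h3 : (sup0 x).card = 3
  · obtain ⟨B⟩ := book_tri hK dK hx h3
    by_cases h3' : (sup0 (h.φ x)).card = 3
    · simp [h3, h3']
    · obtain ⟨C⟩ := book_edge hL dL hy (by omega)
      have := book_le h hx B C (by simp)
      rw [card_TriOver] at this
      simpa [h3, h3'] using this
  · obtain ⟨B⟩ := book_edge hK dK hx (by omega)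
    rw [if_neg h3] at hp ⊢
    by_cases h3' : (sup0 (h.φ x)).card = 3
    · obtain ⟨C⟩ := book_tri hL dL hy h3'
      have := book_le h hx B C (by rw [card_TriOver]; exact hp)
      rw [card_TriOver] at this
      simpa [h3, h3'] using this
    · obtain ⟨C⟩ := book_edge hL dL hy (by omega)
      have := book_le h hx B C (by rw [card_TriOver]; exact hp)
      rw [card_TriOver, card_TriOver] at this
      simpa [h3, h3'] using this

/-- Vertex points. -/
def vpts (V : Type) [DecidableEq V] [Fintype V] : Set (V → ℝ) := range fun v : V => (Pi.single v 1 : V → ℝ)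

theorem vpts_finite : (vpts V).Finite := finite_range _

theorem mem_vpts {K : Finset (Finset V)} (hK : IsCplx K) {u : V → ℝ} (hu : u ∈ geomReal K)
    (h : ¬ 2 ≤ (sup0 u).card) : u ∈ vpts V := by
  have h0 : sup0 u ≠ ∅ := fun h => hK.1 (h ▸ (mem_geom.1 hu).2.2)
  have h1 : (sup0 u).card = 1 := by
    have := Finset.card_pos.2 (Finset.nonempty_iff_ne_empty.2 h0)
    omega
  obtain ⟨v, hv⟩ := Finset.card_eq_one.1 h1
  refine ⟨v, ?_⟩
  have hc := sup0_cell hu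
  have hs := cell_sum hc
  rw [hv] at hs hc
  simp at hs
  funext w
  by_cases hw : w = v
  · subst hw; simp [hs]
  · simp [hw, hc.2.2 w (by simpa using hw)]

/-- Open simplex. -/
def ocell (F : Finset V) : Set (V → ℝ) := {u | u ∈ cell F ∧ ∀ v ∈ F, 0 < u v}

theorem sup0_ocell {F : Finset V} {u : V → ℝ} (hu : u ∈ ocell F) : sup0 u = F := by
  apply subset_antisymm (sup0_sub hu.1)
  intro v hv
  exact mem_sup0.2 (hu.2 v hv).ne'

theorem ocell_convex (F : Finset V) : Convex ℝ (ocell F) := by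
  intro u hu w hw s t hs ht hst
  refine ⟨cell_convex F hu.1 hw.1 hs ht hst, fun v hv => ?_⟩
  simp only [Pi.add_apply, Pi.smul_apply, smul_eq_mul]
  have h1 := hu.2 v hv
  have h2 := hw.2 v hv
  rcases eq_or_lt_of_le hs with rfl | hs'
  · have : t = 1 := by linarith
    subst this; simpa using h2
  · have := mul_pos hs' h1
    have := mul_nonneg ht h2.le
    linarith

/-- The barycenter, weighted. -/
theorem exists_ocell {F : Finset V} (hF : F.Nonempty) : (ocell F).Nonempty := by
  refine ⟨fun v => if v ∈ F then (F.card : ℝ)⁻¹ else 0, ⟨fun v => ?_, ?_, fun v hv => ?_⟩, fun v hv => ?_⟩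
  · dsimp only; split_ifs <;> positivity
  · have : (F.card : ℝ) ≠ 0 := by exact_mod_cast hF.card_pos.ne'
    simp [Finset.sum_ite_mem, this]
  · simp [hv]
  · have : 0 < (F.card : ℝ) := by exact_mod_cast hF.card_pos
    simp [hv, this]

theorem ray_ocell {F : Finset V} {x m : V → ℝ} (hx : x ∈ cell F) (hm : m ∈ ocell F) {t : ℝ} (ht : 0 < t)
    (ht1 : t ≤ 1) : x + t • (m - x) ∈ ocell F := by
  refine ⟨(cell_convex F).add_smul_sub_mem hx hm.1 ⟨ht.le, ht1⟩, fun v hv => ?_⟩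
  simp only [Pi.add_apply, Pi.smul_apply, Pi.sub_apply, smul_eq_mul]
  have h1 := mul_pos ht (hm.2 v hv)
  have h2 := mul_nonneg (sub_nonneg.2 ht1) (hx.1 v)
  linarith

theorem exists_ocell_ne {F : Finset V} (hF : 2 ≤ F.card) (x : V → ℝ) : ∃ m ∈ ocell F, m ≠ x := by
  obtain ⟨m, hm⟩ := exists_ocell (F := F) (Finset.card_pos.1 (by omega))
  by_cases hmx : m = x
  · obtain ⟨a, ha, b, hb, hab⟩ := Finset.one_lt_card.1 (show 1 < F.card by omega)
    refine ⟨_, ray_ocell (single_cell ha) hm (t := 1 / 2) (by norm_num) (by norm_num), ?_⟩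
    rw [← hmx]
    intro h
    have := congrFun h b
    simp [hab.symm] at this
    have := hm.2 b hb
    linarith
  · exact ⟨m, hm, hmx⟩

theorem dense_ocell {F : Finset V} (hF : 2 ≤ F.card) {x : V → ℝ} (hx : x ∈ cell F) {Z : Set (V → ℝ)}
    (hZ : Z.Finite) : x ∈ closure (ocell F \ Z) := by
  obtain ⟨m, hm, hmx⟩ := exists_ocell_ne hF x
  have inj : Function.Injective fun t : ℝ => x + t • (m - x) := by
    intro s t hst
    have h1 : s • (m - x) = t • (m - x) := add_left_cancel hst
    exact smul_left_injective ℝ (sub_ne_zero.2 hmx) h1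
  have fin : ((fun t : ℝ => x + t • (m - x)) ⁻¹' Z).Finite := hZ.preimage inj.injOn
  have tend : Filter.Tendsto (fun t : ℝ => x + t • (m - x)) (𝓝[>] 0) (𝓝 x) := by
    have : Continuous fun t : ℝ => x + t • (m - x) := by fun_prop
    have h := (this.tendsto 0).mono_left (nhdsWithin_le_nhds (s := Ioi 0))
    simpa using h
  refine mem_closure_of_tendsto tend ?_
  have h1 : (((fun t : ℝ => x + t • (m - x)) ⁻¹' Z) \ {0})ᶜ ∈ 𝓝 (0 : ℝ) :=
    (fin.subset sdiff_subset).isClosed.isOpen_compl.mem_nhds (by simp)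
  filter_upwards [mem_nhdsWithin_of_mem_nhds h1, mem_nhdsWithin_of_mem_nhds (Iio_mem_nhds one_pos),
    self_mem_nhdsWithin] with t h1 h2 h3
  have h3' : (0 : ℝ) < t := h3
  have h2' : t < 1 := h2
  refine ⟨ray_ocell hx hm h3' h2'.le, fun hz => h1 ⟨hz, h3'.ne'⟩⟩

theorem ocell_sub_geom {K : Finset (Finset V)} (hK : IsCplx K) {F : Finset V} (hF : F ∈ K) :
    ocell F ⊆ geomReal K := fun _ hu => cell_sub_geom hK hF hu.1

/-- The triangles of a complex. -/
def tris (K : Finset (Finset V)) : Finset (Finset V) := K.filter fun F => F.card = 3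

/-- A good complex. -/
structure GoodC (K : Finset (Finset V)) : Prop where
  cplx : IsCplx K
  dim : ∀ F ∈ K, F.card ≤ 3
  deg : ∀ e ∈ K, e.card = 2 → tdeg K e = 2 ∨ tdeg K e = 3
  vert : ∀ F ∈ K, F.card = 1 → ∃ e ∈ K, e.card = 2 ∧ F ⊆ e
  conn : ∀ Z ⊆ tris K, (∀ T ∈ Z, ∀ T' ∈ tris K, ∀ e ∈ K, e.card = 2 → tdeg K e = 2 → e ⊆ T → e ⊆ T' →
    T' ∈ Z) → Z.Nonempty → Z = tris K

theorem GoodC.pg_cases {K : Finset (Finset V)} (hK : GoodC K) {x : V → ℝ} (hx : x ∈ geomReal K)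
    (h2 : 2 ≤ (sup0 x).card) : pg K x = 2 ∨ pg K x = 3 := by
  have hx' := (mem_geom.1 hx).2.2
  have := hK.dim _ hx'
  unfold pg
  split_ifs with h
  · simp
  · exact hK.deg _ hx' (by omega)

theorem pg_eq {K : Finset (Finset V)} {L : Finset (Finset W)} (hK : IsCplx K) (hL : GoodC L)
    (dK : ∀ F ∈ K, F.card ≤ 3) (h : HP (geomReal K) (geomReal L))
    {x : V → ℝ} (hx : x ∈ geomReal K) (h2 : 2 ≤ (sup0 x).card) (h2' : 2 ≤ (sup0 (h.φ x)).card) :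
    pg K x = pg L (h.φ x) := by
  have hy := h.φm hx
  have h1 := hL.pg_cases hy h2'
  have e1 : h.symm.φ (h.φ x) = x := h.ψφ x hx
  have h3 := pg_le hL.cplx hK hL.dim dK h.symm hy h2' (by rw [e1]; exact h2) (by omega)
  rw [e1] at h3
  exact le_antisymm (pg_le hK hL.cplx dK hL.dim h hx h2 h2' (by omega)) h3

/-- points mapped to vertex points, as a finite set -/
theorem bad_finite {K : Finset (Finset V)} {L : Finset (Finset W)}
    (h : HP (geomReal K) (geomReal L)) : (h.ψ '' vpts W).Finite := vpts_finite.image _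

theorem not_bad {K : Finset (Finset V)} {L : Finset (Finset W)} (hL : IsCplx L)
    (h : HP (geomReal K) (geomReal L)) {x : V → ℝ} (hx : x ∈ geomReal K) (hb : x ∉ h.ψ '' vpts W) :
    2 ≤ (sup0 (h.φ x)).card := by
  by_contra hcon
  exact hb ⟨h.φ x, mem_vpts hL (h.φm hx) hcon, h.ψφ x hx⟩

theorem transfer_deg {K : Finset (Finset V)} {L : Finset (Finset W)} (hK : IsCplx K) (hL : GoodC L)
    (dK : ∀ F ∈ K, F.card ≤ 3) (h : HP (geomReal K) (geomReal L)) :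
    ∀ e ∈ K, e.card = 2 → tdeg K e = 2 ∨ tdeg K e = 3 := by
  intro e he h2
  obtain ⟨m, hm⟩ := exists_ocell (F := e) (Finset.card_pos.1 (by omega))
  have := dense_ocell (F := e) h2.ge hm.1 (bad_finite h)
  obtain ⟨y, hy⟩ := closure_nonempty_iff.1 ⟨_, this⟩
  have hyK := ocell_sub_geom hK he hy.1
  have hs := sup0_ocell hy.1
  have h2' := not_bad hL.cplx h hyK hy.2
  have e1 := pg_eq hK hL dK h hyK (by rw [hs]; omega) h2'
  have e2 := hL.pg_cases (h.φm hyK) h2'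
  rw [← e1] at e2
  simpa [pg, hs, h2] using e2

/-- The singular set. -/
def SingS (K : Finset (Finset V)) : Set (V → ℝ) :=
  ⋃ e ∈ K.filter fun e => e.card = 2 ∧ tdeg K e = 3, cell e

theorem mem_SingS {K : Finset (Finset V)} {u : V → ℝ} :
    u ∈ SingS K ↔ ∃ e ∈ K, e.card = 2 ∧ tdeg K e = 3 ∧ u ∈ cell e := by
  simp [SingS, and_assoc]

theorem SingS_closed (K : Finset (Finset V)) : IsClosed (SingS K) :=
  Finset.finite_toSet _ |>.isClosed_biUnion fun e _ => cell_closed e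

theorem SingS_map {K : Finset (Finset V)} {L : Finset (Finset W)} (hK : IsCplx K) (hL : GoodC L)
    (dK : ∀ F ∈ K, F.card ≤ 3) (h : HP (geomReal K) (geomReal L)) {x : V → ℝ} (hx : x ∈ SingS K) :
    h.φ x ∈ SingS L := by
  obtain ⟨e, he, h2, h3, hxe⟩ := mem_SingS.1 hx
  have h1 := dense_ocell (F := e) h2.ge hxe (bad_finite h)
  have hc : ContinuousWithinAt h.φ (ocell e \ h.ψ '' vpts W) x :=
    (h.φc x (cell_sub_geom hK he hxe)).mono (fun u hu => ocell_sub_geom hK he hu.1)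
  have h4 := hc.mem_closure_image h1
  refine (SingS_closed L).closure_subset_iff.2 ?_ h4
  rintro _ ⟨y, hy, rfl⟩
  have hyK := ocell_sub_geom hK he hy.1
  have hs := sup0_ocell hy.1
  have h2' := not_bad hL.cplx h hyK hy.2
  have e1 := pg_eq hK hL dK h hyK (by rw [hs]; omega) h2'
  have e2 : pg K y = 3 := by simp [pg, hs, h2, h3]
  have hyL := h.φm hyK
  have hdim := hL.dim _ (mem_geom.1 hyL).2.2
  rw [e1] at e2
  unfold pg at e2
  split_ifs at e2 with h5
  · omega
  exact mem_SingS.2 ⟨_, (mem_geom.1 hyL).2.2, by omega, e2, sup0_cell hyL⟩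

end Geom2

section Geom3
open Topology Set
variable {V : Type} [DecidableEq V] [Fintype V]
variable {W : Type} [DecidableEq W] [Fintype W]

theorem ocell_diff_preconn {T : Finset V} (hT : T.card = 3) {Z : Set (V → ℝ)} (hZ : Z.Finite) :
    IsPreconnected (ocell T \ Z) := by
  obtain ⟨a, b, c, hab, hac, hbc, rfl⟩ := Finset.card_eq_three.1 hT
  let g : ℝ × ℝ → V → ℝ := fun q v =>
    (if v = a then Real.exp q.1 else if v = b then Real.exp q.2 else if v = c then 1 else 0) /
      (Real.exp q.1 + Real.exp q.2 + 1)
  have hpos : ∀ q : ℝ × ℝ, 0 < Real.exp q.1 + Real.exp q.2 + 1 := fun q => by positivity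
  have ga : ∀ q, g q a = Real.exp q.1 / (Real.exp q.1 + Real.exp q.2 + 1) := fun q => by simp [g]
  have gb : ∀ q, g q b = Real.exp q.2 / (Real.exp q.1 + Real.exp q.2 + 1) := fun q => by
    simp [g, hab.symm]
  have gc : ∀ q, g q c = 1 / (Real.exp q.1 + Real.exp q.2 + 1) := fun q => by
    simp [g, hac.symm, hbc.symm]
  have gz : ∀ q v, v ≠ a → v ≠ b → v ≠ c → g q v = 0 := fun q v h1 h2 h3 => by
    simp [g, h1, h2, h3]
  have gcont : Continuous g := by
    refine continuous_pi fun v => ?_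
    simp only [g]
    refine Continuous.div ?_ (by fun_prop) (fun q => (hpos q).ne')
    split_ifs <;> fun_prop
  have ginj : Function.Injective g := by
    intro q r h
    have ha := congrFun h a
    have hb := congrFun h b
    have hc := congrFun h c
    rw [ga, ga] at ha
    rw [gb, gb] at hb
    rw [gc, gc] at hc
    have hs : Real.exp q.1 + Real.exp q.2 + 1 = Real.exp r.1 + Real.exp r.2 + 1 := by
      have := inv_injective (by simpa using hc)
      rw [this]
    rw [hs, div_left_inj' (hpos r).ne'] at ha hb
    exact Prod.ext (Real.exp_injective ha) (Real.exp_injective hb)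
  have sum3 : ∀ u : V → ℝ, ∑ v ∈ ({a, b, c} : Finset V), u v = u a + u b + u c := fun u => by
    rw [Finset.sum_insert (by simp [hab, hac]), Finset.sum_pair hbc]; ring
  have grange : ∀ u, u ∈ ocell ({a, b, c} : Finset V) ↔ ∃ q, g q = u := by
    intro u
    constructor
    · intro hu
      have ua := hu.2 a (by simp)
      have ub := hu.2 b (by simp)
      have uc := hu.2 c (by simp)
      have hs := cell_sum hu.1
      rw [sum3] at hs
      refine ⟨(Real.log (u a / u c), Real.log (u b / u c)), ?_⟩
      have hd : Real.exp (Real.log (u a / u c)) + Real.exp (Real.log (u b / u c)) + 1 = 1 / u c := by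
        rw [Real.exp_log (by positivity), Real.exp_log (by positivity)]
        field_simp; exact hs
      funext v
      by_cases h1 : v = a
      · subst h1
        rw [ga, hd]; dsimp only; rw [Real.exp_log (by positivity)]; field_simp
      by_cases h2 : v = b
      · subst h2
        rw [gb, hd]; dsimp only; rw [Real.exp_log (by positivity)]; field_simp
      by_cases h3 : v = c
      · subst h3
        rw [gc, hd]; field_simp
      · rw [gz _ _ h1 h2 h3, hu.1.2.2 v (by simp [h1, h2, h3])]
    · rintro ⟨q, rfl⟩
      have hz : ∀ v, v ∉ ({a, b, c} : Finset V) → g q v = 0 := by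
        intro v hv
        simp only [Finset.mem_insert, Finset.mem_singleton, not_or] at hv
        exact gz q v hv.1 hv.2.1 hv.2.2
      have hp : ∀ v ∈ ({a, b, c} : Finset V), 0 < g q v := by
        intro v hv
        simp only [Finset.mem_insert, Finset.mem_singleton] at hv
        have := hpos q
        rcases hv with rfl | rfl | rfl
        · rw [ga]; positivity
        · rw [gb]; positivity
        · rw [gc]; positivity
      refine ⟨⟨fun v => ?_, ?_, hz⟩, hp⟩
      · by_cases hv : v ∈ ({a, b, c} : Finset V)
        · exact (hp v hv).le
        · rw [hz v hv]
      · rw [← Finset.sum_subset (Finset.subset_univ ({a, b, c} : Finset V)) (fun v _ hv => hz v hv),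
          sum3, ga, gb, gc]
        have := hpos q
        field_simp
  have key : ocell ({a, b, c} : Finset V) \ Z = g '' (g ⁻¹' Z)ᶜ := by
    ext u
    constructor
    · rintro ⟨hu, hz⟩
      obtain ⟨q, rfl⟩ := (grange u).1 hu
      exact ⟨q, hz, rfl⟩
    · rintro ⟨q, hq, rfl⟩
      exact ⟨(grange _).2 ⟨q, rfl⟩, hq⟩
  rw [key]
  refine IsPreconnected.image ?_ _ gcont.continuousOn
  refine ((hZ.preimage ginj.injOn).countable.isConnected_compl_of_one_lt_rank ?_).isPreconnected
  rw [rank_prod']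
  simp [one_add_one_eq_two]

theorem closure_ocell_diff {F : Finset V} (hF : 2 ≤ F.card) {Z : Set (V → ℝ)} (hZ : Z.Finite) :
    cell F ⊆ closure (ocell F \ Z) := fun _ hx => dense_ocell hF hx hZ

theorem mem_tris {K : Finset (Finset V)} {T : Finset V} : T ∈ tris K ↔ T ∈ K ∧ T.card = 3 := by
  simp [tris]

theorem ocell_notSing {K : Finset (Finset V)} {F : Finset V} (hF2 : 2 ≤ F.card)
    (hF : F.card = 2 → tdeg K F ≠ 3) {u : V → ℝ} (hu : u ∈ ocell F) : u ∉ SingS K := by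
  intro hs
  obtain ⟨e, he, h2, h3, hue⟩ := mem_SingS.1 hs
  have h1 := sup0_sub hue
  rw [sup0_ocell hu] at h1
  have : F = e := Finset.eq_of_subset_of_card_le h1 (by omega)
  subst this
  exact hF h2 h3

theorem GoodC.exists_tri {K : Finset (Finset V)} (hK : GoodC K) {F : Finset V} (hF : F ∈ K) :
    ∃ T ∈ tris K, F ⊆ T := by
  have h2 : ∀ e ∈ K, e.card = 2 → ∃ T ∈ tris K, e ⊆ T := by
    intro e he h2
    have : 0 < tdeg K e := by rcases hK.deg e he h2 with h | h <;> omega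
    obtain ⟨T, hT⟩ := Finset.card_pos.1 this
    rw [Finset.mem_filter] at hT
    exact ⟨T, mem_tris.2 ⟨hT.1, hT.2.2⟩, hT.2.1⟩
  have h3 := hK.dim F hF
  have h0 : F ≠ ∅ := fun h => hK.cplx.1 (h ▸ hF)
  have := Finset.card_pos.2 (Finset.nonempty_iff_ne_empty.2 h0)
  interval_cases hc : F.card
  · obtain ⟨e, he, he2, hFe⟩ := hK.vert F hF hc
    obtain ⟨T, hT, heT⟩ := h2 e he he2
    exact ⟨T, hT, hFe.trans heT⟩
  · exact h2 F hF hc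
  · exact ⟨F, mem_tris.2 ⟨hF, hc⟩, subset_rfl⟩

/-- Sharing a nonsingular edge. -/
def nsAdj (K : Finset (Finset V)) (T T' : Finset V) : Prop :=
  T ∈ tris K ∧ T' ∈ tris K ∧ ∃ e ∈ K, e.card = 2 ∧ tdeg K e = 2 ∧ e ⊆ T ∧ e ⊆ T'

theorem GoodC.chain {K : Finset (Finset V)} (hK : GoodC K) {T T' : Finset V} (hT : T ∈ tris K)
    (hT' : T' ∈ tris K) : Relation.ReflTransGen (nsAdj K) T T' := by
  classical
  have := hK.conn ((tris K).filter fun S => Relation.ReflTransGen (nsAdj K) T S)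
    (Finset.filter_subset _ _) ?_ ⟨T, by simp [hT, Relation.ReflTransGen.refl]⟩
  · rw [← this, Finset.mem_filter] at hT'
    exact hT'.2
  · intro S hS S' hS' e he h2 h3 h4 h5
    rw [Finset.mem_filter] at hS ⊢
    exact ⟨hS', hS.2.tail ⟨hS.1, hS', e, he, h2, h3, h4, h5⟩⟩

theorem GoodC.preconn {L : Finset (Finset W)} (hL : GoodC L) {Z : Set (W → ℝ)} (hZ : Z.Finite) :
    IsPreconnected ((geomReal L \ SingS L) \ Z) := by
  have hU : (geomReal L \ SingS L) \ Z = ⋃ T : {T // T ∈ tris L}, (cell T.1 \ SingS L) \ Z := by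
    ext u
    constructor
    · rintro ⟨⟨hu, hs⟩, hz⟩
      obtain ⟨T, hT, hsub⟩ := hL.exists_tri (mem_geom.1 hu).2.2
      exact mem_iUnion.2 ⟨⟨T, hT⟩, ⟨cell_mono hsub (sup0_cell hu), hs⟩, hz⟩
    · intro hu
      obtain ⟨T, ⟨hu, hs⟩, hz⟩ := mem_iUnion.1 hu
      exact ⟨⟨cell_sub_geom hL.cplx (mem_tris.1 T.2).1 hu, hs⟩, hz⟩
  rw [hU]
  apply IsPreconnected.iUnion_of_reflTransGen
  · rintro ⟨T, hT⟩
    have h3 := (mem_tris.1 hT).2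
    refine (ocell_diff_preconn h3 hZ).subset_closure ?_ ?_
    · rintro u ⟨hu, hz⟩
      exact ⟨⟨hu.1, ocell_notSing (by omega) (by omega) hu⟩, hz⟩
    · rintro u ⟨⟨hu, _⟩, _⟩
      exact dense_ocell (by show 2 ≤ T.card; omega) hu hZ
  · rintro ⟨T, hT⟩ ⟨T', hT'⟩
    have := hL.chain hT hT'
    induction this with
    | refl => exact Relation.ReflTransGen.refl
    | tail h1 h2 ih =>
      rename_i S S'
      have hS : S ∈ tris L := h2.1
      refine (ih hS).tail ?_
      obtain ⟨_, _, e, he, he2, hd, h4, h5⟩ := h2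
      obtain ⟨m, hm⟩ := exists_ocell (F := e) (Finset.card_pos.1 (by omega))
      have := dense_ocell (F := e) he2.ge hm.1 hZ
      obtain ⟨y, hy, hyz⟩ := closure_nonempty_iff.1 ⟨_, this⟩
      have hns : y ∉ SingS L := ocell_notSing he2.ge (by intro _; omega) hy
      exact ⟨y, ⟨⟨cell_mono h4 hy.1, hns⟩, hyz⟩, ⟨⟨cell_mono h5 hy.1, hns⟩, hyz⟩⟩

theorem GoodC.exists_singular_of {K : Finset (Finset V)} {L : Finset (Finset W)} (hK : GoodC K)
    (hL : GoodC L) (h : HP (geomReal K) (geomReal L)) (hs : (SingS L).Nonempty) :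
    ∃ e ∈ K, e.card = 2 ∧ tdeg K e = 3 := by
  obtain ⟨y, hy⟩ := hs
  have := SingS_map hL.cplx hK hL.dim h.symm hy
  obtain ⟨e, he, h2, h3, _⟩ := mem_SingS.1 this
  exact ⟨e, he, h2, h3⟩

theorem transfer_vert {K : Finset (Finset V)} {L : Finset (Finset W)} (hK : IsCplx K) (hL : GoodC L)
    (h : HP (geomReal K) (geomReal L)) :
    ∀ F ∈ K, F.card = 1 → ∃ e ∈ K, e.card = 2 ∧ F ⊆ e := by
  intro F hF h1
  by_contra hcon
  push Not at hcon
  obtain ⟨v, rfl⟩ := Finset.card_eq_one.1 h1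
  have hx : (Pi.single v 1 : V → ℝ) ∈ geomReal K := cell_sub_geom hK hF (single_cell (by simp))
  have hsup : sup0 (Pi.single v 1 : V → ℝ) = {v} := by
    ext w; rw [mem_sup0]
    by_cases hw : w = v
    · subst hw; simp
    · simp [hw]
  have hmax : ∀ G ∈ K, v ∈ G → G = {v} := by
    intro G hG hv
    by_contra hne
    have : ∃ w ∈ G, w ≠ v := by
      by_contra h'
      push Not at h'
      apply hne
      ext w; simp only [Finset.mem_singleton]
      exact ⟨h' w, fun h => h ▸ hv⟩
    obtain ⟨w, hw, hwv⟩ := this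
    refine hcon {v, w} (hK.2 G hG _ ?_ (by simp)) (Finset.card_pair hwv.symm) (by simp)
    intro z hz
    simp only [Finset.mem_insert, Finset.mem_singleton] at hz
    rcases hz with rfl | rfl <;> assumption
  -- the point is isolated
  have hiso : {(Pi.single v 1 : V → ℝ)} ∈ 𝓝[geomReal K] (Pi.single v 1 : V → ℝ) := by
    have := starN_Dn hx 1 one_pos le_rfl
    refine Filter.mem_of_superset (Filter.mem_of_superset this (starN_Ds hx 1 one_pos le_rfl)) ?_
    rintro u ⟨G, hG, hsub, hu⟩
    rw [hsup] at hsub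
    have hG' := hmax G hG (hsub (by simp))
    subst hG'
    have hs := cell_sum hu
    simp at hs
    rw [mem_singleton_iff]
    funext w
    by_cases hw : w = v
    · subst hw; simp [hs]
    · simp [hw, hu.2.2 w (by simpa using hw)]
  have h2 := h.nhds hx hiso
  have hy := h.φm hx
  obtain ⟨T, hT, hsub⟩ := hL.exists_tri (mem_geom.1 hy).2.2
  have hyT := cell_mono hsub (sup0_cell hy)
  have h3 := (mem_tris.1 hT).2
  have hcl := dense_ocell (F := T) (by omega) hyT (Set.finite_singleton (h.φ (Pi.single v 1)))
  rw [mem_closure_iff_nhdsWithin_neBot] at hcl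
  have hle : 𝓝[ocell T \ {h.φ (Pi.single v 1)}] (h.φ (Pi.single v 1)) ≤
      𝓝[geomReal L] (h.φ (Pi.single v 1)) :=
    nhdsWithin_mono _ fun u hu => ocell_sub_geom hL.cplx (mem_tris.1 hT).1 hu.1
  obtain ⟨u, hu1, hu2⟩ := hcl.nonempty_of_mem (Filter.inter_mem (hle h2) self_mem_nhdsWithin)
  apply hu2.2
  have : h.ψ u = Pi.single v 1 := hu1.2
  rw [mem_singleton_iff, ← this, h.φψ u hu1.1]

theorem transfer_good {K : Finset (Finset V)} {L : Finset (Finset W)} (hK : IsCplx K) (hL : GoodC L)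
    (dK : ∀ F ∈ K, F.card ≤ 3) (h : HP (geomReal K) (geomReal L)) : GoodC K := by
  have hdeg := transfer_deg hK hL dK h
  have hvert := transfer_vert hK hL h
  have hcov : ∀ F ∈ K, ∃ T ∈ tris K, F ⊆ T := by
    have h2 : ∀ e ∈ K, e.card = 2 → ∃ T ∈ tris K, e ⊆ T := by
      intro e he h2
      have : 0 < tdeg K e := by rcases hdeg e he h2 with h | h <;> omega
      obtain ⟨T, hT⟩ := Finset.card_pos.1 this
      rw [Finset.mem_filter] at hT
      exact ⟨T, mem_tris.2 ⟨hT.1, hT.2.2⟩, hT.2.1⟩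
    intro F hF
    have h3 := dK F hF
    have h0 : F ≠ ∅ := fun h => hK.1 (h ▸ hF)
    have := Finset.card_pos.2 (Finset.nonempty_iff_ne_empty.2 h0)
    interval_cases hc : F.card
    · obtain ⟨e, he, he2, hFe⟩ := hvert F hF hc
      obtain ⟨T, hT, heT⟩ := h2 e he he2
      exact ⟨T, hT, hFe.trans heT⟩
    · exact h2 F hF hc
    · exact ⟨F, mem_tris.2 ⟨hF, hc⟩, subset_rfl⟩
  refine ⟨hK, dK, hdeg, hvert, ?_⟩
  intro Z hZ hcl hne
  by_contra hZne
  obtain ⟨T0, hT0⟩ := hne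
  obtain ⟨T1, hT1, hT1Z⟩ : ∃ T ∈ tris K, T ∉ Z := by
    by_contra hcon
    push Not at hcon
    exact hZne (subset_antisymm hZ hcon)
  let A : Set (V → ℝ) := ⋃ T ∈ Z, cell T
  let B : Set (V → ℝ) := ⋃ T ∈ tris K \ Z, cell T
  have hAc : IsClosed A := (Finset.finite_toSet Z).isClosed_biUnion fun e _ => cell_closed e
  have hBc : IsClosed B := (Finset.finite_toSet (tris K \ Z)).isClosed_biUnion fun e _ => cell_closed e
  have hAB : ∀ u, u ∈ A → u ∈ B → u ∈ SingS K ∨ u ∈ vpts V := by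
    intro u hA hB
    simp only [A, B, mem_iUnion, exists_prop, Finset.mem_sdiff] at hA hB
    obtain ⟨T, hT, huT⟩ := hA
    obtain ⟨T', ⟨hT', hTZ⟩, huT'⟩ := hB
    have huK := cell_sub_geom hK (mem_tris.1 hT').1 huT'
    by_cases hc : 2 ≤ (sup0 u).card
    · left
      have s1 := sup0_sub huT
      have s2 := sup0_sub huT'
      have c3 := (mem_tris.1 hT').2
      have c3' := (mem_tris.1 (hZ hT)).2
      have huS := (mem_geom.1 huK).2.2
      have hne3 : (sup0 u).card ≠ 3 := by
        intro h3
        have e1 : sup0 u = T := Finset.eq_of_subset_of_card_le s1 (by omega)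
        have e2 : sup0 u = T' := Finset.eq_of_subset_of_card_le s2 (by omega)
        exact hTZ (e2 ▸ e1 ▸ hT)
      have h3 := dK _ huS
      have h2 : (sup0 u).card = 2 := by omega
      rcases hdeg _ huS h2 with hd | hd
      · exact absurd (hcl T hT T' hT' _ huS h2 hd s1 s2) hTZ
      · exact mem_SingS.2 ⟨_, huS, h2, hd, sup0_cell huK⟩
    · right
      exact mem_vpts hK huK hc
  -- the preconnected set
  let Y : Set (V → ℝ) := (geomReal K \ SingS K) \ (vpts V ∩ geomReal K)
  have hYim : Y = h.ψ '' ((geomReal L \ SingS L) \ (h.φ '' (vpts V ∩ geomReal K))) := by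
    ext u
    constructor
    · rintro ⟨⟨huK, hs⟩, hz⟩
      refine ⟨h.φ u, ⟨⟨h.φm huK, ?_⟩, ?_⟩, h.ψφ u huK⟩
      · intro hs'
        apply hs
        have hmap : h.ψ (h.φ u) ∈ SingS K := by
          obtain ⟨e, he, h2, h3, hxe⟩ := mem_SingS.1 hs'
          have h1 := dense_ocell (F := e) h2.ge hxe ((vpts_finite (V := V)).image h.φ)
          have hc : ContinuousWithinAt h.ψ (ocell e \ h.φ '' vpts V) (h.φ u) :=
            (h.ψc _ (cell_sub_geom hL.cplx he hxe)).mono (fun u hu => ocell_sub_geom hL.cplx he hu.1)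
          have h4 := hc.mem_closure_image h1
          refine (SingS_closed K).closure_subset_iff.2 ?_ h4
          rintro _ ⟨y, hy, rfl⟩
          have hyL := ocell_sub_geom hL.cplx he hy.1
          have hyK := h.ψm hyL
          have hsy := sup0_ocell hy.1
          have h2' : 2 ≤ (sup0 (h.ψ y)).card := by
            by_contra hcon
            exact hy.2 ⟨h.ψ y, mem_vpts hK hyK hcon, h.φψ y hyL⟩
          have e0 : h.φ (h.ψ y) = y := h.φψ y hyL
          have e1 := pg_eq hK hL dK h hyK h2' (by rw [e0, hsy]; omega)
          rw [e0] at e1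
          have e2 : pg L y = 3 := by simp [pg, hsy, h2, h3]
          have hdim := dK _ (mem_geom.1 hyK).2.2
          rw [← e1] at e2
          unfold pg at e2
          split_ifs at e2 with h5
          · omega
          exact mem_SingS.2 ⟨_, (mem_geom.1 hyK).2.2, by omega, e2, sup0_cell hyK⟩
        rwa [h.ψφ u huK] at hmap
      · rintro ⟨w, ⟨hw1, hw2⟩, hw3⟩
        apply hz
        have : w = u := by rw [← h.ψφ w hw2, hw3, h.ψφ u huK]
        exact this ▸ ⟨hw1, hw2⟩
    · rintro ⟨y, ⟨⟨hy, hs⟩, hz⟩, rfl⟩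
      refine ⟨⟨h.ψm hy, ?_⟩, ?_⟩
      · intro hs'
        apply hs
        have := SingS_map hK hL dK h hs'
        rwa [h.φψ y hy] at this
      · intro hz'
        exact hz ⟨_, hz', h.φψ y hy⟩
  have hYp : IsPreconnected Y := by
    rw [hYim]
    refine (hL.preconn (((vpts_finite (V := V)).subset inter_subset_left).image h.φ)).image _ ?_
    exact h.ψc.mono fun u hu => hu.1.1
  rw [isPreconnected_closed_iff] at hYp
  have inY : ∀ T ∈ tris K, ∃ u ∈ Y, u ∈ cell T := by
    intro T hT
    have h3 := (mem_tris.1 hT).2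
    obtain ⟨m, hm⟩ := exists_ocell (F := T) (Finset.card_pos.1 (by omega))
    refine ⟨m, ⟨⟨ocell_sub_geom hK (mem_tris.1 hT).1 hm, ocell_notSing (by omega) (by omega) hm⟩, ?_⟩, hm.1⟩
    rintro ⟨⟨v, hv⟩, _⟩
    have hs := sup0_ocell hm
    have hle : (sup0 m).card ≤ 1 := by
      rw [Finset.card_le_one]
      have : ∀ a ∈ sup0 m, a = v := by
        intro a ha
        rw [mem_sup0, ← hv] at ha
        by_contra hav
        simp [hav] at ha
      intro a ha b hb
      rw [this a ha, this b hb]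
    rw [hs] at hle
    omega
  obtain ⟨u0, hu0, hc0⟩ := inY T0 (hZ hT0)
  obtain ⟨u1, hu1, hc1⟩ := inY T1 hT1
  obtain ⟨w, hwY, hwA, hwB⟩ := hYp A B hAc hBc (by
    intro u hu
    obtain ⟨T, hT, hsub⟩ := hcov _ (mem_geom.1 hu.1.1).2.2
    have huT := cell_mono hsub (sup0_cell hu.1.1)
    by_cases hTZ : T ∈ Z
    · left; exact mem_biUnion hTZ huT
    · right
      exact mem_biUnion (Finset.mem_coe.2 (Finset.mem_sdiff.2 ⟨hT, hTZ⟩)) huT)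
    ⟨u0, hu0, mem_biUnion hT0 hc0⟩
    ⟨u1, hu1, mem_biUnion (Finset.mem_coe.2 (Finset.mem_sdiff.2 ⟨hT1, hT1Z⟩)) hc1⟩
  rcases hAB w hwA hwB with hh | hh
  · exact hwY.1.2 hh
  · exact hwY.2 ⟨hh, hwY.1.1⟩

end Geom3

section Geom4
open Topology Set
variable {V : Type} [DecidableEq V] [Fintype V]
variable {W : Type} [DecidableEq W] [Fintype W]

/-- Local theta property of a pair `(X, S)` at `x`. -/
def Theta {E : Type*} [TopologicalSpace E] (X S : Set E) (x : E) : Prop :=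
  ∀ N ∈ 𝓝[X] x, ∃ U ⊆ N, U ⊆ X ∧ U ∈ 𝓝[X] x ∧ ∀ y ∈ U, y ∉ S →
    ∃ A, IsPreconnected A ∧ y ∈ A ∧ A ⊆ U \ S ∧ S ∩ U ⊆ closure A

theorem Theta.transfer {K : Finset (Finset V)} {L : Finset (Finset W)} (h : HP (geomReal K) (geomReal L))
    {S : Set (V → ℝ)} {S' : Set (W → ℝ)} (hS : ∀ u ∈ geomReal K, u ∈ S ↔ h.φ u ∈ S')
    {x : V → ℝ} (hx : x ∈ geomReal K) (ht : Theta (geomReal L) S' (h.φ x)) : Theta (geomReal K) S x := by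
  intro N hN
  obtain ⟨U', hU'N, hU'Y, hU', hA⟩ := ht _ (h.nhds hx hN)
  have hU := h.symm.nhds (h.φm hx) hU'
  change geomReal K ∩ h.φ ⁻¹' U' ∈ 𝓝[geomReal K] (h.ψ (h.φ x)) at hU
  rw [h.ψφ x hx] at hU
  refine ⟨_, ?_, inter_subset_left, hU, ?_⟩
  · rintro u ⟨hu, hu'⟩
    have := (hU'N hu').2
    rwa [Set.mem_preimage, h.ψφ u hu] at this
  · rintro y ⟨hy, hy'⟩ hyS
    obtain ⟨A, hAp, hyA, hAU, hcl⟩ := hA _ hy' (fun h' => hyS ((hS y hy).2 h'))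
    refine ⟨h.ψ '' A, hAp.image _ (h.ψc.mono fun u hu => hU'Y (hAU hu).1), ⟨_, hyA, h.ψφ y hy⟩, ?_, ?_⟩
    · rintro _ ⟨u, hu, rfl⟩
      have huY := hU'Y (hAU hu).1
      refine ⟨⟨h.ψm huY, ?_⟩, ?_⟩
      · rw [Set.mem_preimage, h.φψ u huY]; exact (hAU hu).1
      · intro h'
        rw [hS _ (h.ψm huY), h.φψ u huY] at h'
        exact (hAU hu).2 h'
    · rintro u ⟨huS, hu, hu'⟩
      have h1 := hcl ⟨(hS u hu).1 huS, hu'⟩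
      have hc : ContinuousWithinAt h.ψ A (h.φ u) :=
        (h.ψc _ (h.φm hu)).mono fun w hw => hU'Y (hAU hw).1
      have := hc.mem_closure_image h1
      rwa [h.ψφ u hu] at this

/-- A class of triangles around `v` missing a singular edge at `v`. -/
def NonTheta (K : Finset (Finset V)) (v : V) : Prop :=
  ∃ Z ⊆ tris K, Z.Nonempty ∧ (∀ T ∈ Z, v ∈ T) ∧
    (∀ T ∈ Z, ∀ T' ∈ tris K, ∀ e ∈ K, e.card = 2 → tdeg K e = 2 → v ∈ e → e ⊆ T → e ⊆ T' → T' ∈ Z) ∧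
    ∃ e ∈ K, e.card = 2 ∧ tdeg K e = 3 ∧ v ∈ e ∧ ∀ T ∈ Z, ¬ e ⊆ T

theorem sup0_single (v : V) : sup0 (Pi.single v 1 : V → ℝ) = {v} := by
  ext w
  rw [mem_sup0, Finset.mem_singleton]
  by_cases h : w = v
  · subst h; simp
  · simp [h]

theorem NonTheta.not_theta {K : Finset (Finset V)} (hK : GoodC K) {v : V} (h : NonTheta K v) :
    (Pi.single v 1 : V → ℝ) ∈ SingS K ∧ ¬ Theta (geomReal K) (SingS K) (Pi.single v 1) := by
  obtain ⟨Z, hZ, ⟨T0, hT0⟩, hvZ, hcl, e', he', he2, he3, hve', hmiss⟩ := h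
  have hvS : (Pi.single v 1 : V → ℝ) ∈ SingS K := mem_SingS.2 ⟨e', he', he2, he3, single_cell hve'⟩
  refine ⟨hvS, fun hth => ?_⟩
  have hxK : (Pi.single v 1 : V → ℝ) ∈ geomReal K := cell_sub_geom hK.cplx he' (single_cell hve')
  have hN : {u : V → ℝ | 0 < u v} ∈ 𝓝[geomReal K] (Pi.single v 1) := by
    apply mem_nhdsWithin_of_mem_nhds
    apply (isOpen_lt continuous_const (continuous_apply v)).mem_nhds
    simp
  obtain ⟨U, hUN, hUX, hU, hA⟩ := hth _ hN
  have near : ∀ F ∈ K, v ∈ F → 2 ≤ F.card → ∃ u ∈ U, u ∈ ocell F := by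
    intro F hF hv h2
    have h1 := dense_ocell (F := F) h2 (single_cell hv) finite_empty
    rw [sdiff_empty, mem_closure_iff_nhdsWithin_neBot] at h1
    have hle : 𝓝[ocell F] (Pi.single v 1 : V → ℝ) ≤ 𝓝[geomReal K] (Pi.single v 1) :=
      nhdsWithin_mono _ (ocell_sub_geom hK.cplx hF)
    obtain ⟨u, hu1, hu2⟩ := h1.nonempty_of_mem (Filter.inter_mem (hle hU) self_mem_nhdsWithin)
    exact ⟨u, hu1, hu2⟩
  have hT0' := mem_tris.1 (hZ hT0)
  obtain ⟨y, hyU, hy⟩ := near T0 hT0'.1 (hvZ T0 hT0) (by omega)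
  obtain ⟨A, hAp, hyA, hAU, hAcl⟩ := hA y hyU (ocell_notSing (by omega) (by omega) hy)
  let P : Set (V → ℝ) := ⋃ T ∈ Z, cell T
  let Q : Set (V → ℝ) := ⋃ T ∈ tris K \ Z, cell T
  have hPc : IsClosed P := (Finset.finite_toSet Z).isClosed_biUnion fun e _ => cell_closed e
  have hQc : IsClosed Q := (Finset.finite_toSet (tris K \ Z)).isClosed_biUnion fun e _ => cell_closed e
  have hAPQ : A ⊆ P ∪ Q := by
    intro u hu
    have huK := hUX (hAU hu).1
    obtain ⟨T, hT, hsub⟩ := hK.exists_tri (mem_geom.1 huK).2.2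
    have huT := cell_mono hsub (sup0_cell huK)
    by_cases hTZ : T ∈ Z
    · left; exact mem_biUnion hTZ huT
    · right
      exact mem_biUnion (Finset.mem_coe.2 (Finset.mem_sdiff.2 ⟨hT, hTZ⟩)) huT
  have hdis : ∀ u ∈ A, u ∈ P → u ∈ Q → False := by
    intro u hu hP hQ
    simp only [P, Q, mem_iUnion, exists_prop, Finset.mem_sdiff] at hP hQ
    obtain ⟨T, hT, huT⟩ := hP
    obtain ⟨T', ⟨hT', hTZ⟩, huT'⟩ := hQ
    have huK := hUX (hAU hu).1
    have huv : v ∈ sup0 u := mem_sup0.2 (ne_of_gt (hUN (hAU hu).1))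
    have s1 := sup0_sub huT
    have s2 := sup0_sub huT'
    have c3 := (mem_tris.1 hT').2
    have c3' := (mem_tris.1 (hZ hT)).2
    have huS := (mem_geom.1 huK).2.2
    have hne3 : (sup0 u).card ≠ 3 := by
      intro h3
      have e1 : sup0 u = T := Finset.eq_of_subset_of_card_le s1 (by omega)
      have e2 : sup0 u = T' := Finset.eq_of_subset_of_card_le s2 (by omega)
      exact hTZ (e2 ▸ e1 ▸ hT)
    have h3 := hK.dim _ huS
    have hpos := Finset.card_pos.2 ⟨v, huv⟩
    by_cases h2 : (sup0 u).card = 2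
    · rcases hK.deg _ huS h2 with hd | hd
      · exact hTZ (hcl T hT T' hT' _ huS h2 hd huv s1 s2)
      · exact (hAU hu).2 (mem_SingS.2 ⟨_, huS, h2, hd, sup0_cell huK⟩)
    · have h1 : (sup0 u).card = 1 := by omega
      have hsv : sup0 u = {v} := by
        obtain ⟨w, hw⟩ := Finset.card_eq_one.1 h1
        rw [hw, Finset.mem_singleton] at huv
        rw [hw, huv]
      apply (hAU hu).2
      refine mem_SingS.2 ⟨e', he', he2, he3, cell_mono ?_ (sup0_cell huK)⟩
      rw [hsv]; simpa using hve'
  have hAP : A ⊆ P := by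
    intro u hu
    by_contra hP
    have huQ : u ∈ Q := (hAPQ hu).resolve_left hP
    obtain ⟨w, hw, hw1, hw2⟩ := (isPreconnected_closed_iff.1 hAp) P Q hPc hQc hAPQ
      ⟨y, hyA, mem_biUnion hT0 hy.1⟩ ⟨u, hu, huQ⟩
    exact hdis w hw hw1 hw2
  obtain ⟨z, hzU, hz⟩ := near e' he' hve' (by omega)
  have hzP : z ∈ P := (hPc.closure_subset_iff.2 hAP) (hAcl ⟨mem_SingS.2 ⟨e', he', he2, he3, hz.1⟩, hzU⟩)
  simp only [P, mem_iUnion, exists_prop] at hzP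
  obtain ⟨T, hT, hzT⟩ := hzP
  have := sup0_sub hzT
  rw [sup0_ocell hz] at this
  exact hmiss T hT this

/-- Sharing a nonsingular edge over `F`. -/
def nsAdjF (K : Finset (Finset V)) (F T T' : Finset V) : Prop :=
  T ∈ tris K ∧ T' ∈ tris K ∧ ∃ e ∈ K, e.card = 2 ∧ tdeg K e = 2 ∧ F ⊆ e ∧ e ⊆ T ∧ e ⊆ T'

theorem dil_ocell_of {F : Finset V} {x m : V → ℝ} (hx : x ∈ cell F) (hm : m ∈ ocell F) {s : ℝ} (hs : 0 < s)
    (hs1 : s ≤ 1) : dil x s m ∈ ocell F := ray_ocell hx hm hs hs1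

theorem theta_of {K : Finset (Finset V)} (hK : GoodC K) {x : V → ℝ} (hx : x ∈ geomReal K)
    (hr : ∀ T ∈ tris K, sup0 x ⊆ T → ∀ e ∈ K, e.card = 2 → tdeg K e = 3 → sup0 x ⊆ e →
      ∃ T', e ⊆ T' ∧ T' ∈ tris K ∧ Relation.ReflTransGen (nsAdjF K (sup0 x)) T T') :
    Theta (geomReal K) (SingS K) x := by
  classical
  intro N hN
  have hO : {u : V → ℝ | ∀ v ∈ sup0 x, 0 < u v} ∈ 𝓝 x := by
    have : {u : V → ℝ | ∀ v ∈ sup0 x, 0 < u v} = ⋂ v ∈ sup0 x, {u : V → ℝ | 0 < u v} := by ext u; simp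
    rw [this]
    refine (Filter.biInter_finset_mem _).2 fun v hv => ?_
    exact (isOpen_lt continuous_const (continuous_apply v)).mem_nhds (geom_pos hx hv)
  obtain ⟨s, hs, hs1, hsub⟩ := starN_bdd hK.cplx hx _ (Filter.inter_mem hN (mem_nhdsWithin_of_mem_nhds hO))
  refine ⟨dil x s '' starN K (sup0 x), fun u hu => (hsub hu).1,
    (starN_Ds hx s hs hs1).trans (starN_sub hK.cplx _), starN_Dn hx s hs hs1, ?_⟩
  rintro y ⟨u, ⟨F, hF, hxF, huF⟩, rfl⟩ hyS
  obtain ⟨T, hT, hFT⟩ := hK.exists_tri hF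
  have hxT := hxF.trans hFT
  let I := {T' : Finset V // T' ∈ tris K ∧ sup0 x ⊆ T' ∧ Relation.ReflTransGen (nsAdjF K (sup0 x)) T T'}
  let T00 : I := ⟨T, hT, hxT, Relation.ReflTransGen.refl⟩
  have hxc : ∀ F, sup0 x ⊆ F → x ∈ cell F := fun F h => cell_mono h (sup0_cell hx)
  have hdc : Continuous (dil x s) := by unfold dil; fun_prop
  let A : Set (V → ℝ) := ⋃ T' : I, (dil x s '' cell T'.1) \ SingS K
  have hclc : ∀ T' : I, dil x s '' cell T'.1 ⊆ closure (dil x s '' ocell T'.1) := by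
    intro T'
    have h3 := (mem_tris.1 T'.2.1).2
    rintro _ ⟨w, hw, rfl⟩
    have h1 := dense_ocell (F := T'.1) (by omega) hw finite_empty
    rw [sdiff_empty] at h1
    exact image_closure_subset_closure_image hdc ⟨w, h1, rfl⟩
  have hos : ∀ T' : I, dil x s '' ocell T'.1 ⊆ (dil x s '' cell T'.1) \ SingS K := by
    intro T'
    have h3 := (mem_tris.1 T'.2.1).2
    rintro _ ⟨w, hw, rfl⟩
    exact ⟨⟨w, hw.1, rfl⟩, ocell_notSing (by omega) (by omega) (dil_ocell_of (hxc _ T'.2.2.1) hw hs hs1)⟩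
  refine ⟨A, ?_, mem_iUnion.2 ⟨T00, ⟨u, cell_mono hFT huF, rfl⟩, hyS⟩, ?_, ?_⟩
  · have hpc : ∀ T' : I, IsPreconnected ((dil x s '' cell T'.1) \ SingS K) := by
      intro T'
      refine IsPreconnected.subset_closure
        (((ocell_convex T'.1).isPreconnected).image _ hdc.continuousOn) (hos T') ?_
      exact sdiff_subset.trans (hclc T')
    have hreach : ∀ T', (hT' : Relation.ReflTransGen (nsAdjF K (sup0 x)) T T') →
        ∀ (h1 : T' ∈ tris K) (h2 : sup0 x ⊆ T'), Relation.ReflTransGen (fun i j : I =>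
        (((dil x s '' cell i.1) \ SingS K) ∩ ((dil x s '' cell j.1) \ SingS K)).Nonempty) T00
          ⟨T', h1, h2, hT'⟩ := by
      intro T' hT'
      induction hT' with
      | refl => intro _ _; exact Relation.ReflTransGen.refl
      | tail h1 h2 ih =>
        rename_i S S'
        intro hS' hxS'
        obtain ⟨hS, _, e, he, e2, e3, hxe, heS, heS'⟩ := h2
        refine (ih hS (hxe.trans heS)).tail ?_
        obtain ⟨m, hm⟩ := exists_ocell (F := e) (Finset.card_pos.1 (by omega))
        have hns : dil x s m ∉ SingS K :=
          ocell_notSing (by omega) (by omega) (dil_ocell_of (hxc _ hxe) hm hs hs1)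
        exact ⟨dil x s m, ⟨⟨m, cell_mono heS hm.1, rfl⟩, hns⟩, ⟨⟨m, cell_mono heS' hm.1, rfl⟩, hns⟩⟩
    have : A = ⋃ T' : I, (dil x s '' cell T'.1) \ SingS K := rfl
    rw [this]
    refine isPreconnected_of_forall_pair ?_
    intro a ha b hb
    have hpre := IsPreconnected.iUnion_of_reflTransGen hpc (fun i j => ?_)
    · exact ⟨_, subset_rfl, ha, hb, hpre⟩
    · have hi := hreach i.1 i.2.2.2 i.2.1 i.2.2.1
      have hj := hreach j.1 j.2.2.2 j.2.1 j.2.2.1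
      refine Relation.ReflTransGen.trans ?_ hj
      have := hi.swap
      refine Relation.ReflTransGen.mono ?_ _ _ this
      intro a b hab
      obtain ⟨z, hz1, hz2⟩ := hab
      exact ⟨z, hz2, hz1⟩
  · intro w hw
    obtain ⟨T', ⟨z, hz, rfl⟩, hns⟩ := mem_iUnion.1 hw
    exact ⟨⟨z, ⟨T'.1, (mem_tris.1 T'.2.1).1, T'.2.2.1, hz⟩, rfl⟩, hns⟩
  · rintro _ ⟨hwS, w, hw, rfl⟩
    have hpos := (hsub ⟨w, hw, rfl⟩).2
    obtain ⟨e, he, e2, e3, hwe⟩ := mem_SingS.1 hwS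
    have hxe : sup0 x ⊆ e := by
      intro v hv
      exact sup0_sub hwe (mem_sup0.2 (ne_of_gt (hpos v hv)))
    obtain ⟨T', heT', hT', hreach⟩ := hr T hT hxT e he e2 e3 hxe
    have hxT' := hxe.trans heT'
    obtain ⟨F', hF', _, hwF'⟩ := hw
    have hwT' : w ∈ cell T' := by
      refine ⟨hwF'.1, hwF'.2.1, fun v hv => ?_⟩
      have h1 := (cell_mono heT' hwe).2.2 v hv
      have h2 := (hxc T' hxT').2.2 v hv
      simp only [dil, Pi.add_apply, Pi.smul_apply, Pi.sub_apply, smul_eq_mul, h2] at h1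
      have : s * w v = 0 := by linarith
      rcases mul_eq_zero.1 this with h | h
      · exact absurd h hs.ne'
      · exact h
    have i' : I := ⟨T', hT', hxT', hreach⟩
    refine closure_mono ?_ (hclc ⟨T', hT', hxT', hreach⟩ ⟨w, hwT', rfl⟩)
    exact (hos ⟨T', hT', hxT', hreach⟩).trans
      (subset_iUnion (fun T' : I => (dil x s '' cell T'.1) \ SingS K) ⟨T', hT', hxT', hreach⟩)

theorem exists_nonTheta {K : Finset (Finset V)} (hK : GoodC K) {x : V → ℝ} (hx : x ∈ geomReal K)
    (hn : ¬ Theta (geomReal K) (SingS K) x) : ∃ v, NonTheta K v := by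
  classical
  by_contra hcon
  apply hn
  apply theta_of hK hx
  intro T hT hxT e he e2 e3 hxe
  by_contra hno
  push Not at hno
  have hxK := (mem_geom.1 hx).2.2
  have h0 : (sup0 x).Nonempty := Finset.nonempty_iff_ne_empty.2 fun h => hK.cplx.1 (h ▸ hxK)
  have hle := Finset.card_le_card hxe
  have hpos := h0.card_pos
  have h1 : (sup0 x).card = 1 := by
    by_contra h1
    have : sup0 x = e := Finset.eq_of_subset_of_card_le hxe (by omega)
    exact hno T (this ▸ hxT) hT Relation.ReflTransGen.refl
  obtain ⟨v, hv⟩ := Finset.card_eq_one.1 h1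
  rw [hv] at hxT hxe hno
  rw [Finset.singleton_subset_iff] at hxT hxe
  apply hcon
  refine ⟨v, (tris K).filter fun T' => v ∈ T' ∧ Relation.ReflTransGen (nsAdjF K {v}) T T',
    Finset.filter_subset _ _, ⟨T, ?_⟩, ?_, ?_, e, he, e2, e3, hxe, ?_⟩
  · rw [Finset.mem_filter]; exact ⟨hT, hxT, Relation.ReflTransGen.refl⟩
  · intro T' hT'; exact (Finset.mem_filter.1 hT').2.1
  · intro T1 hT1 T2 hT2 e1 he1 c2 d2 hv1 hs1 hs2
    rw [Finset.mem_filter] at hT1 ⊢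
    exact ⟨hT2, hs2 hv1, hT1.2.2.tail ⟨hT1.1, hT2, e1, he1, c2, d2, by simpa using hv1, hs1, hs2⟩⟩
  · intro T1 hT1 hsub
    rw [Finset.mem_filter] at hT1
    exact hno T1 hsub hT1.1 hT1.2.2

/-- Everything the topology gives. -/
theorem transfer_all {K : Finset (Finset V)} {L : Finset (Finset W)} (hK : IsCplx K) (hL : GoodC L)
    (dK : ∀ F ∈ K, F.card ≤ 3) (h : HP (geomReal K) (geomReal L)) {w : W} (hw : NonTheta L w) :
    GoodC K ∧ ∃ v, NonTheta K v := by
  have hG := transfer_good hK hL dK h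
  refine ⟨hG, ?_⟩
  obtain ⟨hs, hnt⟩ := hw.not_theta hL
  obtain ⟨e, he, _, _, hwe⟩ := mem_SingS.1 hs
  have hwL : (Pi.single w 1 : W → ℝ) ∈ geomReal L := cell_sub_geom hL.cplx he hwe
  refine exists_nonTheta hG (h.ψm hwL) fun hth => hnt ?_
  refine Theta.transfer h.symm (S' := SingS K) ?_ hwL hth
  intro u hu
  constructor
  · intro hu'
    exact SingS_map hL.cplx hG hL.dim h.symm hu'
  · intro hu'
    have := SingS_map hK hL dK h hu'
    change h.φ (h.ψ u) ∈ SingS L at this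
    rwa [h.φψ u hu] at this

end Geom4

section Explicit
open Topology Set

/-- Triangles of the disc. -/
def triD : Fin 24 → Fin 3 → Fin 19 :=
  ![![0, 1, 17],
    ![0, 17, 15],
    ![1, 2, 17],
    ![0, 15, 16],
    ![2, 15, 17],
    ![0, 16, 11],
    ![12, 16, 15],
    ![2, 3, 15],
    ![10, 11, 16],
    ![3, 12, 15],
    ![12, 13, 16],
    ![10, 16, 13],
    ![3, 5, 12],
    ![12, 18, 13],
    ![9, 10, 13],
    ![3, 4, 5],
    ![5, 18, 12],
    ![8, 13, 18],
    ![8, 9, 13],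
    ![5, 6, 18],
    ![8, 18, 14],
    ![6, 14, 18],
    ![7, 8, 14],
    ![6, 7, 14]]

/-- Labels of the disc vertices. -/
def labD : Fin 19 → Fin 11 :=
  ![0, 1, 2, 3, 0, 1, 2, 3, 0, 3, 2, 1, 4, 5, 6, 7, 8, 9, 10]

/-- Positions (times 12) of the disc vertices. -/
def posD : Fin 19 → Fin 3 → ℤ :=
  ![![12, 0, 0],
    ![9, 3, 0],
    ![6, 6, 0],
    ![3, 9, 0],
    ![0, 12, 0],
    ![0, 9, 3],
    ![0, 6, 6],
    ![0, 3, 9],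
    ![0, 0, 12],
    ![3, 0, 9],
    ![6, 0, 6],
    ![9, 0, 3],
    ![4, 5, 3],
    ![4, 1, 7],
    ![1, 3, 8],
    ![7, 3, 2],
    ![7, 2, 3],
    ![8, 3, 1],
    ![2, 3, 7]]

/-- Heights of the disc vertices. -/
def omD : Fin 19 → ℤ :=
  ![175, 75, 49, 61, 179, 64, 47, 75, 173, 81, 35, 79, 0, 12, 41, 6, 8, 40, 8]

/-- Vertices along the three sides. -/
def sideD : Fin 3 → Fin 5 → Fin 19 :=
  ![![0, 1, 2, 3, 4],
    ![4, 5, 6, 7, 8],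
    ![0, 11, 10, 9, 8]]

/-- Bit masks of the image triangles. -/
def maskD : Fin 24 → ℕ :=
  ![515, 641, 518, 385, 644, 259, 400, 140, 262, 152, 304, 292, 26, 1072, 44, 11, 1042, 1057, 41, 1030, 1089, 1092, 73, 76]

/-- Parents in the dual spanning tree. -/
def parD : Fin 24 → Fin 24 :=
  ![0, 0, 0, 1, 1, 3, 3, 4, 5, 6, 6, 8, 9, 10, 11, 12, 12, 13, 14, 16, 17, 19, 20, 21]

/-- First vertex of the edge to the parent. -/
def parA : Fin 24 → Fin 11 :=
  ![0, 0, 1, 0, 7, 0, 7, 2, 1, 4, 4, 2, 3, 4, 2, 1, 1, 5, 3, 1, 0, 2, 0, 2]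

/-- Second vertex of the edge to the parent. -/
def parB : Fin 24 → Fin 11 :=
  ![0, 9, 9, 7, 9, 8, 8, 7, 8, 7, 8, 8, 4, 5, 5, 3, 4, 10, 5, 10, 10, 10, 6, 6]

/-- Class of triangles around `0`. -/
def clsD : Finset (Fin 24) := {0, 1, 3, 5}

/-- The image triangle. -/
def triK (i : Fin 24) : Finset (Fin 11) := Finset.univ.filter fun a => (maskD i).testBit a.val = true

theorem mem_triK {i : Fin 24} {a : Fin 11} : a ∈ triK i ↔ (maskD i).testBit a.val = true := by
  simp [triK]

theorem mem_triK' {i : Fin 24} {a : Fin 11} : a ∈ triK i ↔ ∃ j, labD (triD i j) = a := by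
  rw [mem_triK]
  revert i a
  decide +kernel

/-- Number of triangles over a pair. -/
def cntD (a b : Fin 11) : ℕ :=
  (Finset.univ.filter fun i : Fin 24 => (maskD i).testBit a.val = true ∧ (maskD i).testBit b.val = true).card

/-- The explicit complex. -/
def K0 : Finset (Finset (Fin 11)) :=
  (Finset.univ : Finset (Fin 24)).biUnion fun i => (triK i).powerset.erase ∅

theorem mem_K0 {F : Finset (Fin 11)} : F ∈ K0 ↔ F ≠ ∅ ∧ ∃ i, F ⊆ triK i := by
  simp [K0]

theorem K0_cplx : IsCplx K0 := by
  refine ⟨fun h => (mem_K0.1 h).1 rfl, ?_⟩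
  intro F hF G hG hne
  obtain ⟨_, i, hi⟩ := mem_K0.1 hF
  exact mem_K0.2 ⟨hne, i, hG.trans hi⟩

theorem triK_card : ∀ i, (triK i).card = 3 := by decide +kernel

theorem mask_inj : ∀ i j, maskD i = maskD j → i = j := by decide +kernel

theorem mask_lt : ∀ i, maskD i < 2 ^ 11 := by decide +kernel

theorem triK_inj : Function.Injective triK := by
  intro i j h
  apply mask_inj
  apply Nat.eq_of_testBit_eq
  intro k
  by_cases hk : k < 11
  · have := Finset.ext_iff.1 h ⟨k, hk⟩
    rw [mem_triK, mem_triK] at this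
    exact Bool.eq_iff_iff.2 this
  · have hk' : 2 ^ 11 ≤ 2 ^ k := Nat.pow_le_pow_right (by norm_num) (by omega)
    rw [Nat.testBit_lt_two_pow ((mask_lt i).trans_le hk'), Nat.testBit_lt_two_pow ((mask_lt j).trans_le hk')]

theorem K0_dim : ∀ F ∈ K0, F.card ≤ 3 := by
  intro F hF
  obtain ⟨_, i, hi⟩ := mem_K0.1 hF
  exact (Finset.card_le_card hi).trans (triK_card i).le

theorem K0_tris {T : Finset (Fin 11)} (hT : T ∈ tris K0) : ∃ i, T = triK i := by
  obtain ⟨h1, h3⟩ := mem_tris.1 hT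
  obtain ⟨_, i, hi⟩ := mem_K0.1 h1
  exact ⟨i, Finset.eq_of_subset_of_card_le hi (by rw [h3, triK_card])⟩

theorem triK_mem (i : Fin 24) : triK i ∈ tris K0 := by
  have h := triK_card i
  refine mem_tris.2 ⟨mem_K0.2 ⟨?_, i, subset_rfl⟩, h⟩
  intro h0
  rw [h0] at h
  simp at h

theorem K0_tris_eq : tris K0 = Finset.univ.image triK := by
  ext T
  simp only [Finset.mem_image, Finset.mem_univ, true_and]
  constructor
  · intro h
    obtain ⟨i, hi⟩ := K0_tris h
    exact ⟨i, hi.symm⟩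
  · rintro ⟨i, rfl⟩
    exact triK_mem i

theorem K0_tdeg (a b : Fin 11) : tdeg K0 {a, b} = cntD a b := by
  have h1 : (K0.filter fun F => ({a, b} : Finset (Fin 11)) ⊆ F ∧ F.card = 3) =
      (Finset.univ.filter fun i : Fin 24 => (maskD i).testBit a.val = true ∧
        (maskD i).testBit b.val = true).image triK := by
    ext T
    simp only [Finset.mem_filter, Finset.mem_image, Finset.mem_univ, true_and, Finset.insert_subset_iff,
      Finset.singleton_subset_iff]
    constructor
    · rintro ⟨h1, ⟨h2, h3⟩, h4⟩
      obtain ⟨i, rfl⟩ := K0_tris (mem_tris.2 ⟨h1, h4⟩)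
      exact ⟨i, ⟨mem_triK.1 h2, mem_triK.1 h3⟩, rfl⟩
    · rintro ⟨i, ⟨h2, h3⟩, rfl⟩
      have := mem_tris.1 (triK_mem i)
      exact ⟨this.1, ⟨mem_triK.2 h2, mem_triK.2 h3⟩, this.2⟩
  rw [tdeg, h1, Finset.card_image_of_injective _ triK_inj, cntD]

theorem cnt_pos {a b : Fin 11} (h : ({a, b} : Finset (Fin 11)) ∈ K0) : cntD a b ≠ 0 := by
  obtain ⟨_, i, hi⟩ := mem_K0.1 h
  rw [Finset.insert_subset_iff, Finset.singleton_subset_iff] at hi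
  apply Nat.ne_of_gt
  apply Finset.card_pos.2
  exact ⟨i, by simpa using ⟨mem_triK.1 hi.1, mem_triK.1 hi.2⟩⟩

theorem pair_K0 {a b : Fin 11} (h : cntD a b ≠ 0) : ({a, b} : Finset (Fin 11)) ∈ K0 := by
  obtain ⟨i, hi⟩ := Finset.card_pos.1 (Nat.pos_of_ne_zero h)
  rw [Finset.mem_filter] at hi
  refine mem_K0.2 ⟨by simp, i, ?_⟩
  rw [Finset.insert_subset_iff, Finset.singleton_subset_iff]
  exact ⟨mem_triK.2 hi.2.1, mem_triK.2 hi.2.2⟩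

theorem cnt_cases : ∀ a b, a ≠ b → cntD a b = 0 ∨ cntD a b = 2 ∨ cntD a b = 3 := by
  decide +kernel

theorem K0_cover : ∀ a : Fin 11, ∃ i, (maskD i).testBit a.val = true := by decide +kernel

theorem K0_f0 : fnum K0 0 = 11 := by
  have : (K0.filter fun F => F.card = 0 + 1) = Finset.univ.image fun a : Fin 11 => ({a} : Finset (Fin 11)) := by
    ext F
    simp only [Finset.mem_filter, Finset.mem_image, Finset.mem_univ, true_and]
    constructor
    · rintro ⟨_, h⟩
      obtain ⟨a, rfl⟩ := Finset.card_eq_one.1 h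
      exact ⟨a, rfl⟩
    · rintro ⟨a, rfl⟩
      obtain ⟨i, hi⟩ := K0_cover a
      exact ⟨mem_K0.2 ⟨by simp, i, by simpa using mem_triK.2 hi⟩, by simp⟩
  rw [fnum, this, Finset.card_image_of_injective _ Finset.singleton_injective]
  simp

theorem K0_f1 : fnum K0 1 = 34 := by
  have : (K0.filter fun F => F.card = 1 + 1) =
      (Finset.univ.filter fun p : Fin 11 × Fin 11 => p.1 < p.2 ∧ cntD p.1 p.2 ≠ 0).image
        fun p => ({p.1, p.2} : Finset (Fin 11)) := by
    ext F
    simp only [Finset.mem_filter, Finset.mem_image, Finset.mem_univ, true_and]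
    constructor
    · rintro ⟨hF, h⟩
      obtain ⟨a, b, hab, rfl⟩ := Finset.card_eq_two.1 h
      rcases lt_or_gt_of_ne hab with h | h
      · exact ⟨(a, b), ⟨h, cnt_pos hF⟩, rfl⟩
      · rw [Finset.pair_comm] at hF ⊢
        exact ⟨(b, a), ⟨h, cnt_pos hF⟩, rfl⟩
    · rintro ⟨⟨a, b⟩, ⟨h1, h2⟩, rfl⟩
      exact ⟨pair_K0 h2, Finset.card_pair h1.ne⟩
  rw [fnum, this, Finset.card_image_of_injOn]
  · decide +kernel
  · rintro ⟨a, b⟩ h ⟨c, d⟩ h' heq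
    simp only [Finset.coe_filter, Finset.mem_univ, true_and, mem_ofPred_eq] at h h'
    have h1 := h.1
    have h2 := h'.1
    simp only at heq
    have e1 := Finset.ext_iff.1 heq a
    have e2 := Finset.ext_iff.1 heq b
    have e3 := Finset.ext_iff.1 heq c
    simp only [Finset.mem_insert, Finset.mem_singleton, true_or, or_true, true_iff, iff_true] at e1 e2 e3
    ext1 <;> simp only <;> omega

theorem K0_f2 : fnum K0 2 = 24 := by
  have : (K0.filter fun F => F.card = 2 + 1) = tris K0 := rfl
  rw [fnum, this, K0_tris_eq, Finset.card_image_of_injective _ triK_inj]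
  simp

theorem K0_deg : ∀ e ∈ K0, e.card = 2 → tdeg K0 e = 2 ∨ tdeg K0 e = 3 := by
  intro e he h2
  obtain ⟨a, b, hab, rfl⟩ := Finset.card_eq_two.1 h2
  rw [K0_tdeg]
  exact (cnt_cases a b hab).resolve_left (cnt_pos he)

theorem K0_vert : ∀ F ∈ K0, F.card = 1 → ∃ e ∈ K0, e.card = 2 ∧ F ⊆ e := by
  intro F hF h1
  obtain ⟨_, i, hi⟩ := mem_K0.1 hF
  obtain ⟨e, h1, h2, h3⟩ := Finset.exists_subsuperset_card_eq hi (n := 2) (by omega) (by rw [triK_card]; omega)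
  refine ⟨e, mem_K0.2 ⟨?_, i, h2⟩, h3, h1⟩
  rintro rfl
  simp at h3

theorem K0_parent : ∀ i : Fin 24, i ≠ 0 → parD i < i ∧ parA i ≠ parB i ∧
    (maskD i).testBit (parA i).val = true ∧ (maskD i).testBit (parB i).val = true ∧
    (maskD (parD i)).testBit (parA i).val = true ∧ (maskD (parD i)).testBit (parB i).val = true ∧
    cntD (parA i) (parB i) = 2 := by
  decide +kernel

theorem K0_good : GoodC K0 := by
  refine ⟨K0_cplx, K0_dim, K0_deg, K0_vert, ?_⟩
  intro Z hZ hcl hne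
  have all : ∀ i : Fin 24, triK i ∈ Z ↔ triK 0 ∈ Z := by
    intro i
    induction i using WellFoundedLT.induction with
    | ind i ih =>
      by_cases hi : i = 0
      · rw [hi]
      · obtain ⟨hj, hab, h1, h2, h3, h4, h5⟩ := K0_parent i hi
        rw [← ih _ hj]
        have he : ({parA i, parB i} : Finset (Fin 11)) ∈ K0 := pair_K0 (by omega)
        have hc : ({parA i, parB i} : Finset (Fin 11)).card = 2 := Finset.card_pair hab
        have hd : tdeg K0 {parA i, parB i} = 2 := by rw [K0_tdeg, h5]
        have s1 : ({parA i, parB i} : Finset (Fin 11)) ⊆ triK i := by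
          rw [Finset.insert_subset_iff, Finset.singleton_subset_iff]
          exact ⟨mem_triK.2 h1, mem_triK.2 h2⟩
        have s2 : ({parA i, parB i} : Finset (Fin 11)) ⊆ triK (parD i) := by
          rw [Finset.insert_subset_iff, Finset.singleton_subset_iff]
          exact ⟨mem_triK.2 h3, mem_triK.2 h4⟩
        exact ⟨fun h => hcl _ h _ (triK_mem _) _ he hc hd s1 s2, fun h => hcl _ h _ (triK_mem _) _ he hc hd s2 s1⟩
  obtain ⟨T, hT⟩ := hne
  obtain ⟨i, rfl⟩ := K0_tris (hZ hT)
  refine subset_antisymm hZ fun T' hT' => ?_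
  obtain ⟨i', rfl⟩ := K0_tris hT'
  rw [all, ← all i]
  exact hT

theorem K0_balanced : BalancedC 2 K0 := by
  refine ⟨![0, 1, 0, 2, 0, 1, 1, 1, 2, 2, 2], ?_⟩
  have : ∀ i, ∀ a b : Fin 11, (maskD i).testBit a.val = true → (maskD i).testBit b.val = true →
      (![0, 1, 0, 2, 0, 1, 1, 1, 2, 2, 2] : Fin 11 → Fin 3) a =
      (![0, 1, 0, 2, 0, 1, 1, 1, 2, 2, 2] : Fin 11 → Fin 3) b → a = b := by decide +kernel
  intro F hF
  obtain ⟨_, i, hi⟩ := mem_K0.1 hF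
  intro a ha b hb hab
  exact this i a b (mem_triK.1 (hi ha)) (mem_triK.1 (hi hb)) hab

theorem cls_closed : ∀ i ∈ clsD, ∀ i' : Fin 24, ∀ b : Fin 11, b ≠ 0 → (maskD i).testBit b.val = true →
    (maskD i').testBit 0 = true → (maskD i').testBit b.val = true → cntD 0 b = 2 → i' ∈ clsD := by
  decide +kernel

theorem cls_props : (∀ i ∈ clsD, (maskD i).testBit 0 = true ∧ (maskD i).testBit 3 = false) ∧ cntD 0 3 = 3 ∧
    (0 : Fin 24) ∈ clsD := by
  decide +kernel

theorem K0_nonTheta : NonTheta K0 0 := by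
  have hp := cls_props
  refine ⟨clsD.image triK, ?_, ?_, ?_, ?_, {0, 3}, ?_, ?_, ?_, ?_, ?_⟩
  · rw [K0_tris_eq]; exact Finset.image_subset_image (Finset.subset_univ _)
  · exact ⟨_, Finset.mem_image_of_mem _ hp.2.2⟩
  · intro T hT
    obtain ⟨i, hi, rfl⟩ := Finset.mem_image.1 hT
    exact mem_triK.2 (hp.1 i hi).1
  · intro T hT T' hT' e he h2 h3 h4 h5 h6
    obtain ⟨i', rfl⟩ := K0_tris hT'
    obtain ⟨i, hi, rfl⟩ := Finset.mem_image.1 hT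
    obtain ⟨b, hb, rfl⟩ : ∃ b, b ≠ 0 ∧ e = {0, b} := by
      obtain ⟨a, b, hab, rfl⟩ := Finset.card_eq_two.1 h2
      rw [Finset.mem_insert, Finset.mem_singleton] at h4
      rcases h4 with rfl | rfl
      · exact ⟨b, hab.symm, rfl⟩
      · exact ⟨a, hab, Finset.pair_comm _ _⟩
    rw [Finset.insert_subset_iff, Finset.singleton_subset_iff] at h5 h6
    rw [K0_tdeg] at h3
    exact Finset.mem_image_of_mem _ (cls_closed i hi i' b hb (mem_triK.1 h5.2) (mem_triK.1 h6.1)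
      (mem_triK.1 h6.2) h3)
  · exact pair_K0 (by rw [hp.2.1]; omega)
  · rfl
  · rw [K0_tdeg, hp.2.1]
  · simp
  · intro T hT hs
    obtain ⟨i, hi, rfl⟩ := Finset.mem_image.1 hT
    rw [Finset.insert_subset_iff, Finset.singleton_subset_iff] at hs
    have := mem_triK.1 hs.2
    have h2 := (hp.1 i hi).2
    change (maskD i).testBit 3 = true at this
    rw [h2] at this
    exact Bool.false_ne_true this

end Explicit

section Disc
open Topology Set

/-- Dot product in dimension 3. -/
def dt {R : Type*} [Semiring R] (f g : Fin 3 → R) : R := f 0 * g 0 + f 1 * g 1 + f 2 * g 2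

/-- Dual vectors of a disc triangle. -/
def Bv (i : Fin 24) (j c : Fin 3) : ℤ :=
  posD (triD i (j + 1)) (c + 1) * posD (triD i (j + 2)) (c + 2) -
  posD (triD i (j + 1)) (c + 2) * posD (triD i (j + 2)) (c + 1)

/-- Determinant of a disc triangle. -/
def Ed (i : Fin 24) : ℤ := dt (posD (triD i 0)) (Bv i 0)

/-- Height functional of a disc triangle. -/
def Ad (i : Fin 24) (c : Fin 3) : ℤ :=
  omD (triD i 0) * Bv i 0 c + omD (triD i 1) * Bv i 1 c + omD (triD i 2) * Bv i 2 c

theorem fact_dual1 : ∀ i j j', dt (Bv i j) (posD (triD i j')) = if j = j' then Ed i else 0 := by decide +kernel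
theorem fact_dual2 : ∀ i c c', Bv i 0 c * posD (triD i 0) c' + Bv i 1 c * posD (triD i 1) c' +
    Bv i 2 c * posD (triD i 2) c' = if c = c' then Ed i else 0 := by decide +kernel
theorem fact_dual3 : ∀ i c, 12 * (Bv i 0 c + Bv i 1 c + Bv i 2 c) = Ed i := by decide +kernel
theorem fact_det : ∀ i, 0 < Ed i := by decide +kernel
theorem fact_le : ∀ i w, dt (Ad i) (posD w) ≤ Ed i * omD w := by decide +kernel
theorem fact_eq : ∀ i w, dt (Ad i) (posD w) = Ed i * omD w ↔ ∃ j, triD i j = w := by decide +kernel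
theorem fact_flip : ∀ i j, (0 ≤ Bv i j 0 ∧ 0 ≤ Bv i j 1 ∧ 0 ≤ Bv i j 2) ∨
    ∃ i', 0 < Ed i' * Ed i * omD (triD i j) - Ed i * dt (Ad i') (posD (triD i j)) ∧
      ∀ c, Ed i * (Ed i * Ad i' c - Ed i' * Ad i c) =
        -(Ed i' * Ed i * omD (triD i j) - Ed i * dt (Ad i') (posD (triD i j))) * Bv i j c := by decide +kernel
theorem fact_pos : ∀ w c, 0 ≤ posD w c := by decide +kernel
theorem fact_sum : ∀ w, posD w 0 + posD w 1 + posD w 2 = 12 := by decide +kernel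
theorem tri_inj : ∀ i j j', triD i j = triD i j' → j = j' := by decide +kernel
theorem labtri_inj : ∀ i j j', labD (triD i j) = labD (triD i j') → j = j' := by decide +kernel
theorem fact_tricho : ∀ i i', (∀ j j', labD (triD i j) = labD (triD i' j') → triD i j = triD i' j') ∨
    (∃ s s' : Fin 3, ∃ k : Fin 4, ∀ j j', labD (triD i j) = labD (triD i' j') →
      (triD i j = sideD s k.castSucc ∨ triD i j = sideD s k.succ) ∧
      (triD i' j' = sideD s' k.castSucc ∨ triD i' j' = sideD s' k.succ)) ∨
    (∀ j j', labD (triD i j) = labD (triD i' j') → labD (triD i j) = 0) := by decide +kernel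
theorem fact_side : ∀ s, ∀ k : Fin 4, ∃ i j j', triD i j = sideD s k.castSucc ∧ triD i j' = sideD s k.succ := by
  decide +kernel
theorem fact_side_pos : ∀ s c : Fin 3, ∀ k : Fin 5, posD (sideD s k) c =
    if c = ![0, 1, 0] s then 12 - 3 * (k.val : ℤ) else if c = ![1, 2, 2] s then 3 * (k.val : ℤ) else 0 := by
  decide +kernel
theorem fact_side_lab : ∀ s, ∀ k : Fin 5, labD (sideD s k) = labD (sideD 0 k) := by decide +kernel
theorem fact_side_ne : ∀ s, ∀ k : Fin 4, labD (sideD s k.castSucc) ≠ labD (sideD s k.succ) := by decide +kernel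
theorem fact_corner : ∀ w, labD w = 0 → w = 0 ∨ w = 4 ∨ w = 8 := by decide +kernel

end Disc

section Disc2
open Topology Set

/-- Pushforward of a weight function. -/
def push {α β : Type} [Fintype α] [DecidableEq β] (g : α → β) (a : α → ℝ) : β → ℝ :=
  fun b => ∑ w, if g w = b then a w else 0

section pushlemmas
variable {α β γ : Type} [Fintype α] [DecidableEq β] [Fintype β] [DecidableEq γ]

theorem push_sum_mul (g : α → β) (a : α → ℝ) (h : β → ℝ) :
    ∑ b, push g a b * h b = ∑ w, a w * h (g w) := by
  simp only [push, Finset.sum_mul]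
  rw [Finset.sum_comm]
  refine Finset.sum_congr rfl fun w _ => ?_
  simp [ite_mul]

theorem push_sum (g : α → β) (a : α → ℝ) : ∑ b, push g a b = ∑ w, a w := by
  have := push_sum_mul g a (fun _ => 1)
  simpa using this

theorem push_nonneg (g : α → β) {a : α → ℝ} (ha : ∀ w, 0 ≤ a w) (b : β) : 0 ≤ push g a b :=
  Finset.sum_nonneg fun w _ => by split_ifs; exacts [ha w, le_rfl]

theorem push_inj {g : α → β} (hg : Function.Injective g) (a : α → ℝ) (j : α) : push g a (g j) = a j := by
  classical
  simp only [push]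
  rw [Finset.sum_eq_single j]
  · simp
  · intro b _ hb
    rw [if_neg fun h => hb (hg h)]
  · simp

theorem push_not {g : α → β} (a : α → ℝ) {b : β} (hb : ∀ j, g j = b → a j = 0) : push g a b = 0 := by
  refine Finset.sum_eq_zero fun w _ => ?_
  split_ifs with h
  · exact hb w h
  · rfl

theorem push_comp (f : β → γ) (g : α → β) (a : α → ℝ) : push f (push g a) = push (f ∘ g) a := by
  funext c
  have := push_sum_mul g a (fun b => if f b = c then 1 else 0)
  simpa [push] using this

theorem push_restrict {g : α → β} (hg : Function.Injective g) {u : β → ℝ} (hu : ∀ b, u b ≠ 0 → ∃ j, g j = b) :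
    push g (fun j => u (g j)) = u := by
  funext b
  by_cases h : ∃ j, g j = b
  · obtain ⟨j, rfl⟩ := h
    rw [push_inj hg]
  · rw [push_not]
    · by_contra h0
      exact h (hu b (Ne.symm h0))
    · intro j hj
      exact absurd ⟨j, hj⟩ h

theorem push_cont (g : α → β) : Continuous (push g) := by
  refine continuous_pi fun b => ?_
  refine continuous_finsetSum _ fun w _ => ?_
  split_ifs <;> fun_prop

theorem push_simplex (g : α → β) {a : α → ℝ} (ha : a ∈ stdSimplex ℝ α) : push g a ∈ stdSimplex ℝ β :=
  ⟨push_nonneg g ha.1, by rw [push_sum]; exact ha.2⟩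

end pushlemmas

/-- The triangulated disc. -/
def Xd : Set (Fin 19 → ℝ) := {u | ∃ i, ∃ a ∈ stdSimplex ℝ (Fin 3), push (triD i) a = u}

theorem Xd_compact : IsCompact Xd := by
  have : Xd = ⋃ i : Fin 24, push (triD i) '' stdSimplex ℝ (Fin 3) := by
    ext u; simp [Xd]
  rw [this]
  exact isCompact_iUnion fun i => (isCompact_stdSimplex ℝ (Fin 3)).image (push_cont _)

/-- The geometric realization map of the disc. -/
noncomputable def psi (u : Fin 19 → ℝ) (c : Fin 3) : ℝ := (∑ w, u w * (posD w c : ℝ)) / 12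

theorem psi_cont : Continuous psi := by
  refine continuous_pi fun c => ?_
  unfold psi
  refine Continuous.div_const ?_ _
  exact continuous_finsetSum _ fun w _ => by fun_prop

theorem psi_push {α : Type} [Fintype α] (g : α → Fin 19) (a : α → ℝ) (c : Fin 3) :
    psi (push g a) c = (∑ j, a j * (posD (g j) c : ℝ)) / 12 := by
  rw [psi, push_sum_mul]

/-- Integer functional applied to a real vector. -/
def dz (v : Fin 3 → ℤ) (p : Fin 3 → ℝ) : ℝ := (v 0 : ℝ) * p 0 + v 1 * p 1 + v 2 * p 2

theorem dz_psi {α : Type} [Fintype α] (v : Fin 3 → ℤ) (g : α → Fin 19) (a : α → ℝ) :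
    12 * dz v (psi (push g a)) = ∑ j, a j * ((dt v (posD (g j)) : ℤ) : ℝ) := by
  simp only [dz, psi_push, dt]
  push_cast
  simp only [mul_add, Finset.sum_add_distrib]
  have : ∀ c : Fin 3, 12 * ((v c : ℝ) * ((∑ j, a j * (posD (g j) c : ℝ)) / 12)) =
      ∑ j, a j * ((v c : ℝ) * (posD (g j) c : ℝ)) := by
    intro c
    rw [mul_div_assoc', mul_div_cancel₀ _ (by norm_num), Finset.mul_sum]
    exact Finset.sum_congr rfl fun j _ => by ring
  rw [this, this, this]

theorem psi_simplex {u : Fin 19 → ℝ} (hu : u ∈ Xd) : psi u ∈ stdSimplex ℝ (Fin 3) := by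
  obtain ⟨i, a, ha, rfl⟩ := hu
  refine ⟨fun c => ?_, ?_⟩
  · rw [psi_push]
    refine div_nonneg (Finset.sum_nonneg fun j _ => mul_nonneg (ha.1 j) ?_) (by norm_num)
    exact_mod_cast fact_pos _ _
  · have h := dz_psi (fun _ => 1) (triD i) a
    have h1 : ∀ j, dt (fun _ => (1 : ℤ)) (posD (triD i j)) = 12 := by
      intro j
      have := fact_sum (triD i j)
      simp only [dt]; linarith
    simp only [h1, dz, Int.cast_one, one_mul] at h
    rw [← Finset.sum_mul, ha.2] at h
    rw [Fin.sum_univ_three]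
    push_cast at h
    linarith

theorem tri_injective (i : Fin 24) : Function.Injective (triD i) := fun j j' h => tri_inj i j j' h

theorem dual_coord (i : Fin 24) (a : Fin 3 → ℝ) (j : Fin 3) :
    12 * dz (Bv i j) (psi (push (triD i) a)) = a j * (Ed i : ℝ) := by
  rw [dz_psi]
  simp only [fact_dual1]
  rw [Finset.sum_eq_single j]
  · simp
  · intro b _ hb
    rw [if_neg (Ne.symm hb)]; simp
  · simp

theorem height_own (i : Fin 24) (a : Fin 3 → ℝ) :
    12 * dz (Ad i) (psi (push (triD i) a)) = (Ed i : ℝ) * ∑ j, a j * (omD (triD i j) : ℝ) := by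
  rw [dz_psi, Finset.mul_sum]
  refine Finset.sum_congr rfl fun j _ => ?_
  rw [(fact_eq i (triD i j)).2 ⟨j, rfl⟩]
  push_cast; ring

theorem height_le (i i' : Fin 24) {a : Fin 3 → ℝ} (ha : ∀ j, 0 ≤ a j) :
    12 * dz (Ad i) (psi (push (triD i') a)) ≤ (Ed i : ℝ) * ∑ j, a j * (omD (triD i' j) : ℝ) := by
  rw [dz_psi, Finset.mul_sum]
  refine Finset.sum_le_sum fun j _ => ?_
  have h : ((dt (Ad i) (posD (triD i' j)) : ℤ) : ℝ) ≤ ((Ed i * omD (triD i' j) : ℤ) : ℝ) := by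
    exact_mod_cast fact_le i _
  have := mul_le_mul_of_nonneg_left h (ha j)
  push_cast at this
  linarith

theorem Ed_posR (i : Fin 24) : (0 : ℝ) < Ed i := by exact_mod_cast fact_det i

theorem psi_injOn : InjOn psi Xd := by
  rintro _ ⟨i, a, ha, rfl⟩ _ ⟨i', a', ha', rfl⟩ h
  have h1 : ∑ j, a j * (omD (triD i j) : ℝ) ≤ ∑ j, a' j * (omD (triD i' j) : ℝ) := by
    have := height_le i i' ha'.1
    rw [← h, height_own] at this
    exact le_of_mul_le_mul_left this (Ed_posR i)
  have h2 : ∑ j, a' j * (omD (triD i' j) : ℝ) ≤ ∑ j, a j * (omD (triD i j) : ℝ) := by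
    have := height_le i' i ha.1
    rw [h, height_own] at this
    exact le_of_mul_le_mul_left this (Ed_posR i')
  have hE := le_antisymm h1 h2
  have h3 : ∑ j, a' j * ((Ed i * omD (triD i' j) - dt (Ad i) (posD (triD i' j)) : ℤ) : ℝ) = 0 := by
    have e1 := dz_psi (Ad i) (triD i') a'
    rw [← h, height_own, hE, Finset.mul_sum] at e1
    push_cast
    simp only [mul_sub, Finset.sum_sub_distrib]
    rw [← e1, sub_eq_zero]
    exact Finset.sum_congr rfl fun j _ => by ring
  rw [Finset.sum_eq_zero_iff_of_nonneg] at h3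
  swap
  · intro j _
    refine mul_nonneg (ha'.1 j) ?_
    exact_mod_cast sub_nonneg.2 (fact_le i _)
  have hsup : ∀ w, push (triD i') a' w ≠ 0 → ∃ j, triD i j = w := by
    intro w hw
    by_contra hno
    apply hw
    apply push_not
    rintro j rfl
    rcases mul_eq_zero.1 (h3 j (Finset.mem_univ j)) with h0 | h0
    · exact h0
    · exfalso
      apply hno
      apply (fact_eq i _).1
      have : Ed i * omD (triD i' j) - dt (Ad i) (posD (triD i' j)) = 0 := by exact_mod_cast h0
      linarith
  have e := push_restrict (tri_injective i) hsup
  rw [← e] at h ⊢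
  congr 1
  funext j
  have d1 := dual_coord i a j
  have d2 := dual_coord i (fun j => push (triD i') a' (triD i j)) j
  rw [h, d2] at d1
  exact (mul_right_cancel₀ (Ed_posR i).ne' d1).symm

theorem dz_smul_sub (v w b : Fin 3 → ℤ) (x y m z : ℤ) (h : ∀ c, z * (x * v c - y * w c) = -m * b c) (p : Fin 3 → ℝ) :
    (z : ℝ) * (x * dz v p - y * dz w p) = -m * dz b p := by
  have h' : ∀ c, (z : ℝ) * (x * v c - y * w c) = -m * b c := fun c => by exact_mod_cast h c
  simp only [dz]
  linear_combination (p 0) * h' 0 + (p 1) * h' 1 + (p 2) * h' 2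

theorem psi_surj {p : Fin 3 → ℝ} (hp : p ∈ stdSimplex ℝ (Fin 3)) : ∃ u ∈ Xd, psi u = p := by
  obtain ⟨i, hi⟩ := Finite.exists_max fun i : Fin 24 => dz (Ad i) p / (Ed i : ℝ)
  have hnn : ∀ j, 0 ≤ dz (Bv i j) p := by
    intro j
    rcases fact_flip i j with ⟨h0, h1, h2⟩ | ⟨i', hm, hc⟩
    · have h0' : (0 : ℝ) ≤ Bv i j 0 := by exact_mod_cast h0
      have h1' : (0 : ℝ) ≤ Bv i j 1 := by exact_mod_cast h1
      have h2' : (0 : ℝ) ≤ Bv i j 2 := by exact_mod_cast h2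
      have := hp.1
      exact add_nonneg (add_nonneg (mul_nonneg h0' (this 0)) (mul_nonneg h1' (this 1))) (mul_nonneg h2' (this 2))
    · have key := dz_smul_sub _ _ _ _ _ _ _ hc p
      have h1 := hi i'
      rw [div_le_div_iff₀ (Ed_posR i') (Ed_posR i)] at h1
      have hm' : (0 : ℝ) < ((Ed i' * Ed i * omD (triD i j) - Ed i * dt (Ad i') (posD (triD i j)) : ℤ) : ℝ) := by
        exact_mod_cast hm
      have h2 : (Ed i : ℝ) * (Ed i * dz (Ad i') p - Ed i' * dz (Ad i) p) ≤ 0 := by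
        apply mul_nonpos_of_nonneg_of_nonpos (Ed_posR i).le
        linarith
      rw [key] at h2
      by_contra hneg
      push Not at hneg
      have := mul_pos_of_neg_of_neg (neg_lt_zero.2 hm') hneg
      linarith
  let a : Fin 3 → ℝ := fun j => 12 * dz (Bv i j) p / Ed i
  have hE := Ed_posR i
  refine ⟨push (triD i) a, ⟨i, a, ⟨fun j => ?_, ?_⟩, rfl⟩, ?_⟩
  · exact div_nonneg (mul_nonneg (by norm_num) (hnn j)) hE.le
  · have h3 : ∀ c, (12 : ℝ) * (Bv i 0 c + Bv i 1 c + Bv i 2 c) = Ed i := fun c => by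
      exact_mod_cast fact_dual3 i c
    have hs := hp.2
    rw [Fin.sum_univ_three] at hs ⊢
    simp only [a]
    rw [← add_div, ← add_div, div_eq_one_iff_eq hE.ne']
    simp only [dz]
    linear_combination p 0 * h3 0 + p 1 * h3 1 + p 2 * h3 2 + (Ed i : ℝ) * hs
  · funext c
    rw [psi_push, Fin.sum_univ_three]
    have h2 : ∀ c', (Bv i 0 c' : ℝ) * posD (triD i 0) c + Bv i 1 c' * posD (triD i 1) c +
        Bv i 2 c' * posD (triD i 2) c = if c' = c then (Ed i : ℝ) else 0 := by
      intro c'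
      have := fact_dual2 i c' c
      split_ifs with hcc
      · rw [if_pos hcc] at this; exact_mod_cast this
      · rw [if_neg hcc] at this; exact_mod_cast this
    have e : (a 0 * (posD (triD i 0) c : ℝ) + a 1 * posD (triD i 1) c + a 2 * posD (triD i 2) c) / 12 * Ed i
        = p c * Ed i := by
      simp only [a, dz]
      field_simp
      have t0 := h2 0
      have t1 := h2 1
      have t2 := h2 2
      fin_cases c <;> simp at t0 t1 t2 ⊢ <;>
        linear_combination p 0 * t0 + p 1 * t1 + p 2 * t2
    exact mul_right_cancel₀ hE.ne' e

end Disc2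

section Glue
open Topology Set

instance : CompactSpace Xd := isCompact_iff_compactSpace.1 Xd_compact

/-- The disc is homeomorphic to the simplex. -/
noncomputable def eD : Xd ≃ₜ stdSimplex ℝ (Fin 3) :=
  Continuous.homeoOfEquivCompactToT2
    (f := Equiv.ofBijective (fun u : Xd => (⟨psi u.1, psi_simplex u.2⟩ : stdSimplex ℝ (Fin 3))) (by
      constructor
      · rintro ⟨u, hu⟩ ⟨v, hv⟩ h
        exact Subtype.ext (psi_injOn hu hv (congrArg Subtype.val h))
      · rintro ⟨p, hp⟩
        obtain ⟨u, hu, rfl⟩ := psi_surj hp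
        exact ⟨⟨u, hu⟩, rfl⟩))
    (by
      show Continuous fun u : Xd => (⟨psi u.1, psi_simplex u.2⟩ : stdSimplex ℝ (Fin 3))
      exact (psi_cont.comp continuous_subtype_val).subtype_mk _)

theorem eD_val (u : Xd) : (eD u).1 = psi u.1 := rfl

theorem pL_mem {u : Fin 19 → ℝ} (hu : u ∈ Xd) : push labD u ∈ geomReal K0 := by
  obtain ⟨i, a, ha, rfl⟩ := hu
  have hs : push labD (push (triD i) a) ∈ stdSimplex ℝ (Fin 11) := push_simplex _ (push_simplex _ ha)
  refine mem_geom.2 ⟨hs.1, hs.2, mem_K0.2 ⟨?_, i, ?_⟩⟩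
  · intro h0
    have : ∀ l, push labD (push (triD i) a) l = 0 := by
      intro l
      by_contra hl
      have := mem_sup0.2 hl
      rw [h0] at this
      simp at this
    have h1 := hs.2
    simp [this] at h1
  · intro l hl
    rw [mem_sup0, push_comp] at hl
    rw [mem_triK']
    by_contra hno
    apply hl
    apply push_not
    intro j hj
    exact absurd ⟨j, hj⟩ hno

/-- The parametrization of the complex by the simplex. -/
noncomputable def fD (p : stdSimplex ℝ (Fin 3)) : geomReal K0 :=
  ⟨push labD (eD.symm p).1, pL_mem (eD.symm p).2⟩

theorem fD_cont : Continuous fD :=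
  ((push_cont labD).comp (continuous_subtype_val.comp eD.symm.continuous)).subtype_mk _

theorem fD_surj : Function.Surjective fD := by
  rintro ⟨y, hy⟩
  obtain ⟨h0, h1, h2⟩ := mem_geom.1 hy
  obtain ⟨_, i, hi⟩ := mem_K0.1 h2
  have hinj : Function.Injective (labD ∘ triD i) := fun j j' h => labtri_inj i j j' h
  have e : push (labD ∘ triD i) (fun j => y ((labD ∘ triD i) j)) = y := by
    refine push_restrict hinj fun l hl => ?_
    exact mem_triK'.1 (hi (mem_sup0.2 hl))
  have ha : (fun j => y ((labD ∘ triD i) j)) ∈ stdSimplex ℝ (Fin 3) := by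
    refine ⟨fun j => h0 _, ?_⟩
    rw [← push_sum (labD ∘ triD i), e, h1]
  refine ⟨eD ⟨push (triD i) _, i, _, ha, rfl⟩, ?_⟩
  apply Subtype.ext
  show push labD (eD.symm (eD _)).1 = y
  rw [Homeomorph.symm_apply_apply, push_comp, e]

/-- Endpoints of the boundary segments. -/
def segV (s : Fin 3) (k : Fin 4) : Fin 2 → Fin 19 := ![sideD s k.castSucc, sideD s k.succ]

/-- Points on boundary segments. -/
def seg (s : Fin 3) (k : Fin 4) (t : ℝ) : Fin 19 → ℝ := push (segV s k) ![1 - t, t]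

theorem seg_mem (s : Fin 3) (k : Fin 4) {t : ℝ} (h0 : 0 ≤ t) (h1 : t ≤ 1) : seg s k t ∈ Xd := by
  obtain ⟨i, j, j', e1, e2⟩ := fact_side s k
  refine ⟨i, push ![j, j'] ![1 - t, t], push_simplex _ ⟨?_, ?_⟩, ?_⟩
  · intro m
    fin_cases m
    · simpa using h1
    · simpa using h0
  · simp
  · rw [push_comp, seg]
    congr 1
    funext m
    fin_cases m
    · simpa [segV] using e1
    · simpa [segV] using e2

theorem seg_psi (s : Fin 3) (k : Fin 4) (t : ℝ) :
    psi (seg s k t) = epath (![0, 1, 0] s) (![1, 2, 2] s) ((k.val + t) / 4) := by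
  funext c
  rw [seg, psi_push, Fin.sum_univ_two]
  simp only [segV, Matrix.cons_val_zero, Matrix.cons_val_one, fact_side_pos, epath]
  split_ifs <;> simp <;> ring

theorem seg_lab (s : Fin 3) (k : Fin 4) (t : ℝ) : push labD (seg s k t) = push labD (seg 0 k t) := by
  rw [seg, seg, push_comp, push_comp]
  congr 1
  funext m
  fin_cases m
  · simpa [segV] using fact_side_lab s k.castSucc
  · simpa [segV] using fact_side_lab s k.succ

theorem exists_kt {t : ℝ} (h0 : 0 ≤ t) (h1 : t ≤ 1) : ∃ k : Fin 4, ∃ r : ℝ, 0 ≤ r ∧ r ≤ 1 ∧ t = (k.val + r) / 4 := by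
  by_cases a1 : t ≤ 1 / 4
  · exact ⟨0, 4 * t, by linarith, by linarith, by simp⟩
  by_cases a2 : t ≤ 2 / 4
  · exact ⟨1, 4 * t - 1, by linarith, by linarith, by simp⟩
  by_cases a3 : t ≤ 3 / 4
  · exact ⟨2, 4 * t - 2, by linarith, by linarith, by simp⟩
  · exact ⟨3, 4 * t - 3, by linarith, by linarith, by simp⟩

theorem fD_side {s : Fin 3} {k : Fin 4} {r : ℝ} (h0 : 0 ≤ r) (h1 : r ≤ 1) {x : stdSimplex ℝ (Fin 3)}
    (hx : x.val = epath (![0, 1, 0] s) (![1, 2, 2] s) ((k.val + r) / 4)) :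
    (fD x).1 = push labD (seg 0 k r) := by
  have : x = eD ⟨seg s k r, seg_mem s k h0 h1⟩ := by
    apply Subtype.ext
    rw [hx, eD_val, seg_psi]
  rw [this]
  show push labD (eD.symm (eD _)).1 = _
  rw [Homeomorph.symm_apply_apply, seg_lab]

theorem fD_rel {x y : stdSimplex ℝ (Fin 3)} (h : dhRel x y) : fD x = fD y := by
  obtain ⟨t, h0, h1, h⟩ := h
  obtain ⟨k, r, r0, r1, rfl⟩ := exists_kt h0 h1
  apply Subtype.ext
  rcases h with ⟨hx, hy⟩ | ⟨hx, hy⟩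
  · rw [fD_side (s := 0) r0 r1 hx, fD_side (s := 1) r0 r1 hy]
  · rw [fD_side (s := 0) r0 r1 hx, fD_side (s := 2) r0 r1 hy]

/-- The class in the dunce hat. -/
noncomputable def cls (u : Xd) : DunceHat := Quot.mk dhRel (eD u)

theorem cls_seg (s : Fin 3) (k : Fin 4) {r : ℝ} (r0 : 0 ≤ r) (r1 : r ≤ 1) :
    cls ⟨seg s k r, seg_mem s k r0 r1⟩ = cls ⟨seg 0 k r, seg_mem 0 k r0 r1⟩ := by
  have hk : (k.val : ℝ) ≤ 3 := by exact_mod_cast Nat.le_of_lt_succ k.2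
  have hk0 : (0 : ℝ) ≤ k.val := by positivity
  have hs : s = 0 ∨ s = 1 ∨ s = 2 := by revert s; decide
  rcases hs with rfl | rfl | rfl
  · rfl
  · refine (Quot.sound ?_).symm
    refine ⟨(k.val + r) / 4, by positivity, by linarith, Or.inl ⟨?_, ?_⟩⟩
    · rw [eD_val, seg_psi]; rfl
    · rw [eD_val, seg_psi]; rfl
  · refine (Quot.sound ?_).symm
    refine ⟨(k.val + r) / 4, by positivity, by linarith, Or.inr ⟨?_, ?_⟩⟩
    · rw [eD_val, seg_psi]; rfl
    · rw [eD_val, seg_psi]; rfl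

theorem segV_inj (s : Fin 3) (k : Fin 4) : Function.Injective (segV s k) := by
  have h := fact_side_ne s k
  intro a b hab
  fin_cases a <;> fin_cases b
  · rfl
  · exact absurd (congrArg labD hab) h
  · exact absurd (congrArg labD hab.symm) h
  · rfl

theorem seg_of {u : Fin 19 → ℝ} (hu : u ∈ Xd) (s : Fin 3) (k : Fin 4)
    (hs : ∀ w, u w ≠ 0 → w = sideD s k.castSucc ∨ w = sideD s k.succ) :
    0 ≤ u (sideD s k.succ) ∧ u (sideD s k.succ) ≤ 1 ∧ u = seg s k (u (sideD s k.succ)) ∧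
      push labD u (labD (sideD 0 k.succ)) = u (sideD s k.succ) := by
  have hsx : u ∈ stdSimplex ℝ (Fin 19) := by
    obtain ⟨i, a, ha, rfl⟩ := hu
    exact push_simplex _ ha
  have e : push (segV s k) (fun j => u (segV s k j)) = u := by
    refine push_restrict (segV_inj s k) fun w hw => ?_
    rcases hs w hw with h | h
    · exact ⟨0, h.symm⟩
    · exact ⟨1, h.symm⟩
  have hsum : u (sideD s k.castSucc) + u (sideD s k.succ) = 1 := by
    have := push_sum (segV s k) (fun j => u (segV s k j))
    rw [e, hsx.2, Fin.sum_univ_two] at this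
    exact this.symm
  have h0 := hsx.1 (sideD s k.castSucc)
  have h1 := hsx.1 (sideD s k.succ)
  refine ⟨h1, by linarith, ?_, ?_⟩
  · conv_lhs => rw [← e]
    rw [seg]
    congr 1
    funext m
    fin_cases m
    · show u (sideD s k.castSucc) = 1 - _
      linarith
    · rfl
  · conv_lhs => rw [← e]
    rw [push_comp, ← fact_side_lab s k.succ]
    have hinj : Function.Injective (labD ∘ segV s k) := by
      have h := fact_side_ne s k
      intro a b hab
      fin_cases a <;> fin_cases b
      · rfl
      · exact absurd hab h
      · exact absurd hab.symm h
      · rfl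
    exact push_inj hinj _ 1

theorem seg_zero (s : Fin 3) (k : Fin 4) : seg s k 0 = Pi.single (sideD s k.castSucc) 1 := by
  funext w
  simp only [seg, push, Fin.sum_univ_two, segV]
  simp [Pi.single_apply, eq_comm]

theorem seg_one (s : Fin 3) (k : Fin 4) : seg s k 1 = Pi.single (sideD s k.succ) 1 := by
  funext w
  simp only [seg, push, Fin.sum_univ_two, segV]
  simp [Pi.single_apply, eq_comm]

theorem cls_corner {u : Xd} {w : Fin 19} (hu : u.1 = Pi.single w 1) (hw : labD w = 0) :
    cls u = cls ⟨seg 0 0 0, seg_mem 0 0 le_rfl zero_le_one⟩ := by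
  have h4 : cls ⟨seg 0 3 1, seg_mem 0 3 zero_le_one le_rfl⟩ =
      cls ⟨seg 0 0 0, seg_mem 0 0 le_rfl zero_le_one⟩ := by
    rw [← cls_seg 1 0 le_rfl zero_le_one]
    congr 2
    rw [seg_one, seg_zero]
    rfl
  rcases fact_corner w hw with rfl | rfl | rfl
  · congr 1
    apply Subtype.ext
    rw [hu]; exact (seg_zero 0 0).symm
  · rw [← cls_seg 1 0 le_rfl zero_le_one]
    congr 1
    apply Subtype.ext
    rw [hu]; exact (seg_zero 1 0).symm
  · rw [← h4, ← cls_seg 1 3 zero_le_one le_rfl]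
    congr 1
    apply Subtype.ext
    rw [hu]; exact (seg_one 1 3).symm

theorem cls_eq {u u' : Xd} (h : push labD u.1 = push labD u'.1) : cls u = cls u' := by
  obtain ⟨u, hu⟩ := u
  obtain ⟨u', hu'⟩ := u'
  simp only at h
  obtain ⟨i, a, ha, rfl⟩ := id hu
  obtain ⟨i', a', ha', rfl⟩ := id hu'
  have hl : ∀ i, Function.Injective (labD ∘ triD i) := fun i j j' h => labtri_inj i j j' h
  have v1 : ∀ i a j, push labD (push (triD i) a) (labD (triD i j)) = a j := by
    intro i a j
    rw [push_comp]
    exact push_inj (hl i) a j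
  have com : ∀ i a i' a', push labD (push (triD i) a) = push labD (push (triD i') a') →
      ∀ j, a j ≠ 0 → ∃ j', labD (triD i' j') = labD (triD i j) ∧ a' j' = a j := by
    intro i a i' a' h j hj
    have h1 := v1 i a j
    rw [h] at h1
    by_contra hno
    push Not at hno
    have : push labD (push (triD i') a') (labD (triD i j)) = 0 := by
      rw [push_comp]
      apply push_not
      intro j' hj'
      have h2 := hno j' hj'
      have h3 := v1 i' a' j'
      have hj'' : labD (triD i' j') = labD (triD i j) := hj'
      rw [hj'', h1] at h3
      exact absurd h3.symm h2
    exact hj (h1 ▸ this)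
  have nz : ∀ i a w, push (triD i) a w ≠ 0 → ∃ j, triD i j = w ∧ a j ≠ 0 := by
    intro i a w hw
    by_contra hno
    push Not at hno
    exact hw (push_not a hno)
  rcases fact_tricho i i' with hA | ⟨s, s', k, hB⟩ | hC
  · congr 1
    apply Subtype.ext
    show push (triD i) a = push (triD i') a'
    funext w
    by_cases h1 : push (triD i) a w = 0
    · by_cases h2 : push (triD i') a' w = 0
      · rw [h1, h2]
      · obtain ⟨j', rfl, hj'⟩ := nz i' a' w h2
        obtain ⟨j, hj, hja⟩ := com i' a' i a h.symm j' hj'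
        rw [push_inj (tri_injective i'), ← hA j j' hj, push_inj (tri_injective i), hja]
    · obtain ⟨j, rfl, hj⟩ := nz i a w h1
      obtain ⟨j', hj', hja⟩ := com i a i' a' h j hj
      rw [push_inj (tri_injective i), hA j j' hj'.symm, push_inj (tri_injective i'), hja]
  · obtain ⟨p0, p1, pe, pl⟩ := seg_of hu s k (by
      intro w hw
      obtain ⟨j, rfl, hj⟩ := nz i a w hw
      obtain ⟨j', hj', hja⟩ := com i a i' a' h j hj
      exact (hB j j' hj'.symm).1)
    obtain ⟨q0, q1, qe, ql⟩ := seg_of hu' s' k (by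
      intro w hw
      obtain ⟨j', rfl, hj'⟩ := nz i' a' w hw
      obtain ⟨j, hj, hja⟩ := com i' a' i a h.symm j' hj'
      exact (hB j j' hj).2)
    rw [h, ql] at pl
    have c1 : cls ⟨push (triD i) a, hu⟩ = cls ⟨seg s k _, seg_mem s k p0 p1⟩ :=
      congrArg cls (Subtype.ext pe)
    have c2 : cls ⟨push (triD i') a', hu'⟩ = cls ⟨seg s' k _, seg_mem s' k q0 q1⟩ :=
      congrArg cls (Subtype.ext qe)
    rw [c1, c2, cls_seg s k p0 p1, cls_seg s' k q0 q1]
    congr 2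
    rw [pl]
  · have corner : ∀ i a i' a', a ∈ stdSimplex ℝ (Fin 3) →
        push labD (push (triD i) a) = push labD (push (triD i') a') →
        (∀ j j', labD (triD i j) = labD (triD i' j') → labD (triD i j) = 0) →
        ∃ w, push (triD i) a = Pi.single w 1 ∧ labD w = 0 := by
      intro i a i' a' ha h hC
      have hz : ∀ j, a j ≠ 0 → labD (triD i j) = 0 := by
        intro j hj
        obtain ⟨j', hj', _⟩ := com i a i' a' h j hj
        exact hC j j' hj'.symm
      obtain ⟨j, hj⟩ : ∃ j, a j ≠ 0 := by
        by_contra hno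
        push Not at hno
        have := ha.2
        simp [hno] at this
      have ho : ∀ j', j' ≠ j → a j' = 0 := by
        intro j' hne
        by_contra h0
        exact hne (labtri_inj i j' j (by rw [hz j hj, hz j' h0]))
      have h1 : a j = 1 := by
        have := ha.2
        rwa [Finset.sum_eq_single j (fun b _ hb => ho b hb) (by simp)] at this
      refine ⟨triD i j, ?_, hz j hj⟩
      funext w
      by_cases hw : triD i j = w
      · subst hw
        rw [push_inj (tri_injective i), h1]; simp
      · rw [push_not, Pi.single_eq_of_ne (Ne.symm hw)]
        intro j' hj'
        apply ho
        rintro rfl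
        exact hw hj'
    obtain ⟨w, hw, hw0⟩ := corner i a i' a' ha h hC
    obtain ⟨w', hw', hw0'⟩ := corner i' a' i a ha' h.symm (fun j j' hj => by
      rw [hj]; exact hC j' j hj.symm)
    rw [cls_corner (u := ⟨_, hu⟩) hw hw0, cls_corner (u := ⟨_, hu'⟩) hw' hw0']

instance : CompactSpace DunceHat := by unfold DunceHat; infer_instance

theorem K0_dunce : IsDunceHatTri K0 := by
  refine ⟨K0_cplx, ⟨Homeomorph.symm ?_⟩⟩
  let g : DunceHat → geomReal K0 := Quot.lift fD (fun _ _ h => fD_rel h)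
  have gc : Continuous g := continuous_quot_lift _ fD_cont
  have gb : Function.Bijective g := by
    constructor
    · intro p q
      induction p using Quot.ind with | mk x => ?_
      induction q using Quot.ind with | mk y => ?_
      intro h
      have h' : push labD (eD.symm x).1 = push labD (eD.symm y).1 := congrArg Subtype.val h
      have := cls_eq h'
      simpa [cls] using this
    · intro y
      obtain ⟨x, hx⟩ := fD_surj y
      exact ⟨Quot.mk _ x, hx⟩
  exact Continuous.homeoOfEquivCompactToT2 (f := Equiv.ofBijective g gb) gc

end Glue

section Comb1
variable {V : Type} [DecidableEq V] [Fintype V]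

/-- The edges of a complex. -/
def edg (K : Finset (Finset V)) : Finset (Finset V) := K.filter fun F => F.card = 2

/-- The vertices of a complex, as singletons. -/
def vts (K : Finset (Finset V)) : Finset (Finset V) := K.filter fun F => F.card = 1

theorem mem_edg {K : Finset (Finset V)} {e : Finset V} : e ∈ edg K ↔ e ∈ K ∧ e.card = 2 := by
  simp [edg]

theorem mem_vts {K : Finset (Finset V)} {e : Finset V} : e ∈ vts K ↔ e ∈ K ∧ e.card = 1 := by
  simp [vts]

theorem tdeg_eq (K : Finset (Finset V)) (e : Finset V) :
    tdeg K e = ((tris K).filter fun T => e ⊆ T).card := by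
  unfold tdeg tris
  rw [Finset.filter_filter]
  congr 1
  ext F
  simp [and_comm]

theorem face_of {K : Finset (Finset V)} (hK : IsCplx K) {F G : Finset V} (hF : F ∈ K) (h : G ⊆ F)
    (hc : 0 < G.card) : G ∈ K :=
  hK.2 F hF G h (Finset.card_pos.1 hc).ne_empty

/-- Edges inside a triangle through a vertex. -/
theorem cnt_edge_v {K : Finset (Finset V)} (hK : IsCplx K) {T : Finset V} (hT : T ∈ tris K) {v : V} :
    ((edg K).filter fun e => v ∈ e ∧ e ⊆ T).card = if v ∈ T then 2 else 0 := by
  rw [mem_tris] at hT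
  split_ifs with hv
  · have : ((edg K).filter fun e => v ∈ e ∧ e ⊆ T) = (T.erase v).image fun x => {v, x} := by
      ext e
      simp only [Finset.mem_filter, mem_edg, Finset.mem_image, Finset.mem_erase]
      constructor
      · rintro ⟨⟨he, h2⟩, hve, hs⟩
        obtain ⟨x, y, hxy, rfl⟩ := Finset.card_eq_two.1 h2
        simp only [Finset.mem_insert, Finset.mem_singleton] at hve
        rcases hve with rfl | rfl
        · exact ⟨y, ⟨hxy.symm, hs (by simp)⟩, rfl⟩
        · exact ⟨x, ⟨hxy, hs (by simp)⟩, Finset.pair_comm _ _⟩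
      · rintro ⟨x, ⟨hxv, hx⟩, rfl⟩
        have hs : ({v, x} : Finset V) ⊆ T := by
          intro z hz
          simp only [Finset.mem_insert, Finset.mem_singleton] at hz
          rcases hz with rfl | rfl <;> assumption
        have h2 : ({v, x} : Finset V).card = 2 := Finset.card_pair hxv.symm
        exact ⟨⟨face_of hK hT.1 hs (by omega), h2⟩, by simp, hs⟩
    rw [this, Finset.card_image_of_injOn, Finset.card_erase_of_mem hv, hT.2]
    intro x hx y hy hxy
    simp only [Finset.coe_erase, Set.mem_sdiff, Set.mem_singleton_iff] at hx hy
    have : x ∈ ({v, y} : Finset V) := by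
      have h : ({v, x} : Finset V) = {v, y} := hxy
      rw [← h]; simp
    simp only [Finset.mem_insert, Finset.mem_singleton] at this
    rcases this with h | h
    · exact absurd h hx.2
    · exact h
  · rw [Finset.card_eq_zero, Finset.filter_eq_empty_iff]
    rintro e - ⟨h1, h2⟩
    exact hv (h2 h1)

theorem cnt_edge {K : Finset (Finset V)} (hK : IsCplx K) {T : Finset V} (hT : T ∈ tris K) :
    ((edg K).filter fun e => e ⊆ T).card = 3 := by
  rw [mem_tris] at hT
  have : ((edg K).filter fun e => e ⊆ T) = T.powersetCard 2 := by
    ext e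
    simp only [Finset.mem_filter, mem_edg, Finset.mem_powersetCard]
    constructor
    · rintro ⟨⟨_, h⟩, h'⟩; exact ⟨h', h⟩
    · rintro ⟨h, h'⟩; exact ⟨⟨face_of hK hT.1 h (by omega), h'⟩, h⟩
  rw [this, Finset.card_powersetCard, hT.2]; rfl

theorem GoodC.nonsing_eq {K : Finset (Finset V)} {e T T' : Finset V}
    (h2 : tdeg K e = 2) (hT : T ∈ tris K) (hT' : T' ∈ tris K)
    (he : e ⊆ T) (he' : e ⊆ T') (hne : T ≠ T') :
    ((tris K).filter fun T => e ⊆ T) = {T, T'} := by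
  symm
  apply Finset.eq_of_subset_of_card_le
  · intro x hx
    simp only [Finset.mem_insert, Finset.mem_singleton] at hx
    rcases hx with rfl | rfl <;> simp [*]
  · rw [← tdeg_eq, h2, Finset.card_pair hne]

theorem GoodC.euler {K : Finset (Finset V)} (hK : GoodC K) (hs : ∃ e ∈ edg K, tdeg K e = 3) :
    (vts K).card + (tris K).card ≤ (edg K).card + 1 := by
  classical
  let M1 : Matrix {F // F ∈ vts K} {e // e ∈ edg K} (ZMod 2) := Matrix.of fun F e => if F.1 ⊆ e.1 then 1 else 0
  let M2 : Matrix {e // e ∈ edg K} {T // T ∈ tris K} (ZMod 2) := Matrix.of fun e T => if e.1 ⊆ T.1 then 1 else 0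
  have hmul : M1 * M2 = 0 := by
    ext F T
    obtain ⟨v, hv⟩ := Finset.card_eq_one.1 (mem_vts.1 F.2).2
    simp only [Matrix.mul_apply, M1, M2, Matrix.of_apply, Matrix.zero_apply, hv, Finset.singleton_subset_iff]
    rw [Finset.sum_coe_sort (edg K) (fun e => (if v ∈ e then (1 : ZMod 2) else 0) * if e ⊆ T.1 then 1 else 0)]
    have : ∀ e ∈ edg K, ((if v ∈ e then (1 : ZMod 2) else 0) * if e ⊆ T.1 then 1 else 0)
        = if v ∈ e ∧ e ⊆ T.1 then 1 else 0 := by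
      intro e _
      by_cases h1 : v ∈ e <;> by_cases h2 : e ⊆ T.1 <;> simp [h1, h2]
    rw [Finset.sum_congr rfl this, Finset.sum_boole, cnt_edge_v hK.cplx T.2]
    split_ifs <;> rfl
  have hle := Matrix.rank_add_rank_le_card_of_mul_eq_zero hmul
  have r2 : M2.rank = (tris K).card := by
    have hk : LinearMap.ker M2.mulVecLin = ⊥ := by
      rw [LinearMap.ker_eq_bot']
      intro y hy
      let g : Finset V → ZMod 2 := fun T => if h : T ∈ tris K then y ⟨T, h⟩ else 0
      have hg : ∀ e ∈ edg K, ∑ T ∈ (tris K).filter (fun T => e ⊆ T), g T = 0 := by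
        intro e he
        have h := congrFun hy ⟨e, he⟩
        simp only [Matrix.mulVecLin_apply, Matrix.mulVec, dotProduct, M2, Matrix.of_apply, Pi.zero_apply] at h
        rw [Finset.sum_filter, ← Finset.sum_coe_sort]
        refine Eq.trans ?_ h
        apply Finset.sum_congr rfl
        intro T _
        simp [g]
      have h01 : ∀ a : ZMod 2, a = 0 ∨ a = 1 := by decide
      by_contra hne
      have : ∃ T, y T ≠ 0 := by
        by_contra hno
        push Not at hno
        exact hne (funext hno)
      obtain ⟨T0, hT0⟩ := this
      have hZ := hK.conn ((tris K).filter fun T => g T = 1) (Finset.filter_subset _ _) (by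
        intro T hT T' hT' e he e2 ed heT heT'
        rw [Finset.mem_filter] at hT ⊢
        refine ⟨hT', ?_⟩
        by_cases hTT : T = T'
        · rw [← hTT]; exact hT.2
        have h1 := hg e (mem_edg.2 ⟨he, e2⟩)
        rw [GoodC.nonsing_eq ed hT.1 hT' heT heT' hTT, Finset.sum_pair hTT, hT.2] at h1
        rcases h01 (g T') with h | h
        · rw [h] at h1; exact absurd h1 (by decide)
        · exact h) ⟨T0.1, by
          rw [Finset.mem_filter]
          refine ⟨T0.2, ?_⟩
          have : g T0.1 = y T0 := by simp [g]
          rw [this]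
          exact (h01 _).resolve_left hT0⟩
      obtain ⟨e, he, e3⟩ := hs
      have h1 := hg e he
      rw [Finset.sum_congr rfl (g := fun _ => (1 : ZMod 2)) (by
        intro T hT
        have := (Finset.mem_filter.1 hT).1
        rw [← hZ] at this
        exact (Finset.mem_filter.1 this).2)] at h1
      rw [Finset.sum_const, ← tdeg_eq, e3] at h1
      exact absurd h1 (by decide)
    have h := LinearMap.finrank_range_add_finrank_ker M2.mulVecLin
    rw [hk, finrank_bot, Module.finrank_fintype_fun_eq_card, Fintype.card_coe] at h
    rw [Matrix.rank]; omega
  have r1 : (vts K).card ≤ M1.rank + 1 := by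
    rw [← Matrix.rank_transpose]
    have h := LinearMap.finrank_range_add_finrank_ker M1.transpose.mulVecLin
    rw [Module.finrank_fintype_fun_eq_card, Fintype.card_coe] at h
    have hk : Module.finrank (ZMod 2) (LinearMap.ker M1.transpose.mulVecLin) ≤ 1 := by
      have hsub : LinearMap.ker M1.transpose.mulVecLin ≤ Submodule.span (ZMod 2) {fun _ => 1} := by
        intro x hx
        rw [LinearMap.mem_ker] at hx
        rw [Submodule.mem_span_singleton]
        let g : V → ZMod 2 := fun v => if h : {v} ∈ vts K then x ⟨{v}, h⟩ else 0
        have hg : ∀ a b, a ≠ b → {a, b} ∈ K → g a = g b := by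
          intro a b hab he
          have h2 : ({a, b} : Finset V).card = 2 := Finset.card_pair hab
          have ha : {a} ∈ vts K := mem_vts.2 ⟨face_of hK.cplx he (by simp) (by simp), by simp⟩
          have hb : {b} ∈ vts K := mem_vts.2 ⟨face_of hK.cplx he (by simp) (by simp), by simp⟩
          have h := congrFun hx ⟨{a, b}, mem_edg.2 ⟨he, h2⟩⟩
          simp only [Matrix.mulVecLin_apply, Matrix.mulVec, dotProduct, M1, Matrix.of_apply, Pi.zero_apply,
            Matrix.transpose_apply] at h
          have hab' : (⟨{a}, ha⟩ : {F // F ∈ vts K}) ≠ ⟨{b}, hb⟩ := by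
            intro h; exact hab (Finset.singleton_injective (congrArg Subtype.val h))
          rw [Fintype.sum_eq_add _ _ hab'] at h
          · have ga : g a = x ⟨{a}, ha⟩ := by simp [g, ha]
            have gb : g b = x ⟨{b}, hb⟩ := by simp [g, hb]
            rw [ga, gb]
            simp at h
            have key : ∀ p q : ZMod 2, p + q = 0 → p = q := by decide
            exact key _ _ h
          · rintro F ⟨hFa, hFb⟩
            obtain ⟨v, hv⟩ := Finset.card_eq_one.1 (mem_vts.1 F.2).2
            rw [if_neg, zero_mul]
            rw [hv, Finset.singleton_subset_iff]
            intro hm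
            simp only [Finset.mem_insert, Finset.mem_singleton] at hm
            rcases hm with rfl | rfl
            · exact hFa (Subtype.ext hv)
            · exact hFb (Subtype.ext hv)
        have hgT : ∀ T ∈ tris K, ∀ a ∈ T, ∀ b ∈ T, g a = g b := by
          intro T hT a ha b hb
          by_cases hab : a = b
          · rw [hab]
          · exact hg a b hab (face_of hK.cplx (mem_tris.1 hT).1 (by
              intro z hz
              simp only [Finset.mem_insert, Finset.mem_singleton] at hz
              rcases hz with rfl | rfl <;> assumption) (by simp))
        obtain ⟨e0, he0, _⟩ := hs
        obtain ⟨T0, hT0, _⟩ := hK.exists_tri (mem_edg.1 he0).1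
        obtain ⟨a0, ha0⟩ : T0.Nonempty := Finset.card_pos.1 (by rw [(mem_tris.1 hT0).2]; omega)
        have hZ := hK.conn ((tris K).filter fun T => ∀ a ∈ T, g a = g a0) (Finset.filter_subset _ _) (by
          intro T hT T' hT' e he e2 ed heT heT'
          rw [Finset.mem_filter] at hT ⊢
          refine ⟨hT', fun a ha => ?_⟩
          obtain ⟨b, hb⟩ : e.Nonempty := Finset.card_pos.1 (by omega)
          rw [hgT T' hT' a ha b (heT' hb)]
          exact hT.2 b (heT hb)) ⟨T0, Finset.mem_filter.2 ⟨hT0, fun a ha => hgT T0 hT0 a ha a0 ha0⟩⟩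
        refine ⟨g a0, ?_⟩
        ext F
        obtain ⟨v, hv⟩ := Finset.card_eq_one.1 (mem_vts.1 F.2).2
        obtain ⟨T, hT, hFT⟩ := hK.exists_tri (mem_vts.1 F.2).1
        have hT' := hT
        rw [← hZ, Finset.mem_filter] at hT'
        have h1 := hT'.2 v (hFT (by rw [hv]; simp))
        have hv' : {v} ∈ vts K := hv ▸ F.2
        have h2 : g v = x ⟨{v}, hv'⟩ := by simp [g, hv']
        have h3 : F = ⟨{v}, hv'⟩ := Subtype.ext hv
        rw [h3, ← h2, h1]; simp
      refine (Submodule.finrank_mono hsub).trans ?_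
      exact (finrank_span_le_card _).trans (by simp)
    rw [Matrix.rank]; omega
  rw [Fintype.card_coe] at hle
  omega

theorem sum_tdeg {K : Finset (Finset V)} (S : Finset (Finset V)) :
    ∑ e ∈ S, tdeg K e = ∑ T ∈ tris K, (S.filter fun e => e ⊆ T).card := by
  have := Finset.sum_card_bipartiteAbove_eq_sum_card_bipartiteBelow (s := S) (t := tris K) (fun e T => e ⊆ T)
  simp only [Finset.bipartiteAbove, Finset.bipartiteBelow] at this
  rw [← this]
  exact Finset.sum_congr rfl fun e _ => tdeg_eq K e

/-- The singular edges. -/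
def sedg (K : Finset (Finset V)) : Finset (Finset V) := (edg K).filter fun e => tdeg K e = 3

theorem GoodC.sum_deg {K : Finset (Finset V)} (hK : GoodC K) {S : Finset (Finset V)} (hS : S ⊆ edg K) :
    ∑ e ∈ S, tdeg K e = 2 * S.card + (S.filter fun e => tdeg K e = 3).card := by
  have : ∀ e ∈ S, tdeg K e = 2 + if tdeg K e = 3 then 1 else 0 := by
    intro e he
    have h := mem_edg.1 (hS he)
    rcases hK.deg e h.1 h.2 with h | h <;> simp [h]
  rw [Finset.sum_congr rfl this, Finset.sum_add_distrib, Finset.sum_const, Finset.sum_boole]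
  simp [mul_comm]

theorem GoodC.count3 {K : Finset (Finset V)} (hK : GoodC K) :
    3 * (tris K).card = 2 * (edg K).card + (sedg K).card := by
  have h1 := hK.sum_deg (Finset.Subset.refl (edg K))
  rw [sum_tdeg, Finset.sum_congr rfl fun T hT => cnt_edge hK.cplx hT, Finset.sum_const] at h1
  simp only [smul_eq_mul] at h1
  rw [sedg]; omega

/-- The singular degree of a vertex. -/
def sdeg (K : Finset (Finset V)) (v : V) : ℕ := ((sedg K).filter fun e => v ∈ e).card

theorem GoodC.sdeg_even {K : Finset (Finset V)} (hK : GoodC K) (v : V) : Even (sdeg K v) := by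
  have h1 := hK.sum_deg (Finset.filter_subset (fun e => v ∈ e) (edg K))
  rw [sum_tdeg] at h1
  simp only [Finset.filter_filter] at h1
  rw [Finset.sum_congr rfl fun T hT => cnt_edge_v hK.cplx hT] at h1
  have h2 : Even (∑ T ∈ tris K, if v ∈ T then 2 else 0) := by
    apply Finset.even_sum
    intro T _
    split_ifs <;> decide
  have h3 : sdeg K v = ((edg K).filter fun e => v ∈ e ∧ tdeg K e = 3).card := by
    unfold sdeg sedg
    rw [Finset.filter_filter]
    congr 1
    ext e
    simp only [Finset.mem_filter]
    tauto
  rw [h3]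
  rw [h1] at h2
  obtain ⟨k, hk⟩ := h2
  exact ⟨k - ((edg K).filter fun e => v ∈ e).card, by omega⟩

theorem sum_sdeg (K : Finset (Finset V)) (S : Finset V) :
    ∑ v ∈ S, sdeg K v = ∑ e ∈ sedg K, (S ∩ e).card := by
  have := Finset.sum_card_bipartiteAbove_eq_sum_card_bipartiteBelow (s := S) (t := sedg K) (fun v e => v ∈ e)
  simp only [Finset.bipartiteAbove, Finset.bipartiteBelow] at this
  rw [show ∑ v ∈ S, sdeg K v = _ from this]
  refine Finset.sum_congr rfl fun e _ => ?_
  rw [Finset.filter_mem_eq_inter]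

theorem mem_sedg {K : Finset (Finset V)} {e : Finset V} :
    e ∈ sedg K ↔ e ∈ K ∧ e.card = 2 ∧ tdeg K e = 3 := by
  simp [sedg, mem_edg, and_assoc]

theorem GoodC.sdeg_two {K : Finset (Finset V)} (hK : GoodC K) {e : Finset V} (he : e ∈ sedg K) {v : V}
    (hv : v ∈ e) : 2 ≤ sdeg K v := by
  have h1 : 0 < sdeg K v := Finset.card_pos.2 ⟨e, Finset.mem_filter.2 ⟨he, hv⟩⟩
  obtain ⟨k, hk⟩ := hK.sdeg_even v
  omega

theorem GoodC.three_sedg {K : Finset (Finset V)} (hK : GoodC K) {e : Finset V} (he : e ∈ sedg K) :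
    3 ≤ (sedg K).card := by
  obtain ⟨u, v, huv, rfl⟩ := Finset.card_eq_two.1 (mem_sedg.1 he).2.1
  have ex : ∀ w ∈ ({u, v} : Finset V), ∃ f ∈ sedg K, w ∈ f ∧ f ≠ {u, v} := by
    intro w hw
    have h := hK.sdeg_two he hw
    obtain ⟨f, hf, hne⟩ := Finset.exists_mem_ne (by exact h) ({u, v} : Finset V)
    rw [Finset.mem_filter] at hf
    exact ⟨f, hf.1, hf.2, hne⟩
  obtain ⟨f, hf, huf, hf'⟩ := ex u (by simp)
  obtain ⟨g, hg, hvg, hg'⟩ := ex v (by simp)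
  have hfg : f ≠ g := by
    rintro rfl
    apply hf'
    symm
    apply Finset.eq_of_subset_of_card_le
    · intro x hx
      simp only [Finset.mem_insert, Finset.mem_singleton] at hx
      rcases hx with rfl | rfl <;> assumption
    · rw [(mem_sedg.1 hf).2.1, Finset.card_pair huv]
  have : ({({u, v} : Finset V), f, g} : Finset (Finset V)) ⊆ sedg K := by
    intro x hx
    simp only [Finset.mem_insert, Finset.mem_singleton] at hx
    rcases hx with rfl | rfl | rfl <;> assumption
  refine le_trans ?_ (Finset.card_le_card this)
  rw [Finset.card_eq_three.2 ⟨_, _, _, hf'.symm, hg'.symm, hfg, rfl⟩]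

end Comb1

section Comb2
variable {V : Type} [DecidableEq V] [Fintype V]

/-- The vertices of a complex. -/
def vtx (K : Finset (Finset V)) : Finset V := Finset.univ.filter fun v => {v} ∈ K

theorem mem_vtx {K : Finset (Finset V)} {v : V} : v ∈ vtx K ↔ {v} ∈ K := by simp [vtx]

theorem card_vtx (K : Finset (Finset V)) : (vtx K).card = (vts K).card := by
  have : vts K = (vtx K).image fun v => {v} := by
    ext F
    simp only [mem_vts, Finset.mem_image, mem_vtx]
    constructor
    · rintro ⟨h, h1⟩
      obtain ⟨v, rfl⟩ := Finset.card_eq_one.1 h1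
      exact ⟨v, h, rfl⟩
    · rintro ⟨v, h, rfl⟩
      exact ⟨h, by simp⟩
  rw [this, Finset.card_image_of_injective _ Finset.singleton_injective]

theorem mem_vtx_of {K : Finset (Finset V)} (hK : IsCplx K) {F : Finset V} (hF : F ∈ K) {v : V}
    (hv : v ∈ F) : v ∈ vtx K :=
  mem_vtx.2 (face_of hK hF (by simpa using hv) (by simp))

/-- Color classes. -/
def cl (K : Finset (Finset V)) (κ : V → Fin 3) (i : Fin 3) : Finset V := (vtx K).filter fun v => κ v = i

theorem mem_cl {K : Finset (Finset V)} {κ : V → Fin 3} {i : Fin 3} {v : V} :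
    v ∈ cl K κ i ↔ v ∈ vtx K ∧ κ v = i := by simp [cl]

theorem sum3 (f : Fin 3 → ℕ) (i j k : Fin 3) (hij : i ≠ j) (hik : i ≠ k) (hjk : j ≠ k) :
    ∑ c, f c = f i + f j + f k := by
  rw [Fin.sum_univ_three]
  fin_cases i <;> fin_cases j <;> fin_cases k <;> simp at hij hik hjk ⊢ <;> omega

theorem third (i j : Fin 3) (h : i ≠ j) : ∃ k, i ≠ k ∧ j ≠ k ∧ ∀ c, c = i ∨ c = j ∨ c = k := by
  revert i j; decide

theorem other (i : Fin 3) : ∃ j, i ≠ j := by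
  revert i; decide

theorem all3 (i j k : Fin 3) (hij : i ≠ j) (hik : i ≠ k) (hjk : j ≠ k) (c : Fin 3) :
    c = i ∨ c = j ∨ c = k := by
  revert i j k c; decide

theorem sum_cl (K : Finset (Finset V)) (κ : V → Fin 3) (f : V → ℕ) :
    ∑ c, ∑ v ∈ cl K κ c, f v = ∑ v ∈ vtx K, f v :=
  Finset.sum_fiberwise (vtx K) κ f

theorem card_cl (K : Finset (Finset V)) (κ : V → Fin 3) :
    ∑ c, (cl K κ c).card = (vts K).card := by
  rw [← card_vtx, Finset.card_eq_sum_ones (vtx K), ← sum_cl K κ]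
  simp

theorem col_tri {K : Finset (Finset V)} {κ : V → Fin 3} (hκ : ProperColoring 2 K κ) {T : Finset V}
    (hT : T ∈ tris K) (i : Fin 3) : ∃ x ∈ T, κ x = i := by
  have h : (T.image κ).card = 3 := by
    rw [Finset.card_image_of_injOn (hκ T (mem_tris.1 hT).1), (mem_tris.1 hT).2]
  have : T.image κ = Finset.univ := Finset.eq_univ_of_card _ (by rw [h]; rfl)
  have hi := Finset.mem_univ i
  rw [← this, Finset.mem_image] at hi
  exact hi

theorem col_inj {K : Finset (Finset V)} {κ : V → Fin 3} (hκ : ProperColoring 2 K κ) {T : Finset V}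
    (hT : T ∈ K) {x y : V} (hx : x ∈ T) (hy : y ∈ T) (h : κ x = κ y) : x = y :=
  hκ T hT hx hy h

/-- Edges avoiding a color. -/
def eopp (K : Finset (Finset V)) (κ : V → Fin 3) (i : Fin 3) : Finset (Finset V) :=
  (edg K).filter fun e => ∀ x ∈ e, κ x ≠ i

/-- Edges at a vertex with the other end of given color. -/
def eat (K : Finset (Finset V)) (κ : V → Fin 3) (v : V) (j : Fin 3) : Finset (Finset V) :=
  (edg K).filter fun e => v ∈ e ∧ ∃ x ∈ e, κ x = j

theorem pair_sub {a b : V} {T : Finset V} (ha : a ∈ T) (hb : b ∈ T) : ({a, b} : Finset V) ⊆ T := by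
  intro z hz
  simp only [Finset.mem_insert, Finset.mem_singleton] at hz
  rcases hz with rfl | rfl <;> assumption

theorem eq_pair {a b : V} {e : Finset V} (ha : a ∈ e) (hb : b ∈ e) (hab : a ≠ b) (he : e.card = 2) :
    e = {a, b} := by
  symm
  apply Finset.eq_of_subset_of_card_le (pair_sub ha hb)
  rw [he, Finset.card_pair hab]

theorem eq_triple {a b c : V} {T : Finset V} (ha : a ∈ T) (hb : b ∈ T) (hc : c ∈ T) (hab : a ≠ b)
    (hac : a ≠ c) (hbc : b ≠ c) (hT : T.card = 3) : T = {a, b, c} := by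
  symm
  apply Finset.eq_of_subset_of_card_le
  · intro z hz
    simp only [Finset.mem_insert, Finset.mem_singleton] at hz
    rcases hz with rfl | rfl | rfl <;> assumption
  · rw [hT, Finset.card_eq_three.2 ⟨a, b, c, hab, hac, hbc, rfl⟩]

theorem cnt_opp {K : Finset (Finset V)} (hK : IsCplx K) {κ : V → Fin 3} (hκ : ProperColoring 2 K κ)
    {T : Finset V} (hT : T ∈ tris K) (i : Fin 3) :
    ((eopp K κ i).filter fun e => e ⊆ T).card ≤ 1 := by
  obtain ⟨x, hx, hxi⟩ := col_tri hκ hT i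
  have hT' := mem_tris.1 hT
  have : ∀ e ∈ (eopp K κ i).filter fun e => e ⊆ T, e = T.erase x := by
    intro e he
    simp only [eopp, Finset.mem_filter, mem_edg] at he
    apply Finset.eq_of_subset_of_card_le
    · intro y hy
      rw [Finset.mem_erase]
      refine ⟨?_, he.2 hy⟩
      rintro rfl
      exact he.1.2 y hy hxi
    · rw [Finset.card_erase_of_mem hx, hT'.2, he.1.1.2]
  rw [Finset.card_le_one]
  intro a ha b hb
  rw [this a ha, this b hb]

theorem GoodC.opp_le {K : Finset (Finset V)} (hK : GoodC K) {κ : V → Fin 3} (hκ : ProperColoring 2 K κ)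
    (i : Fin 3) : 2 * (eopp K κ i).card ≤ (tris K).card := by
  have h1 := hK.sum_deg (Finset.filter_subset (fun e => ∀ x ∈ e, κ x ≠ i) (edg K))
  rw [sum_tdeg] at h1
  have h2 : ∑ T ∈ tris K, ((eopp K κ i).filter fun e => e ⊆ T).card ≤ ∑ T ∈ tris K, 1 :=
    Finset.sum_le_sum fun T hT => cnt_opp hK.cplx hκ hT i
  rw [Finset.sum_const, smul_eq_mul, mul_one] at h2
  unfold eopp at h2 ⊢
  omega

theorem cnt_eat {K : Finset (Finset V)} (hK : IsCplx K) {κ : V → Fin 3} (hκ : ProperColoring 2 K κ)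
    {T : Finset V} (hT : T ∈ tris K) {v : V} {j : Fin 3} (hj : κ v ≠ j) :
    ((eat K κ v j).filter fun e => e ⊆ T).card = if v ∈ T then 1 else 0 := by
  have hT' := mem_tris.1 hT
  split_ifs with hv
  · obtain ⟨x, hx, hxj⟩ := col_tri hκ hT j
    have hvx : v ≠ x := by rintro rfl; exact hj hxj
    rw [Finset.card_eq_one]
    refine ⟨{v, x}, ?_⟩
    ext e
    simp only [eat, Finset.mem_filter, mem_edg, Finset.mem_singleton]
    constructor
    · rintro ⟨⟨⟨_, h2⟩, hve, y, hy, hyj⟩, hs⟩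
      have : y = x := col_inj hκ hT'.1 (hs hy) hx (hyj.trans hxj.symm)
      subst this
      exact eq_pair hve hy hvx h2
    · rintro rfl
      exact ⟨⟨⟨face_of hK hT'.1 (pair_sub hv hx) (by simp), Finset.card_pair hvx⟩, by simp, x, by simp, hxj⟩,
        pair_sub hv hx⟩
  · rw [Finset.card_eq_zero, Finset.filter_eq_empty_iff]
    intro e he hs
    simp only [eat, Finset.mem_filter] at he
    exact hv (hs he.2.1)

theorem GoodC.eat_sum {K : Finset (Finset V)} (hK : GoodC K) {κ : V → Fin 3} (hκ : ProperColoring 2 K κ)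
    {v : V} {j : Fin 3} (hj : κ v ≠ j) (hv : sdeg K v = 0) :
    2 * (eat K κ v j).card = ∑ T ∈ tris K, if v ∈ T then 1 else 0 := by
  have h1 := hK.sum_deg (Finset.filter_subset (fun e => v ∈ e ∧ ∃ x ∈ e, κ x = j) (edg K))
  rw [sum_tdeg] at h1
  have h2 := Finset.sum_congr rfl fun T (hT : T ∈ tris K) => cnt_eat hK.cplx hκ hT hj
  have h3 : ((eat K κ v j).filter fun e => tdeg K e = 3).card = 0 := by
    rw [Finset.card_eq_zero, Finset.filter_eq_empty_iff]
    intro e he h3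
    simp only [eat, Finset.mem_filter] at he
    unfold sdeg at hv
    rw [Finset.card_eq_zero, Finset.filter_eq_empty_iff] at hv
    exact hv (mem_sedg.2 ⟨(mem_edg.1 he.1).1, (mem_edg.1 he.1).2, h3⟩) he.2.1
  rw [← h2]
  unfold eat at h3 ⊢
  omega

theorem eat_le {K : Finset (Finset V)} (hK : IsCplx K) {κ : V → Fin 3} {v : V} {j : Fin 3} (hj : κ v ≠ j) :
    (eat K κ v j).card ≤ (cl K κ j).card := by
  have : eat K κ v j ⊆ (cl K κ j).image fun x => {v, x} := by
    intro e he
    simp only [eat, Finset.mem_filter, mem_edg] at he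
    obtain ⟨⟨heK, h2⟩, hv, x, hx, hxj⟩ := he
    rw [Finset.mem_image]
    refine ⟨x, mem_cl.2 ⟨mem_vtx_of hK heK hx, hxj⟩, ?_⟩
    exact (eq_pair hv hx (by rintro rfl; exact hj hxj) h2).symm
  exact (Finset.card_le_card this).trans Finset.card_image_le

theorem opp_le_sum {K : Finset (Finset V)} (hK : IsCplx K) {κ : V → Fin 3} (hκ : ProperColoring 2 K κ)
    {i j k : Fin 3} (hij : i ≠ j) (hik : i ≠ k) (hjk : j ≠ k) :
    (eopp K κ k).card ≤ ∑ v ∈ cl K κ i, (eat K κ v j).card := by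
  have : eopp K κ k ⊆ (cl K κ i).biUnion fun v => eat K κ v j := by
    intro e he
    have he' := he
    simp only [eopp, Finset.mem_filter, mem_edg] at he'
    obtain ⟨⟨heK, h2⟩, hk⟩ := he'
    obtain ⟨x, y, hxy, rfl⟩ := Finset.card_eq_two.1 h2
    have hne : κ x ≠ κ y := fun h => hxy (col_inj hκ heK (by simp) (by simp) h)
    have hx := hk x (by simp)
    have hy := hk y (by simp)
    rw [Finset.mem_biUnion]
    rcases all3 i j k hij hik hjk (κ x) with h | h | h
    · have hyj : κ y = j := by
        rcases all3 i j k hij hik hjk (κ y) with h' | h' | h'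
        · exact absurd (h.trans h'.symm) hne
        · exact h'
        · exact absurd h' hy
      refine ⟨x, mem_cl.2 ⟨mem_vtx_of hK heK (by simp), h⟩, ?_⟩
      simp only [eat, Finset.mem_filter, mem_edg]
      exact ⟨⟨heK, h2⟩, by simp, y, by simp, hyj⟩
    · have hyi : κ y = i := by
        rcases all3 i j k hij hik hjk (κ y) with h' | h' | h'
        · exact h'
        · exact absurd (h.trans h'.symm) hne
        · exact absurd h' hy
      refine ⟨y, mem_cl.2 ⟨mem_vtx_of hK heK (by simp), hyi⟩, ?_⟩
      simp only [eat, Finset.mem_filter, mem_edg]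
      exact ⟨⟨heK, h2⟩, by simp, x, by simp, h⟩
    · exact absurd h hx
  exact (Finset.card_le_card this).trans Finset.card_biUnion_le

theorem opp_le_mul {K : Finset (Finset V)} (hK : IsCplx K) {κ : V → Fin 3} (hκ : ProperColoring 2 K κ)
    {i j k : Fin 3} (hij : i ≠ j) (hik : i ≠ k) (hjk : j ≠ k) :
    (eopp K κ k).card ≤ (cl K κ i).card * (cl K κ j).card := by
  refine (opp_le_sum hK hκ hij hik hjk).trans ?_
  rw [← smul_eq_mul, ← Finset.sum_const]
  apply Finset.sum_le_sum
  intro v hv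
  apply eat_le hK
  rw [(mem_cl.1 hv).2]; exact hij

theorem edg_le {K : Finset (Finset V)} (κ : V → Fin 3) :
    (edg K).card ≤ ∑ c, (eopp K κ c).card := by
  have : edg K ⊆ Finset.univ.biUnion fun c => eopp K κ c := by
    intro e he
    have h2 := (mem_edg.1 he).2
    obtain ⟨x, y, hxy, rfl⟩ := Finset.card_eq_two.1 h2
    have key : ∀ a b : Fin 3, ∃ c, a ≠ c ∧ b ≠ c := by decide
    obtain ⟨c, h1, h2⟩ := key (κ x) (κ y)
    rw [Finset.mem_biUnion]
    refine ⟨c, Finset.mem_univ _, ?_⟩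
    simp only [eopp, Finset.mem_filter]
    refine ⟨he, ?_⟩
    intro z hz
    simp only [Finset.mem_insert, Finset.mem_singleton] at hz
    rcases hz with rfl | rfl <;> assumption
  exact (Finset.card_le_card this).trans Finset.card_biUnion_le

theorem GoodC.sum_sdeg_cl {K : Finset (Finset V)} (hK : GoodC K) (κ : V → Fin 3) :
    ∑ c, ∑ v ∈ cl K κ c, sdeg K v = 2 * (sedg K).card := by
  rw [sum_cl, sum_sdeg]
  have : ∀ e ∈ sedg K, (vtx K ∩ e).card = 2 := by
    intro e he
    rw [mem_sedg] at he
    rw [Finset.inter_eq_right.2, he.2.1]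
    intro v hv
    exact mem_vtx_of hK.cplx he.1 hv
  rw [Finset.sum_congr rfl this, Finset.sum_const, smul_eq_mul, mul_comm]

/-- The numerical consequences. -/
theorem GoodC.numeric {K : Finset (Finset V)} (hK : GoodC K) {κ : V → Fin 3} (hκ : ProperColoring 2 K κ)
    (hs : (sedg K).Nonempty) (hN : (vts K).card ≤ 10) :
    (∀ v, sdeg K v ≤ 2) ∧ ∀ i, (cl K κ i).card ≤ 3 ∨
      ((cl K κ i).card ≤ 4 ∧ ∀ v ∈ cl K κ i, sdeg K v = 0) := by
  obtain ⟨e0, he0⟩ := hs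
  have h3s := hK.three_sedg he0
  have heul := hK.euler ⟨e0, (Finset.mem_filter.1 he0).1, (Finset.mem_filter.1 he0).2⟩
  have hc3 := hK.count3
  have hf1 := edg_le (K := K) κ
  have hcl := card_cl K κ
  have hsum := hK.sum_sdeg_cl κ
  have hev : ∀ v, sdeg K v = 0 ∨ 2 ≤ sdeg K v := by
    intro v
    obtain ⟨k, hk⟩ := hK.sdeg_even v
    omega
  have hge3 : ∀ i, 3 ≤ (cl K κ i).card := by
    intro i
    by_contra hlt
    obtain ⟨j, hij⟩ := other i
    obtain ⟨k, hik, hjk, _⟩ := third i j hij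
    rw [sum3 _ i j k hij hik hjk] at hf1 hcl
    have a1 := opp_le_mul hK.cplx hκ hij hik hjk
    have a2 := opp_le_mul hK.cplx hκ hik hij hjk.symm
    have a3 := hK.opp_le hκ i
    have a4 : (sedg K).card ≤ (edg K).card := Finset.card_le_card (Finset.filter_subset _ _)
    generalize (cl K κ i).card = ni at *
    have : ni = 0 ∨ ni = 1 ∨ ni = 2 := by omega
    rcases this with rfl | rfl | rfl <;> omega
  have h4 : ∀ i, (cl K κ i).card = 4 → (∀ v, sdeg K v ≤ 2) ∧ ∀ v ∈ cl K κ i, sdeg K v = 0 := by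
    intro i hi
    obtain ⟨j, hij⟩ := other i
    obtain ⟨k, hik, hjk, hall⟩ := third i j hij
    rw [sum3 _ i j k hij hik hjk] at hf1 hcl hsum
    have hj3 := hge3 j
    have hk3 := hge3 k
    have hj : (cl K κ j).card = 3 := by omega
    have hk : (cl K κ k).card = 3 := by omega
    have bound : ∀ j k, i ≠ j → i ≠ k → j ≠ k → (cl K κ j).card = 3 → (cl K κ k).card = 3 →
        2 * (eopp K κ k).card ≤ 18 + ∑ v ∈ cl K κ j, min (sdeg K v) 2 := by
      intro j k hij hik hjk hj hk
      have h1 := opp_le_sum hK.cplx hκ hij.symm hjk hik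
      have h2 : ∑ v ∈ cl K κ j, 2 * (eat K κ v i).card ≤ ∑ v ∈ cl K κ j, (6 + min (sdeg K v) 2) := by
        apply Finset.sum_le_sum
        intro v hv
        have hvj := (mem_cl.1 hv).2
        have e1 : (eat K κ v i).card ≤ (cl K κ i).card := eat_le hK.cplx (by rw [hvj]; exact hij.symm)
        rcases hev v with h0 | h2
        · have e2 : (eat K κ v k).card ≤ (cl K κ k).card := eat_le hK.cplx (by rw [hvj]; exact hjk)
          have e3 := hK.eat_sum hκ (v := v) (j := i) (by rw [hvj]; exact hij.symm) h0
          have e4 := hK.eat_sum hκ (v := v) (j := k) (by rw [hvj]; exact hjk) h0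
          omega
        · rw [min_eq_right h2]; omega
      rw [← Finset.mul_sum, Finset.sum_add_distrib, Finset.sum_const, hj] at h2
      simp only [smul_eq_mul] at h2
      omega
    have b1 := bound j k hij hik hjk hj hk
    have b2 := bound k j hik hij hjk.symm hk hj
    have b3 := opp_le_mul hK.cplx hκ hjk hij.symm hik.symm
    rw [hj, hk] at b3
    have m : ∀ c, ∑ v ∈ cl K κ c, min (sdeg K v) 2 ≤ ∑ v ∈ cl K κ c, sdeg K v :=
      fun c => Finset.sum_le_sum fun v _ => min_le_left _ _
    have mj := m j
    have mk := m k
    have si : ∑ v ∈ cl K κ i, sdeg K v = 0 := by omega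
    have sj : ∑ v ∈ cl K κ j, min (sdeg K v) 2 = ∑ v ∈ cl K κ j, sdeg K v := by omega
    have sk : ∑ v ∈ cl K κ k, min (sdeg K v) 2 = ∑ v ∈ cl K κ k, sdeg K v := by omega
    have zi : ∀ v ∈ cl K κ i, sdeg K v = 0 := Finset.sum_eq_zero_iff.1 si
    have zj := (Finset.sum_eq_sum_iff_of_le fun v _ => min_le_left _ _).1 sj
    have zk := (Finset.sum_eq_sum_iff_of_le fun v _ => min_le_left _ _).1 sk
    refine ⟨fun v => ?_, zi⟩
    by_cases hv : v ∈ vtx K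
    · rcases hall (κ v) with h | h | h
      · rw [zi v (mem_cl.2 ⟨hv, h⟩)]; omega
      · have := zj v (mem_cl.2 ⟨hv, h⟩); omega
      · have := zk v (mem_cl.2 ⟨hv, h⟩); omega
    · rw [sdeg, Finset.card_eq_zero.2]
      · omega
      · rw [Finset.filter_eq_empty_iff]
        intro e he hve
        exact hv (mem_vtx_of hK.cplx (mem_sedg.1 he).1 hve)
  have hle4 : ∀ i, (cl K κ i).card ≤ 4 := by
    intro i
    obtain ⟨j, hij⟩ := other i
    obtain ⟨k, hik, hjk, hall⟩ := third i j hij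
    rw [sum3 _ i j k hij hik hjk] at hcl
    have := hge3 j
    have := hge3 k
    omega
  refine ⟨?_, fun i => ?_⟩
  · by_cases hex : ∃ i, (cl K κ i).card = 4
    · obtain ⟨i, hi⟩ := hex
      exact (h4 i hi).1
    · push Not at hex
      have h3 : ∀ i, (cl K κ i).card = 3 := by
        intro i
        have := hge3 i
        have := hle4 i
        have := hex i
        omega
      have p2 := opp_le_mul hK.cplx hκ (i := 0) (j := 1) (k := 2) (by decide) (by decide) (by decide)
      have p1 := opp_le_mul hK.cplx hκ (i := 0) (j := 2) (k := 1) (by decide) (by decide) (by decide)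
      have p0 := opp_le_mul hK.cplx hκ (i := 1) (j := 2) (k := 0) (by decide) (by decide) (by decide)
      rw [h3, h3] at p0 p1 p2
      rw [Fin.sum_univ_three] at hf1 hcl
      rw [h3, h3, h3] at hcl
      intro v
      have hle : sdeg K v ≤ (sedg K).card := Finset.card_le_card (Finset.filter_subset _ _)
      obtain ⟨k, hk⟩ := hK.sdeg_even v
      omega
  · have := hle4 i
    by_cases h : (cl K κ i).card = 4
    · exact Or.inr ⟨this, (h4 i h).2⟩
    · left; omega

theorem theta_contra {K : Finset (Finset V)} (hK : GoodC K) {κ : V → Fin 3} (hκ : ProperColoring 2 K κ)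
    (hd : ∀ v, sdeg K v ≤ 2) (hc : ∀ i, (cl K κ i).card ≤ 3 ∨
      ((cl K κ i).card ≤ 4 ∧ ∀ v ∈ cl K κ i, sdeg K v = 0)) {v : V} (h : NonTheta K v) : False := by
  obtain ⟨Z, hZ, ⟨T0, hT0⟩, hvZ, hcl, e, heK, e2, e3, hve, hmiss⟩ := h
  have hes : e ∈ sedg K := mem_sedg.2 ⟨heK, e2, e3⟩
  obtain ⟨w', hw'e, hw'v⟩ := Finset.exists_mem_ne (by omega : 1 < e.card) v
  have heq : e = {v, w'} := eq_pair hve hw'e hw'v.symm e2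
  have hcol : κ v ≠ κ w' := fun h => hw'v (col_inj hκ heK hve hw'e h).symm
  obtain ⟨r, hvr, hwr, hall⟩ := third _ _ hcol
  -- the other singular edge at `v`
  obtain ⟨w, hw1, hw2⟩ : ∃ w, (w = w' ∨ {v, w} ∈ sedg K) ∧
      ∀ x, x ≠ v → {v, x} ∈ sedg K → x = w' ∨ x = w := by
    by_cases hex : ∃ x, x ≠ v ∧ x ≠ w' ∧ {v, x} ∈ sedg K
    · obtain ⟨x, hxv, hxw, hx⟩ := hex
      refine ⟨x, Or.inr hx, ?_⟩
      intro y hyv hy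
      by_contra hno
      push Not at hno
      have inj : ∀ a b : V, a ≠ v → ({v, a} : Finset V) = {v, b} → a = b := by
        intro a b ha hab
        have : a ∈ ({v, b} : Finset V) := by rw [← hab]; simp
        simp only [Finset.mem_insert, Finset.mem_singleton] at this
        exact this.resolve_left ha
      have hsub : ({({v, w'} : Finset V), {v, x}, {v, y}} : Finset (Finset V)) ⊆
          (sedg K).filter fun e => v ∈ e := by
        intro z hz
        simp only [Finset.mem_insert, Finset.mem_singleton] at hz
        rw [Finset.mem_filter]
        rcases hz with rfl | rfl | rfl
        · exact ⟨heq ▸ hes, by simp⟩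
        · exact ⟨hx, by simp⟩
        · exact ⟨hy, by simp⟩
      have h1 := Finset.card_le_card hsub
      rw [Finset.card_eq_three.2 ⟨_, _, _, fun h => hxw (inj _ _ hw'v h).symm,
        fun h => hno.1 (inj _ _ hw'v h).symm, fun h => hno.2 (inj _ _ hxv h).symm, rfl⟩] at h1
      have h2 := hd v
      unfold sdeg at h2
      omega
    · push Not at hex
      refine ⟨w', Or.inl rfl, fun x hxv hx => ?_⟩
      left
      by_contra hne
      exact hex x hxv hne hx
  have tri : ∀ T ∈ Z, T ∈ K ∧ T.card = 3 := fun T hT => mem_tris.1 (hZ hT)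
  have nons : ∀ x, x ≠ v → x ≠ w' → x ≠ w → {v, x} ∈ K → tdeg K {v, x} = 2 := by
    intro x hxv h1 h2 hxK
    have hc2 : ({v, x} : Finset V).card = 2 := Finset.card_pair hxv.symm
    rcases hK.deg _ hxK hc2 with h | h
    · exact h
    · rcases hw2 x hxv (mem_sedg.2 ⟨hxK, hc2, h⟩) with h | h
      · exact absurd h h1
      · exact absurd h h2
  have edgeK : ∀ T ∈ Z, ∀ x ∈ T, {v, x} ∈ K := fun T hT x hx =>
    face_of hK.cplx (tri T hT).1 (pair_sub (hvZ T hT) hx) (by simp)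
  have F2 : ∀ T ∈ Z, ∀ x ∈ T, x ≠ v → x ≠ w' → x ≠ w → ∃ T' ∈ Z, T' ≠ T ∧ x ∈ T' := by
    intro T hT x hx hxv h1 h2
    have hd2 := nons x hxv h1 h2 (edgeK T hT x hx)
    have hd2' := hd2
    rw [tdeg_eq] at hd2'
    obtain ⟨T', hT', hne⟩ := Finset.exists_mem_ne (by omega : 1 < ((tris K).filter fun T => {v, x} ⊆ T).card) T
    rw [Finset.mem_filter] at hT'
    exact ⟨T', hcl T hT T' hT'.1 _ (edgeK T hT x hx) (Finset.card_pair hxv.symm) hd2 (by simp)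
      (pair_sub (hvZ T hT) hx) hT'.2, hne, hT'.2 (by simp)⟩
  have uniq : ∀ T ∈ Z, ∀ T' ∈ Z, ∀ y x, y ∈ T → y ∈ T' → x ∈ T → x ∈ T' → κ y = κ w' → κ x = r → T = T' := by
    intro T hT T' hT' y x hy hy' hx hx' hyc hxc
    have n1 : v ≠ y := by rintro rfl; exact hcol hyc
    have n2 : v ≠ x := by rintro rfl; exact hvr hxc
    have n3 : y ≠ x := by rintro rfl; exact hwr (hyc.symm.trans hxc)
    rw [eq_triple (hvZ T hT) hy hx n1 n2 n3 (tri T hT).2,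
      eq_triple (hvZ T' hT') hy' hx' n1 n2 n3 (tri T' hT').2]
  classical
  let R := cl K κ r
  let X := R.filter fun x => insert x e ∈ K
  let Q := R.filter fun x => ∃ T ∈ Z, x ∈ T
  have memQ : ∀ T ∈ Z, ∀ x ∈ T, κ x = r → x ∈ Q := by
    intro T hT x hx hxr
    exact Finset.mem_filter.2 ⟨mem_cl.2 ⟨mem_vtx_of hK.cplx (tri T hT).1 hx, hxr⟩, T, hT, hx⟩
  have hX : 3 ≤ X.card := by
    have hsub : ((tris K).filter fun T => e ⊆ T) ⊆ X.image fun x => insert x e := by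
      intro T hT
      rw [Finset.mem_filter] at hT
      obtain ⟨x, hx, hxr⟩ := col_tri hκ hT.1 r
      have hxe : x ∉ e := by
        rw [heq]
        simp only [Finset.mem_insert, Finset.mem_singleton]
        rintro (rfl | rfl)
        · exact hvr hxr
        · exact hwr hxr
      have hTe : insert x e = T := by
        apply Finset.eq_of_subset_of_card_le
        · exact Finset.insert_subset hx hT.2
        · rw [Finset.card_insert_of_notMem hxe, e2, (mem_tris.1 hT.1).2]
      rw [Finset.mem_image]
      refine ⟨x, Finset.mem_filter.2 ⟨mem_cl.2 ⟨mem_vtx_of hK.cplx (mem_tris.1 hT.1).1 hx, hxr⟩, ?_⟩, hTe⟩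
      rw [hTe]; exact (mem_tris.1 hT.1).1
    have h1 := (Finset.card_le_card hsub).trans Finset.card_image_le
    rw [← tdeg_eq, e3] at h1
    exact h1
  have notw' : ∀ T ∈ Z, w' ∉ T := by
    intro T hT hw
    apply hmiss T hT
    rw [heq]
    exact pair_sub (hvZ T hT) hw
  have F3a : ∀ T ∈ Z, ∀ y ∈ T, κ y = κ w' → y ≠ w → 2 ≤ Q.card := by
    intro T hT y hy hyc hyw
    have hyw' : y ≠ w' := by rintro rfl; exact notw' T hT hy
    have hyv : y ≠ v := by rintro rfl; exact hcol hyc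
    obtain ⟨T', hT', hne, hy'⟩ := F2 T hT y hy hyv hyw' hyw
    obtain ⟨x, hx, hxr⟩ := col_tri hκ (hZ hT) r
    obtain ⟨x', hx', hxr'⟩ := col_tri hκ (hZ hT') r
    have hxx : x ≠ x' := by
      rintro rfl
      exact hne (uniq T' hT' T hT y x hy' hy hx' hx hyc hxr)
    rw [← Finset.card_pair hxx]
    exact Finset.card_le_card (pair_sub (memQ T hT x hx hxr) (memQ T' hT' x' hx' hxr'))
  have hQ : 2 ≤ Q.card := by
    obtain ⟨y, hy, hyc⟩ := col_tri hκ (hZ hT0) (κ w')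
    by_cases hyw : y = w
    · obtain ⟨x, hx, hxr⟩ := col_tri hκ (hZ hT0) r
      have hxv : x ≠ v := by rintro rfl; exact hvr hxr
      have hxw' : x ≠ w' := by rintro rfl; exact hwr hxr
      have hxw : x ≠ w := by rintro rfl; subst hyw; exact hwr (hyc.symm.trans hxr)
      obtain ⟨T', hT', hne, hx'⟩ := F2 T0 hT0 x hx hxv hxw' hxw
      obtain ⟨y', hy', hyc'⟩ := col_tri hκ (hZ hT') (κ w')
      apply F3a T' hT' y' hy' hyc'
      rintro rfl
      subst hyw
      exact hne (uniq T' hT' T0 hT0 y x hy' hy hx' hx hyc hxr)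
    · exact F3a T0 hT0 y hy hyc hyw
  have hdis : Disjoint (Q.erase w) X := by
    rw [Finset.disjoint_left]
    intro x hxQ hxX
    rw [Finset.mem_erase, Finset.mem_filter] at hxQ
    obtain ⟨hxw, hxR, T, hT, hxT⟩ := hxQ
    have hxr := (mem_cl.1 hxR).2
    have hxK := (Finset.mem_filter.1 hxX).2
    have hxv : x ≠ v := by rintro rfl; exact hvr hxr
    have hxw' : x ≠ w' := by rintro rfl; exact hwr hxr
    have hxe : x ∉ e := by
      rw [heq]
      simp [hxv, hxw']
    have hT1 : insert x e ∈ Z := hcl T hT _ (mem_tris.2 ⟨hxK, by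
      rw [Finset.card_insert_of_notMem hxe, e2]⟩) {v, x} (edgeK T hT x hxT) (Finset.card_pair hxv.symm)
      (nons x hxv hxw' hxw (edgeK T hT x hxT)) (by simp) (pair_sub (hvZ T hT) hxT)
      (pair_sub (Finset.mem_insert_of_mem hve) (Finset.mem_insert_self _ _))
    exact hmiss _ hT1 (Finset.subset_insert _ _)
  have hsubR : Q.erase w ∪ X ⊆ R :=
    Finset.union_subset ((Finset.erase_subset _ _).trans (Finset.filter_subset _ _)) (Finset.filter_subset _ _)
  have hcard := Finset.card_le_card hsubR
  rw [Finset.card_union_of_disjoint hdis] at hcard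
  have hcr := hc r
  by_cases hwR : w ∈ R
  · have h1 := Finset.pred_card_le_card_erase (s := Q) (a := w)
    have hwne : w ≠ w' := by rintro rfl; exact hwr (mem_cl.1 hwR).2
    have h2 := hK.sdeg_two (hw1.resolve_left hwne) (v := w) (by simp)
    rcases hcr with h3 | ⟨_, h3⟩
    · change R.card ≤ 3 at h3
      omega
    · have := h3 w hwR
      omega
  · have hwQ : Q.erase w = Q := Finset.erase_eq_of_notMem (fun h => hwR (Finset.mem_filter.1 h).1)
    rw [hwQ] at hcard
    have : R.card ≤ 4 := by
      rcases hcr with h3 | ⟨h3, _⟩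
      · exact le_trans h3 (by omega)
      · exact h3
    omega

theorem GoodC.eleven {K : Finset (Finset V)} (hK : GoodC K) {κ : V → Fin 3} (hκ : ProperColoring 2 K κ)
    {v : V} (h : NonTheta K v) : 11 ≤ (vts K).card := by
  by_contra hlt
  have hs : (sedg K).Nonempty := by
    obtain ⟨_, _, _, _, _, e, heK, e2, e3, _, _⟩ := h
    exact ⟨e, mem_sedg.2 ⟨heK, e2, e3⟩⟩
  obtain ⟨h1, h2⟩ := hK.numeric hκ hs (by omega)
  exact theta_contra hK hκ h1 h2 h

theorem dunce_eleven {n : ℕ} {K : Finset (Finset (Fin n))} (hK : IsDunceHatTri K) (hb : BalancedC 2 K) :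
    11 ≤ fnum K 0 := by
  obtain ⟨κ, hκ⟩ := hb
  obtain ⟨hc, ⟨φ⟩⟩ := hK
  obtain ⟨_, ⟨ψ⟩⟩ := K0_dunce
  obtain ⟨hp⟩ := HP.of_homeo (φ.trans ψ.symm)
  have hdim : ∀ F ∈ K, F.card ≤ 3 := by
    intro F hF
    rw [← Finset.card_image_of_injOn (hκ F hF)]
    exact (Finset.card_le_univ _).trans (by simp)
  obtain ⟨hg, v, hv⟩ := transfer_all hc K0_good hdim hp K0_nonTheta
  exact hg.eleven hκ hv

end Comb2

/-- No balanced triangulation of the dunce hat on exactly 10 vertices exists; combined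
with the lower bound `f₀ ≥ 10`, the minimum number of vertices of a balanced
triangulation of the dunce hat is 11, attained by a complex with `f`-vector
`(1, 11, 34, 24)`. -/
theorem stmt10 :
    (∀ (n : ℕ) (K : Finset (Finset (Fin n))), IsDunceHatTri K → BalancedC 2 K →
      fnum K 0 ≠ 10) ∧
    (∀ (n : ℕ) (K : Finset (Finset (Fin n))), IsDunceHatTri K → BalancedC 2 K →
      11 ≤ fnum K 0) ∧
    (∃ (n : ℕ) (K : Finset (Finset (Fin n))), IsDunceHatTri K ∧ BalancedC 2 K ∧
      fnum K 0 = 11 ∧ fnum K 1 = 34 ∧ fnum K 2 = 24) := by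
  refine ⟨fun n K hK hb h => ?_, fun n K hK hb => dunce_eleven hK hb,
    ⟨11, K0, K0_dunce, K0_balanced, K0_f0, K0_f1, K0_f2⟩⟩
  have := dunce_eleven hK hb
  omega
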